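/- Let D be a Stein (Riemann) domain and A ⊂ D. Then A is locally pluripolar in D if and only if A is (globally) pluripolar in D. -/

import Mathlib

open Complex Metric Filter Set MeasureTheory
open scoped Topology Real

noncomputable section

variable {V : Type*} [NormedAddCommGroup V] [NormedSpace ℂ V]

/-- Plurisubharmonic real-valued function on a set in a complex normed space. -/
def PSHOn (u : V → ℝ) (D : Set V) : Prop :=
  UpperSemicontinuousOn u D ∧
  ∀ z ∈ D, ∀ v : V, ∀ᶠ r in 𝓝[>] (0:ℝ),
    u z ≤ (1 / (2 * Real.pi)) *
      ∫ θ in (0:ℝ)..(2 * Real.pi), u (z + (Complex.ofReal r * Complex.exp (θ * Complex.I)) • v)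

/-- `[-∞, ∞)`-valued plurisubharmonic function on a set in a complex normed
space: upper semicontinuous and satisfying the sub-mean value inequality over
small circles, tested against continuous majorants (so that `-∞` values are
allowed). -/
def PSHe (u : V → EReal) (D : Set V) : Prop :=
  UpperSemicontinuousOn u D ∧ (∀ z, u z < ⊤) ∧
  ∀ z ∈ D, ∀ v : V, ∀ᶠ r in 𝓝[>] (0:ℝ),
    ∀ g : ℝ → ℝ, Continuous g →
      (∀ θ : ℝ, u (z + (Complex.ofReal r * Complex.exp (θ * Complex.I)) • v) ≤ (g θ : ℝ)) →
      u z ≤ ((1 / (2 * Real.pi)) * ∫ θ in (0:ℝ)..(2 * Real.pi), g θ : ℝ)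

/-- `A` is pluripolar in `D`: contained in the `-∞` locus of a
plurisubharmonic function on `D` which is not identically `-∞` on any
connected component of `D`. -/
def PluripolarIn (A D : Set V) : Prop :=
  ∃ u : V → EReal, PSHe u D ∧
    (∀ z ∈ D, ∃ w ∈ connectedComponentIn D z, u w ≠ ⊥) ∧
    ∀ a ∈ A, u a = ⊥

/-- `A` is locally pluripolar in `D`. -/
def LocPluripolarIn (A D : Set V) : Prop :=
  ∀ a ∈ A, ∃ U : Set V, IsOpen U ∧ a ∈ U ∧ U ⊆ D ∧ PluripolarIn (A ∩ U) U

/-- A Stein (Riemann) domain in `ℂⁿ`, characterized (via Oka's solution of the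
Levi problem) by the existence of a continuous plurisubharmonic exhaustion
function. -/
def IsSteinDomain (D : Set V) : Prop :=
  IsOpen D ∧ D.Nonempty ∧
    ∃ ψ : V → ℝ, ContinuousOn ψ D ∧ PSHOn ψ D ∧
      ∀ c : ℝ, IsCompact {z ∈ D | ψ z ≤ c}

/-- A continuous function on the unit circle is uniformly close to the real part of a polynomial. -/
theorem exists_polynomial_re_near (g : ℂ → ℝ) (hg : ContinuousOn g (sphere 0 1)) {ε : ℝ}
    (hε : 0 < ε) :
    ∃ p : Polynomial ℂ, ∀ ζ : ℂ, ‖ζ‖ = 1 → |(p.eval ζ).re - g ζ| ≤ ε := by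
  have hspan : ∀ f ∈ Submodule.span ℂ (Set.range (@fourier (1 : ℝ))),
      ∃ p q : Polynomial ℂ, ∀ x : AddCircle (1 : ℝ),
        f x = p.eval (x.toCircle : ℂ) + (starRingEnd ℂ) (q.eval (x.toCircle : ℂ)) := by
    intro f hf
    induction hf using Submodule.span_induction with
    | mem f hf =>
      obtain ⟨k, rfl⟩ := hf
      obtain ⟨m, rfl | rfl⟩ := k.eq_nat_or_neg
      · refine ⟨Polynomial.X ^ m, 0, fun x => ?_⟩
        simp [fourier_apply, AddCircle.toCircle_nsmul]
      · refine ⟨0, Polynomial.X ^ m, fun x => ?_⟩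
        rw [fourier_neg, fourier_apply]
        simp [AddCircle.toCircle_nsmul]
    | zero => exact ⟨0, 0, fun x => by simp⟩
    | add f h _ _ hf hh =>
      obtain ⟨p, q, h1⟩ := hf
      obtain ⟨p', q', h2⟩ := hh
      exact ⟨p + p', q + q', fun x => by simp [h1 x, h2 x]; ring⟩
    | smul c f _ hf =>
      obtain ⟨p, q, h1⟩ := hf
      exact ⟨Polynomial.C c * p, Polynomial.C ((starRingEnd ℂ) c) * q, fun x => by
        simp [h1 x]; ring⟩
  let G : C(AddCircle (1 : ℝ), ℂ) := ⟨fun x => (g (x.toCircle : ℂ) : ℂ), by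
    have h := AddCircle.continuous_toCircle (T := (1:ℝ))
    exact continuous_ofReal.comp (hg.comp_continuous (by fun_prop) (fun x =>
      mem_sphere_zero_iff_norm.2 (Circle.norm_coe _)))⟩
  have hG : G ∈ (Submodule.span ℂ (Set.range (@fourier (1 : ℝ)))).topologicalClosure := by
    rw [span_fourier_closure_eq_top]; trivial
  obtain ⟨f, hf, hfG⟩ := Metric.mem_closure_iff.1 hG ε hε
  obtain ⟨p, q, hpq⟩ := hspan f hf
  refine ⟨p + q, fun ζ hζ => ?_⟩
  obtain ⟨x, hx⟩ : ∃ x : AddCircle (1 : ℝ), (x.toCircle : ℂ) = ζ := by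
    obtain ⟨x, hx⟩ := (AddCircle.homeomorphCircle (T := (1:ℝ)) one_ne_zero).surjective
      ⟨ζ, by simpa [Submonoid.unitSphere] using hζ⟩
    exact ⟨x, by simpa [AddCircle.homeomorphCircle_apply] using congrArg Subtype.val hx⟩
  have h1 : ‖G x - f x‖ ≤ ε := by
    rw [← dist_eq_norm]; exact (ContinuousMap.dist_apply_le_dist x).trans hfG.le
  have h2 : ((p + q).eval ζ).re = (f x).re := by
    rw [hpq x, hx]; simp
  rw [h2, abs_sub_comm]
  calc |g ζ - (f x).re| = |(G x - f x).re| := by simp [G, hx]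
    _ ≤ _ := (abs_re_le_norm _).trans h1

theorem circleIntegrable_of_continuous {g : ℂ → ℝ} (hg : Continuous g) (c : ℂ) (R : ℝ) :
    CircleIntegrable g c R := hg.continuousOn.circleIntegrable'

theorem circleAverage_re_polynomial (p : Polynomial ℂ) :
    Real.circleAverage (fun ζ => (p.eval ζ).re) 0 1 = (p.eval 0).re := by
  have h := Complex.reCLM.circleAverage_comp_comm (f := fun ζ => p.eval ζ) (c := 0) (R := 1)
    (p.continuous.continuousOn.circleIntegrable')
  have h2 := DiffContOnCl.circleAverage (f := fun ζ => p.eval ζ) (c := 0) (R := 1)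
    (p.differentiable.diffContOnCl)
  rw [h2] at h
  exact h

theorem circleAverage_near {g h : ℂ → ℝ} (hg : Continuous g) (hh : Continuous h) {ε : ℝ}
    (hgh : ∀ ζ : ℂ, ‖ζ‖ = 1 → g ζ ≤ h ζ + ε) :
    Real.circleAverage g 0 1 ≤ Real.circleAverage h 0 1 + ε := by
  have := Real.circleAverage_mono (c := 0) (R := 1) (f₁ := g) (f₂ := fun ζ => h ζ + ε)
    (circleIntegrable_of_continuous hg _ _) (circleIntegrable_of_continuous (by fun_prop) _ _)
    (fun ζ hζ => hgh ζ (by simpa using hζ))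
  rwa [Real.circleAverage_fun_add (circleIntegrable_of_continuous hh _ _)
    (circleIntegrable_of_continuous continuous_const _ _), Real.circleAverage_const] at this

theorem countable_zeros {F : ℂ → ℂ} (hF : Differentiable ℂ F) (h0 : F 0 ≠ 0) :
    {z | F z = 0}.Countable := by
  have h := AnalyticOnNhd.preimage_zero_mem_codiscrete (𝕜 := ℂ) (f := F) (x := 0)
    (fun z _ => hF.analyticAt z) h0
  have h2 := (mem_codiscrete'.1 h).2
  have h3 : (F ⁻¹' {0}ᶜ)ᶜ = {z | F z = 0} := by ext; simp
  rw [h3] at h2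
  exact (HereditarilyLindelofSpace.isLindelof _).countable_of_isDiscrete h2

/-- Jensen's inequality for an entire function dominated on the unit circle. -/
theorem log_norm_le_mean {F : ℂ → ℂ} (hF : Differentiable ℂ F) (h0 : F 0 ≠ 0) {g : ℝ → ℝ}
    (hg : Continuous g) (h : ∀ θ ∈ Icc (0:ℝ) (2 * π), ‖F (exp (θ * I))‖ ≤ Real.exp (g θ)) :
    Real.log ‖F 0‖ ≤ 1 / (2 * π) * ∫ θ in (0:ℝ)..(2 * π), g θ := by
  have han : AnalyticOnNhd ℂ F (closedBall 0 |1|) := fun z _ => hF.analyticAt z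
  have hJ := han.circleAverage_log_norm one_ne_zero h0
  have hpos : 0 ≤ ∑ᶠ u, MeromorphicOn.divisor F (closedBall 0 |1|) u *
      Real.log (1 * ‖(0:ℂ) - u‖⁻¹) := by
    refine finsum_nonneg fun u => ?_
    by_cases hu : u ∈ closedBall (0:ℂ) |1|
    · refine mul_nonneg (mod_cast MeromorphicOn.AnalyticOnNhd.divisor_nonneg han u) ?_
      rcases eq_or_ne u 0 with rfl | hu0
      · simp
      · refine Real.log_nonneg ?_
        rw [one_mul]
        refine (one_le_inv₀ (by simpa using hu0)).2 (by simpa using hu)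
    · rw [Function.locallyFinsuppWithin.apply_eq_zero_of_notMem _ hu]; simp
  have h1 : Real.log ‖F 0‖ ≤ Real.circleAverage (Real.log ‖F ·‖) 0 1 := by linarith
  refine h1.trans ?_
  rw [Real.circleAverage_def, smul_eq_mul, one_div]
  refine mul_le_mul_of_nonneg_left ?_ (by positivity)
  have hci : CircleIntegrable (Real.log ‖F ·‖) 0 1 :=
    (han.mono sphere_subset_closedBall).meromorphicOn.circleIntegrable_log_norm
  refine intervalIntegral.integral_mono_ae_restrict (by positivity) hci (hg.intervalIntegrable _ _) ?_
  have hc := ((countable_zeros hF h0).preimage_circleMap 0 one_ne_zero).ae_notMem volume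
  filter_upwards [ae_restrict_of_ae hc, ae_restrict_mem measurableSet_Icc] with θ hθ hθI
  have h2 : circleMap 0 1 θ = exp (θ * I) := by simp [circleMap]
  simp only [Set.mem_preimage, Set.mem_ofPred_eq, h2] at hθ ⊢
  rw [Real.log_le_iff_le_exp (norm_pos_iff.2 hθ)]
  exact h θ hθI

theorem norm_le_of_circle {F : ℂ → ℂ} (hF : Differentiable ℂ F) {C : ℝ}
    (h : ∀ ζ : ℂ, ‖ζ‖ = 1 → ‖F ζ‖ ≤ C) {ζ : ℂ} (hζ : ‖ζ‖ ≤ 1) : ‖F ζ‖ ≤ C := by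
  refine norm_le_of_forall_mem_frontier_norm_le (U := ball (0:ℂ) 1) isBounded_ball
    hF.diffContOnCl (fun z hz => h z ?_) ?_
  · rw [frontier_ball _ one_ne_zero] at hz; simpa using hz
  · rw [closure_ball _ one_ne_zero]; simpa using hζ

/-- If `a ^ j * H` is small on the unit disc, where `‖a‖ ≤ 1` and `a 0` is not too small, then
`H` is small near the origin. -/
theorem norm_le_of_pow_mul_norm_le {a H : ℂ → ℂ} (ha : Differentiable ℂ a)
    (hH : Differentiable ℂ H) (ha1 : ∀ ζ : ℂ, ‖ζ‖ ≤ 1 → ‖a ζ‖ ≤ 1) {M : ℝ}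
    (ha0 : Real.exp (-M) ≤ ‖a 0‖) {j : ℕ} {ε : ℝ}
    (h : ∀ ζ : ℂ, ‖ζ‖ ≤ 1 → ‖a ζ ^ j * H ζ‖ ≤ ε) {y : ℂ} (hy : ‖y‖ ≤ 1 / 4) :
    ‖H y‖ ≤ ε * Real.exp (j * (8 + 3 * M)) := by
  have ha00 : a 0 ≠ 0 := norm_pos_iff.1 ((Real.exp_pos _).trans_le ha0)
  have hε : 0 ≤ ε := (norm_nonneg _).trans (h 0 (by simp))
  obtain ⟨s, hs, hs12⟩ : ∃ s ∈ ((fun z : ℂ => ‖z‖) '' {z | a z = 0})ᶜ, s ∈ Ioo (1 / 2 : ℝ) 1 := by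
    have := ((countable_zeros ha ha00).image (fun z : ℂ => ‖z‖)).dense_compl ℝ
    obtain ⟨s, h1, h2⟩ := this.exists_mem_open (isOpen_Ioo (a := (1 / 2 : ℝ)) (b := 1))
      (nonempty_Ioo.2 (by norm_num))
    exact ⟨s, h1, h2⟩
  obtain ⟨hs1, hs2⟩ := hs12
  have hs0 : 0 < s := by linarith
  have hsn : ∀ ζ : ℂ, ‖(s : ℂ) * ζ‖ = s * ‖ζ‖ := fun ζ => by
    rw [norm_mul, norm_real, Real.norm_eq_abs, abs_of_pos hs0]
  have hs1' : ∀ ζ : ℂ, ‖ζ‖ ≤ 1 → ‖(s : ℂ) * ζ‖ ≤ 1 := fun ζ hζ => by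
    rw [hsn]; nlinarith [norm_nonneg ζ]
  have hne : ∀ ζ : ℂ, ‖ζ‖ = 1 → a (s * ζ) ≠ 0 := fun ζ hζ h0 => hs
    ⟨s * ζ, h0, by simp only [hsn, hζ, mul_one]⟩
  obtain ⟨p, hp⟩ := exists_polynomial_re_near (fun ζ => Real.log ‖a (s * ζ)‖) (by
    refine ContinuousOn.log ?_ fun ζ hζ => norm_ne_zero_iff.2 (hne ζ (mem_sphere_zero_iff_norm.1 hζ))
    have := ha.continuous
    fun_prop) one_pos
  have hpd : Differentiable ℂ (fun ζ => p.eval ζ) := p.differentiable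
  have hre1 : ∀ ζ : ℂ, ‖ζ‖ ≤ 1 → (p.eval ζ).re ≤ 1 := fun ζ hζ => by
    have := norm_le_of_circle (F := fun ζ => exp (p.eval ζ)) (by fun_prop) (C := Real.exp 1)
      (fun ζ hζ => by
        rw [norm_exp, Real.exp_le_exp]
        have h1 := (abs_le.1 (hp ζ hζ)).2
        have h2 := Real.log_nonpos (norm_nonneg _) (ha1 _ (hs1' ζ hζ.le))
        linarith) hζ
    rwa [norm_exp, Real.exp_le_exp] at this
  have hre0 : -M - 1 ≤ (p.eval 0).re := by
    have := norm_le_of_circle (F := fun ζ => a (s * ζ) * exp (-p.eval ζ)) (by fun_prop)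
      (C := Real.exp 1) (fun ζ hζ => by
        rw [norm_mul, norm_exp, ← Real.exp_log (norm_pos_iff.2 (hne ζ hζ)), ← Real.exp_add,
          Real.exp_le_exp]
        have h1 := (abs_le.1 (hp ζ hζ)).1
        simp only [neg_re]; linarith) (ζ := 0) (by simp)
    rw [mul_zero, norm_mul, norm_exp, neg_re] at this
    have h3 : Real.exp (-M) * Real.exp (-(p.eval 0).re) ≤ Real.exp 1 :=
      (mul_le_mul_of_nonneg_right ha0 (Real.exp_pos _).le).trans this
    rw [← Real.exp_add, Real.exp_le_exp] at h3
    linarith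
  have hHs : ∀ ζ : ℂ, ‖ζ‖ ≤ 1 → ‖H (s * ζ)‖ ≤ ε * Real.exp (j - j * (p.eval ζ).re) := by
    intro ζ hζ
    have := norm_le_of_circle (F := fun ζ => H (s * ζ) * exp (j * p.eval ζ)) (by fun_prop)
      (C := ε * Real.exp j) (fun ζ hζ => by
        have h1 := (abs_le.1 (hp ζ hζ)).2
        have h2 := h _ (hs1' ζ hζ.le)
        have h3 : Real.exp (j * (p.eval ζ).re) ≤ ‖a (s * ζ)‖ ^ j * Real.exp j := by
          have h4 := Real.exp_log (norm_pos_iff.2 (hne ζ hζ))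
          have h5 : (p.eval ζ).re ≤ Real.log ‖a (s * ζ)‖ + 1 := by linarith
          calc Real.exp (j * (p.eval ζ).re) = Real.exp ((p.eval ζ).re) ^ j := by
                rw [← Real.exp_nat_mul]
            _ ≤ Real.exp (Real.log ‖a (s * ζ)‖ + 1) ^ j := by gcongr
            _ = _ := by rw [Real.exp_add, h4, mul_pow, ← Real.exp_nat_mul, mul_one]
        have h6 : (j * p.eval ζ).re = j * (p.eval ζ).re := by simp
        rw [norm_mul, norm_exp, h6]
        calc _ ≤ ‖H (s * ζ)‖ * (‖a (s * ζ)‖ ^ j * Real.exp j) := by gcongr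
          _ = ‖a (s * ζ) ^ j * H (s * ζ)‖ * Real.exp j := by rw [norm_mul, norm_pow]; ring
          _ ≤ _ := by gcongr) hζ
    have h6 : (j * p.eval ζ).re = j * (p.eval ζ).re := by simp
    rw [norm_mul, norm_exp, h6] at this
    calc ‖H (s * ζ)‖ = ‖H (s * ζ)‖ * Real.exp (j * (p.eval ζ).re)
          * Real.exp (-(j * (p.eval ζ).re)) := by
          rw [mul_assoc, ← Real.exp_add]; simp
      _ ≤ ε * Real.exp j * Real.exp (-(j * (p.eval ζ).re)) := by gcongr
      _ = _ := by rw [mul_assoc, ← Real.exp_add]; ring_nf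
  have hζ : ‖y / s‖ ≤ 1 / 2 := by
    rw [norm_div, norm_real, Real.norm_eq_abs, abs_of_pos hs0, div_le_iff₀ hs0]; linarith
  have hBC := borelCaratheodory_zero (f := fun ζ => p.eval ζ - p.eval 0)
    (M := 2 - (p.eval 0).re) (R := 1) (z := y / s) (by linarith [hre1 0 (by simp)])
    (by fun_prop) (fun ζ hζ => by
      simp only [Set.mem_ofPred_eq, sub_re]
      linarith [hre1 ζ (by simpa using (mem_ball_zero_iff.1 hζ).le)])
    one_pos (by rw [mem_ball_zero_iff]; linarith) (by simp)
  have hM := hre1 0 (by simp)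
  have h7 : 2 * (2 - (p.eval 0).re) * ‖y / s‖ / (1 - ‖y / s‖) ≤ 2 * (2 - (p.eval 0).re) := by
    rw [div_le_iff₀ (by linarith)]
    nlinarith
  have h8 := (neg_le_abs _).trans ((abs_re_le_norm _).trans (hBC.trans h7))
  rw [sub_re] at h8
  have h9 := hHs (y / s) (by linarith)
  rw [mul_div_cancel₀ _ (by exact_mod_cast hs0.ne')] at h9
  refine h9.trans ?_
  gcongr
  have : (0:ℝ) ≤ j := by positivity
  nlinarith

/-- An entire function vanishing on a finite set is divisible by the corresponding product. -/
theorem exists_eq_prod_mul (s : Finset ℂ) {F : ℂ → ℂ} (hF : Differentiable ℂ F)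
    (h : ∀ z ∈ s, F z = 0) :
    ∃ Q : ℂ → ℂ, Differentiable ℂ Q ∧ ∀ z, F z = (∏ c ∈ s, (z - c)) * Q z := by
  induction s using Finset.induction_on generalizing F with
  | empty => exact ⟨F, hF, fun z => by simp⟩
  | insert c s hc ih =>
    have hd : Differentiable ℂ (dslope F c) := by
      rw [← differentiableOn_univ] at hF ⊢
      exact (differentiableOn_dslope univ_mem).2 hF
    have hFc : ∀ z, F z = (z - c) * dslope F c z := fun z => by
      have := sub_smul_dslope F c z
      rw [h c (by simp), sub_zero, smul_eq_mul] at this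
      exact this.symm
    obtain ⟨Q, hQ, hQs⟩ := ih hd (fun z hz => by
      have h1 := hFc z
      rw [h z (by simp [hz])] at h1
      have h2 : z - c ≠ 0 := sub_ne_zero.2 (fun h => hc (h ▸ hz))
      exact (mul_eq_zero.1 h1.symm).resolve_left h2)
    exact ⟨Q, hQ, fun z => by rw [hFc z, hQs z, Finset.prod_insert hc, mul_assoc]⟩

/-- The grid of `L` equidistributed points on the circle of radius `1 / 4`. -/
def circGrid (L : ℕ) : Finset ℂ := (Polynomial.nthRootsFinset L (1 : ℂ)).image (fun ω => ω / 4)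

theorem mem_circGrid {L : ℕ} (hL : 0 < L) {g : ℂ} : g ∈ circGrid L ↔ (4 * g) ^ L = 1 := by
  simp only [circGrid, Finset.mem_image, Polynomial.mem_nthRootsFinset hL]
  constructor
  · rintro ⟨ω, h, rfl⟩
    rw [← h]; congr 1; ring
  · intro h
    exact ⟨4 * g, h, by ring⟩

theorem norm_of_mem_circGrid {L : ℕ} (hL : 0 < L) {g : ℂ} (hg : g ∈ circGrid L) :
    ‖g‖ = 1 / 4 := by
  have h := (mem_circGrid hL).1 hg
  have h2 := norm_eq_one_of_pow_eq_one h hL.ne'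
  rw [norm_mul] at h2
  norm_num at h2
  linarith

theorem card_circGrid {L : ℕ} (hL : 0 < L) : (circGrid L).card = L := by
  rw [circGrid, Finset.card_image_of_injective _ (fun a b h => by simpa using h)]
  exact (isPrimitiveRoot_exp L hL.ne').card_nthRootsFinset

theorem prod_circGrid {L : ℕ} (hL : 0 < L) (z : ℂ) :
    ∏ c ∈ circGrid L, (z - c) = z ^ L - (1 / 4) ^ L := by
  rw [circGrid, Finset.prod_image (fun a _ b _ h => by simpa using h),
    (isPrimitiveRoot_exp L hL.ne').pow_sub_pow_eq_prod_sub_mul z (1 / 4) hL]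
  exact Finset.prod_congr rfl fun c _ => by ring

/-- A bounded entire function which is small on the grid is small on the disc of radius `1 / 4`. -/
theorem norm_le_of_circGrid {F : ℂ → ℂ} (hF : Differentiable ℂ F) {L : ℕ} (hL : 0 < L)
    {B η : ℝ} (hB : ∀ ζ : ℂ, ‖ζ‖ ≤ 1 → ‖F ζ‖ ≤ B) (hη : ∀ g ∈ circGrid L, ‖F g‖ ≤ η)
    (hBη : B * (1 / 4) ^ L ≤ η) {ζ : ℂ} (hζ : ‖ζ‖ ≤ 1 / 4) : ‖F ζ‖ ≤ 8 * L * η := by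
  have hL1 : (1:ℝ) ≤ L := by exact_mod_cast hL
  have hB0 : 0 ≤ B := (norm_nonneg _).trans (hB 0 (by simp))
  have hη0 : 0 ≤ η := le_trans (by positivity) hBη
  let P : ℂ → ℂ := fun z => ∑ g ∈ circGrid L, F g * ((1 / L) * ∑ i ∈ Finset.range L, (z / g) ^ i)
  have hPd : Differentiable ℂ P := by
    intro z; simp only [P]; fun_prop
  have hPb : ∀ z : ℂ, ∀ r : ℝ, 1 ≤ r → ‖z‖ ≤ r * (1 / 4) → ‖P z‖ ≤ L * η * r ^ L := by
    intro z r hr hz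
    have h1 : ∀ g ∈ circGrid L, ‖F g * ((1 / L) * ∑ i ∈ Finset.range L, (z / g) ^ i)‖
        ≤ η * r ^ L := by
      intro g hg
      rw [norm_mul]
      refine mul_le_mul (hη g hg) ?_ (norm_nonneg _) hη0
      rw [norm_mul, norm_div, norm_one, Complex.norm_natCast, one_div,
        inv_mul_le_iff₀ (by positivity)]
      refine (norm_sum_le _ _).trans ?_
      refine (Finset.sum_le_card_nsmul _ _ (r ^ L) fun i hi => ?_).trans ?_
      · rw [norm_pow, norm_div, norm_of_mem_circGrid hL hg]
        have h2 : ‖z‖ / (1 / 4) ≤ r := by rw [div_le_iff₀ (by norm_num)]; exact hz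
        calc _ ≤ r ^ i := by gcongr
          _ ≤ r ^ L := pow_le_pow_right₀ hr (Finset.mem_range.1 hi).le
      · simp
    refine (norm_sum_le _ _).trans ((Finset.sum_le_card_nsmul _ _ _ h1).trans ?_)
    rw [card_circGrid hL, nsmul_eq_mul, mul_assoc]
  have hPg : ∀ g ∈ circGrid L, P g = F g := by
    intro g hg
    have hg0 : ∀ g ∈ circGrid L, g ≠ 0 := fun g hg h0 => by
      have := norm_of_mem_circGrid hL hg; rw [h0, norm_zero] at this; norm_num at this
    have hLc : (L : ℂ) ≠ 0 := by exact_mod_cast hL.ne'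
    rw [show P g = ∑ g' ∈ circGrid L, F g' * ((1 / L) * ∑ i ∈ Finset.range L, (g / g') ^ i)
      from rfl, Finset.sum_eq_single_of_mem g hg]
    · rw [div_self (hg0 g hg)]; simp [hLc]
    · intro g' hg' hne
      have h1 : g / g' ≠ 1 := fun h => hne (by
        rw [div_eq_one_iff_eq (hg0 g' hg')] at h; exact h.symm)
      have h2 : (g / g') ^ L = 1 := by
        have e1 := (mem_circGrid hL).1 hg
        have e2 := (mem_circGrid hL).1 hg'
        rw [show g / g' = (4 * g) / (4 * g') by rw [mul_div_mul_left _ _ (by norm_num)], div_pow,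
          e1, e2, div_one]
      rw [geom_sum_eq h1, h2]; simp
  obtain ⟨Q, hQ, hQs⟩ := exists_eq_prod_mul (circGrid L) (F := fun z => F z - P z)
    (hF.sub hPd) (fun z hz => by simp [hPg z hz])
  have h4L : (1 / 4 : ℝ) ^ L ≤ 1 / 4 := by
    calc (1 / 4 : ℝ) ^ L ≤ (1 / 4) ^ 1 := pow_le_pow_of_le_one (by norm_num) (by norm_num) hL
      _ = _ := by norm_num
  have hQb : ‖Q ζ‖ ≤ 4 / 3 * (B + L * η * 4 ^ L) := by
    refine norm_le_of_circle hQ (fun z hz => ?_) (by linarith)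
    have h1 := hQs z
    rw [prod_circGrid hL] at h1
    have h2 : 3 / 4 ≤ ‖z ^ L - (1 / 4) ^ L‖ := by
      have := norm_sub_norm_le (z ^ L) ((1 / 4 : ℂ) ^ L)
      rw [norm_pow, hz, one_pow, norm_pow] at this
      norm_num at this h4L ⊢
      linarith
    have h3 : ‖F z - P z‖ ≤ B + L * η * 4 ^ L :=
      (norm_sub_le _ _).trans (add_le_add (hB z hz.le) (hPb z 4 (by norm_num) (by
        rw [hz]; norm_num)))
    rw [h1, norm_mul] at h3
    nlinarith [norm_nonneg (Q z)]
  have h5 : ‖F ζ - P ζ‖ ≤ 2 * (1 / 4) ^ L * (4 / 3 * (B + L * η * 4 ^ L)) := by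
    have h1 := hQs ζ
    rw [prod_circGrid hL] at h1
    rw [h1, norm_mul]
    refine mul_le_mul ?_ hQb (norm_nonneg _) (by positivity)
    refine (norm_sub_le _ _).trans ?_
    rw [norm_pow, norm_pow, two_mul]
    have : ‖(1 / 4 : ℂ)‖ = 1 / 4 := by norm_num
    rw [this]
    gcongr
  have h6 := hPb ζ 1 le_rfl (by linarith)
  have h7 : (1 / 4 : ℝ) ^ L * 4 ^ L = 1 := by rw [← mul_pow]; norm_num
  have h8 : ‖F ζ‖ ≤ ‖F ζ - P ζ‖ + ‖P ζ‖ := by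
    simpa using norm_add_le (F ζ - P ζ) (P ζ)
  have h9 : 2 * (1 / 4) ^ L * (4 / 3 * (B + L * η * 4 ^ L))
      = 8 / 3 * (B * (1 / 4) ^ L) + 8 / 3 * L * η * ((1 / 4 : ℝ) ^ L * 4 ^ L) := by ring
  rw [h9, h7] at h5
  rw [one_pow] at h6
  nlinarith

/-- The grid estimate in several variables. -/
theorem norm_le_of_grid {n : ℕ} {F : (Fin n → ℂ) → ℂ} (hF : Differentiable ℂ F) {L : ℕ}
    (hL : 0 < L) {B η : ℝ} (hB : ∀ y : Fin n → ℂ, ‖y‖ ≤ 1 → ‖F y‖ ≤ B)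
    (hη : ∀ y : Fin n → ℂ, (∀ i, y i ∈ circGrid L) → ‖F y‖ ≤ η)
    (hBη : B * (1 / 4) ^ L ≤ η) {y : Fin n → ℂ} (hy : ‖y‖ ≤ 1 / 4) :
    ‖F y‖ ≤ (8 * L) ^ n * η := by
  have hL1 : (1:ℝ) ≤ L := by exact_mod_cast hL
  have hB0 : 0 ≤ B := (norm_nonneg _).trans (hB 0 (by simp))
  have hη0 : 0 ≤ η := le_trans (by positivity) hBη
  have key : ∀ k ≤ n, ∀ y : Fin n → ℂ, (∀ i : Fin n, i.1 < k → ‖y i‖ ≤ 1 / 4) →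
      (∀ i : Fin n, k ≤ i.1 → y i ∈ circGrid L) → ‖F y‖ ≤ (8 * L) ^ k * η := by
    intro k
    induction k with
    | zero => intro _ y _ h; simpa using hη y fun i => h i (Nat.zero_le _)
    | succ k ih =>
      intro hk y h1 h2
      let i₀ : Fin n := ⟨k, hk⟩
      have hd : Differentiable ℂ (fun ζ : ℂ => F (Function.update y i₀ ζ)) := by
        refine hF.comp fun ζ => ?_
        exact (hasFDerivAt_update y ζ).differentiableAt
      have hn : ∀ i : Fin n, i ≠ i₀ → ‖y i‖ ≤ 1 / 4 := fun i hi => by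
        by_cases hik : i.1 < k
        · exact h1 i (by omega)
        · exact (norm_of_mem_circGrid hL (h2 i (by
            have : i.1 ≠ k := fun h => hi (Fin.ext h)
            omega))).le
      have := norm_le_of_circGrid hd hL (B := B) (η := (8 * L) ^ k * η) (fun ζ hζ => hB _ (by
          rw [pi_norm_le_iff_of_nonneg zero_le_one]
          intro i
          by_cases hi : i = i₀
          · subst hi; simpa using hζ
          · rw [Function.update_of_ne hi]; linarith [hn i hi]))
        (fun g hg => ih (by omega) _ (fun i hi => by
            have hi' : i ≠ i₀ := fun h => by rw [h] at hi; simp [i₀] at hi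
            rw [Function.update_of_ne hi']; exact hn i hi')
          (fun i hi => by
            by_cases hi' : i = i₀
            · subst hi'; simpa using hg
            · rw [Function.update_of_ne hi']
              exact h2 i (by
                have : i.1 ≠ k := fun h => hi' (Fin.ext h)
                omega)))
        (hBη.trans (le_mul_of_one_le_left hη0 (one_le_pow₀ (by linarith))))
        (ζ := y i₀) (h1 i₀ (by simp [i₀]))
      rw [Function.update_eq_self] at this
      rw [pow_succ]
      linarith
  refine key n le_rfl y (fun i _ => (norm_le_pi_norm y i).trans hy) fun i hi => absurd i.2 (by omega)

theorem floor_box {a b s : ℝ} (ha : 0 ≤ a * s) (hb : 0 ≤ b * s) (hs : 0 < s)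
    (h : ⌊a * s⌋₊ = ⌊b * s⌋₊) : |a - b| ≤ 1 / s := by
  have h1 := Nat.floor_le ha
  have h2 := Nat.lt_floor_add_one (a * s)
  have h3 := Nat.floor_le hb
  have h4 := Nat.lt_floor_add_one (b * s)
  rw [h] at h1 h2
  have h5 : |a - b| * s = |a * s - b * s| := by rw [← sub_mul, abs_mul, abs_of_pos hs]
  rw [le_div_iff₀ hs, h5, abs_le]
  constructor <;> linarith

/-- Siegel's lemma: the pigeonhole principle for small integer combinations of complex vectors. -/
theorem exists_int_combination {ι X : Type*} [Fintype ι] [Fintype X] (v : ι → X → ℂ) {N T : ℕ}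
    (hT : 2 ≤ T) {B : ℝ} (hB : 0 < B) (hv : ∀ c : ι → Fin N, ∀ x, ‖∑ i, (c i : ℂ) * v i x‖ ≤ B)
    (hcard : (T * T) ^ Fintype.card X < N ^ Fintype.card ι) :
    ∃ c : ι → ℤ, c ≠ 0 ∧ (∀ i, |c i| ≤ N) ∧ ∀ x, ‖∑ i, (c i : ℂ) * v i x‖ ≤ 8 * B / T := by
  classical
  set s : ℝ := T / (4 * B) with hs
  have hT0 : (2:ℝ) ≤ T := by exact_mod_cast hT
  have hs0 : 0 < s := by positivity
  have hbox : ∀ t : ℝ, |t| ≤ B → 0 ≤ (t + B) * s ∧ ⌊(t + B) * s⌋₊ < T := by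
    intro t ht
    have h1 := abs_le.1 ht
    have h0 : 0 ≤ (t + B) * s := mul_nonneg (by linarith) hs0.le
    refine ⟨h0, (Nat.floor_lt h0).2 ?_⟩
    calc (t + B) * s ≤ (2 * B) * s := by gcongr; linarith
      _ = T / 2 := by rw [hs]; field_simp; norm_num
      _ < T := by linarith
  let F : (ι → Fin N) → X → ℂ := fun c x => ∑ i, (c i : ℂ) * v i x
  have hre : ∀ c x, |(F c x).re| ≤ B := fun c x => (abs_re_le_norm _).trans (hv c x)
  have him : ∀ c x, |(F c x).im| ≤ B := fun c x => (abs_im_le_norm _).trans (hv c x)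
  let Φ : (ι → Fin N) → X → Fin T × Fin T := fun c x =>
    (⟨_, (hbox _ (hre c x)).2⟩, ⟨_, (hbox _ (him c x)).2⟩)
  obtain ⟨c, c', hne, hΦ⟩ := Fintype.exists_ne_map_eq_of_card_lt Φ (by
    simpa only [Fintype.card_fun, Fintype.card_prod, Fintype.card_fin] using hcard)
  refine ⟨fun i => (c i : ℤ) - (c' i : ℤ), fun h => hne ?_, fun i => ?_, fun x => ?_⟩
  · funext i
    have := congrFun h i
    simp only [Pi.zero_apply] at this
    exact Fin.ext (by omega)
  · have h1 := (c i).2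
    have h2 := (c' i).2
    simp only [abs_le]; constructor <;> omega
  · have h1 : ∑ i, (((c i : ℤ) - (c' i : ℤ) : ℤ) : ℂ) * v i x = F c x - F c' x := by
      simp only [F, ← Finset.sum_sub_distrib, ← sub_mul]
      push_cast; rfl
    rw [h1]
    have h2 := congrFun hΦ x
    simp only [Φ, Prod.mk.injEq, Fin.mk.injEq] at h2
    have e1 := floor_box (hbox _ (hre c x)).1 (hbox _ (hre c' x)).1 hs0 h2.1
    have e2 := floor_box (hbox _ (him c x)).1 (hbox _ (him c' x)).1 hs0 h2.2
    refine (norm_le_abs_re_add_abs_im _).trans ?_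
    rw [sub_re, sub_im]
    have e3 : (F c x).re + B - ((F c' x).re + B) = (F c x).re - (F c' x).re := by ring
    have e4 : (F c x).im + B - ((F c' x).im + B) = (F c x).im - (F c' x).im := by ring
    rw [e3] at e1
    rw [e4] at e2
    have e5 : 1 / s + 1 / s = 8 * B / T := by rw [hs]; field_simp; norm_num
    linarith

/-- Evaluation of the polynomial with integer coefficients `q`, of degree `< d` in each variable. -/
def evalCoef {n d : ℕ} (q : (Fin n → Fin d) → ℤ) (z : Fin n → ℂ) : ℂ :=
  ∑ α, (q α : ℂ) * ∏ i, z i ^ (α i : ℕ)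

theorem norm_monomial_le {n d : ℕ} {Λ : ℝ} (hΛ : 1 ≤ Λ) {z : Fin n → ℂ} (hz : ‖z‖ ≤ Λ)
    (α : Fin n → Fin d) : ‖∏ i, z i ^ (α i : ℕ)‖ ≤ Λ ^ (n * d) := by
  rw [norm_prod]
  calc ∏ i, ‖z i ^ (α i : ℕ)‖ ≤ ∏ _i : Fin n, Λ ^ d := by
        refine Finset.prod_le_prod (fun _ _ => norm_nonneg _) fun i _ => ?_
        rw [norm_pow]
        calc ‖z i‖ ^ (α i : ℕ) ≤ Λ ^ (α i : ℕ) := by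
              gcongr; exact (norm_le_pi_norm z i).trans hz
          _ ≤ Λ ^ d := pow_le_pow_right₀ hΛ (α i).2.le
    _ = _ := by rw [Finset.prod_const, Finset.card_univ, Fintype.card_fin, ← pow_mul, mul_comm]

theorem norm_evalCoef_le {n d : ℕ} {q : (Fin n → Fin d) → ℤ} {N Λ : ℝ} (hN : 0 ≤ N)
    (hq : ∀ α, |(q α : ℝ)| ≤ N) (hΛ : 1 ≤ Λ) {z : Fin n → ℂ} (hz : ‖z‖ ≤ Λ) :
    ‖evalCoef q z‖ ≤ d ^ n * N * Λ ^ (n * d) := by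
  refine (norm_sum_le _ _).trans ?_
  refine (Finset.sum_le_card_nsmul _ _ (N * Λ ^ (n * d)) fun α _ => ?_).trans_eq ?_
  · rw [norm_mul, norm_intCast]
    exact mul_le_mul (hq α) (norm_monomial_le hΛ hz α) (norm_nonneg _) hN
  · simp [mul_assoc]

/-- From an entire function `f` bounded by `1` and not too small at `0`, the pigeonhole principle
produces an integer polynomial which is small where `f` is very small. -/
theorem exists_coef_small {n : ℕ} {f : (Fin n → ℂ) → ℂ} (hf : Differentiable ℂ f)
    (hf1 : ∀ y, ‖y‖ ≤ 1 → ‖f y‖ ≤ 1) {M K ρ Λ : ℝ} (hM : 0 ≤ M)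
    (hf0 : Real.exp (-M) ≤ ‖f 0‖) {c : Fin n → ℂ}
    (hρ : 0 < ρ) (hΛ1 : 1 ≤ Λ) (hΛ : ‖c‖ + ρ ≤ Λ) {d ℓ h : ℕ} (hd : 0 < d) (hℓ : 0 < ℓ)
    (hh : h = 2 * ℓ ^ (n + 1) + 1) :
    ∃ q : (Fin n → Fin d) → ℤ, q ≠ 0 ∧ (∀ α, |(q α : ℝ)| ≤ 2 ^ d) ∧
      ∀ y, ‖y‖ ≤ 1 / 16 → ‖f y‖ ≤ Real.exp (-K) →
        ‖evalCoef q (c + (ρ : ℂ) • y)‖ ≤ (h * (d ^ n * 2 ^ d * Λ ^ (n * d))) *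
          ((8 * (ℓ * d)) ^ n * 8 / 2 ^ (ℓ * d) * Real.exp (h * (8 + 3 * M)) + Real.exp (-K)) := by
  classical
  set L := ℓ * d with hL
  have hL0 : 0 < L := Nat.mul_pos hℓ hd
  set B₁ : ℝ := d ^ n * 2 ^ d * Λ ^ (n * d) with hB₁
  have hΛ0 : 0 < Λ := by linarith
  have hd0 : (0:ℝ) < d := by exact_mod_cast hd
  have hB₁0 : 0 < B₁ := by positivity
  have hh0 : (0:ℝ) < h := by rw [hh]; positivity
  have hz : ∀ y : Fin n → ℂ, ‖y‖ ≤ 1 → ‖c + (ρ : ℂ) • y‖ ≤ Λ := fun y hy => by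
    refine (norm_add_le _ _).trans (le_trans ?_ hΛ)
    rw [norm_smul, norm_real, Real.norm_eq_abs, abs_of_pos hρ]
    nlinarith
  have hev : ∀ (q : (Fin n → Fin d) → ℤ), (∀ α, |(q α : ℝ)| ≤ 2 ^ d) → ∀ y, ‖y‖ ≤ 1 →
      ‖evalCoef q (c + (ρ : ℂ) • y)‖ ≤ B₁ := fun q hq y hy =>
    norm_evalCoef_le (by positivity) hq hΛ1 (hz y hy)
  have hsum : ∀ (q : Fin h → (Fin n → Fin d) → ℤ), (∀ j α, |(q j α : ℝ)| ≤ 2 ^ d) →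
      ∀ (s : Finset (Fin h)) (e : Fin h → ℕ) y, ‖y‖ ≤ 1 →
      ‖∑ j ∈ s, f y ^ e j * evalCoef (q j) (c + (ρ : ℂ) • y)‖ ≤ h * B₁ := by
    intro q hq s e y hy
    refine (norm_sum_le _ _).trans ?_
    refine (Finset.sum_le_card_nsmul _ _ B₁ fun j _ => ?_).trans ?_
    · rw [norm_mul, norm_pow]
      calc _ ≤ 1 * B₁ := mul_le_mul (pow_le_one₀ (norm_nonneg _) (hf1 y hy)) (hev _ (hq j) y hy)
            (norm_nonneg _) zero_le_one
        _ = B₁ := one_mul _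
    · rw [nsmul_eq_mul]
      gcongr
      simpa using s.card_le_univ
  let v : Fin h × (Fin n → Fin d) → (Fin n → circGrid L) → ℂ := fun jα x =>
    f (fun i => (x i : ℂ)) ^ (jα.1 : ℕ) *
      ∏ i, (c + (ρ : ℂ) • (fun i => (x i : ℂ))) i ^ (jα.2 i : ℕ)
  have hvF : ∀ (q : Fin h × (Fin n → Fin d) → ℤ) x, ∑ i, (q i : ℂ) * v i x =
      ∑ j : Fin h, f (fun i => (x i : ℂ)) ^ (j : ℕ) *
        evalCoef (fun α => q (j, α)) (c + (ρ : ℂ) • (fun i => (x i : ℂ))) := by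
    intro q x
    rw [Fintype.sum_prod_type]
    refine Finset.sum_congr rfl fun j _ => ?_
    rw [evalCoef, Finset.mul_sum]
    exact Finset.sum_congr rfl fun α _ => by simp only [v]; ring
  have hgn : ∀ x : Fin n → circGrid L, ‖fun i => (x i : ℂ)‖ ≤ 1 := fun x => by
    rw [pi_norm_le_iff_of_nonneg zero_le_one]
    intro i
    rw [norm_of_mem_circGrid hL0 (x i).2]; norm_num
  obtain ⟨q, hq0, hqN, hqs⟩ := exists_int_combination v (N := 2 ^ d) (T := 2 ^ L) (B := h * B₁)
    (by calc 2 = 2 ^ 1 := rfl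
          _ ≤ 2 ^ L := Nat.pow_le_pow_right (by norm_num) hL0) (by positivity)
    (fun e x => by
      have := hvF (fun i => ((e i : ℕ) : ℤ)) x
      push_cast at this
      rw [this]
      refine hsum (fun j α => ((e (j, α) : ℕ) : ℤ)) (fun j α => ?_) _ _ _ (hgn x)
      have : ((e (j, α) : ℕ) : ℝ) ≤ 2 ^ d := by exact_mod_cast (e (j, α)).2.le
      simpa using this)
    (by
      simp only [Fintype.card_fun, Fintype.card_prod, Fintype.card_fin, Fintype.card_coe,
        card_circGrid hL0]
      rw [← pow_add, ← pow_mul, ← pow_mul]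
      refine Nat.pow_lt_pow_right (by norm_num) ?_
      rw [hh, hL]
      have : 0 < d * d ^ n := by positivity
      calc (ℓ * d + ℓ * d) * (ℓ * d) ^ n = 2 * ℓ ^ (n + 1) * (d * d ^ n) := by
            rw [mul_pow]; ring
        _ < (2 * ℓ ^ (n + 1) + 1) * (d * d ^ n) := by
            rw [add_mul, one_mul]; omega
        _ = _ := by ring)
  let p : Fin h → (Fin n → Fin d) → ℤ := fun j α => q (j, α)
  have hpN : ∀ j α, |(p j α : ℝ)| ≤ 2 ^ d := fun j α => by
    have := hqN (j, α)
    have h2 : ((|q (j, α)| : ℤ) : ℝ) ≤ ((2 ^ d : ℕ) : ℝ) := by exact_mod_cast this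
    simpa using h2
  obtain ⟨j₀, hj₀, hmin⟩ : ∃ j₀ : Fin h, p j₀ ≠ 0 ∧ ∀ j < j₀, p j = 0 := by
    have : ∃ j, p j ≠ 0 := by
      by_contra! hall
      exact hq0 (funext fun jα => congrFun (hall jα.1) jα.2)
    have hwf := (Finset.univ.filter fun j => p j ≠ 0).exists_minimal (by
      obtain ⟨j, hj⟩ := this
      exact ⟨j, by simp [hj]⟩)
    obtain ⟨j₀, hj₀⟩ := hwf
    refine ⟨j₀, by simpa using hj₀.prop, fun j hj => ?_⟩
    by_contra hne
    exact absurd (hj₀.le_of_le (by simp [hne]) hj.le) (not_le.2 hj)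
  let F : (Fin n → ℂ) → ℂ := fun y => ∑ j : Fin h, f y ^ (j : ℕ) *
    evalCoef (p j) (c + (ρ : ℂ) • y)
  let G : (Fin n → ℂ) → ℂ := fun y => ∑ j ∈ Finset.univ.filter (fun j => j₀ < j),
    f y ^ ((j : ℕ) - j₀ - 1) * evalCoef (p j) (c + (ρ : ℂ) • y)
  have hevd : ∀ q : (Fin n → Fin d) → ℤ,
      Differentiable ℂ (fun y : Fin n → ℂ => evalCoef q (c + (ρ : ℂ) • y)) := fun q => by
    unfold evalCoef; fun_prop
  have hFd : Differentiable ℂ F := by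
    have := fun j => hevd (p j)
    simp only [F]; fun_prop
  have hGd : Differentiable ℂ G := by
    have := fun j => hevd (p j)
    simp only [G]; fun_prop
  have hFG : ∀ y, F y = f y ^ (j₀ : ℕ) *
      (evalCoef (p j₀) (c + (ρ : ℂ) • y) + f y * G y) := by
    intro y
    have h1 : F y = ∑ j ∈ Finset.univ.filter (fun j => j₀ ≤ j), f y ^ (j : ℕ) *
        evalCoef (p j) (c + (ρ : ℂ) • y) := by
      refine (Finset.sum_subset (Finset.filter_subset _ _) fun j _ hj => ?_).symm
      have hlt : j < j₀ := by simpa using hj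
      rw [hmin j hlt]; simp [evalCoef]
    have h2 : Finset.univ.filter (fun j => j₀ ≤ j) =
        insert j₀ (Finset.univ.filter (fun j => j₀ < j)) := by
      ext j; simp only [Finset.mem_filter, Finset.mem_univ, true_and, Finset.mem_insert]
      rw [le_iff_eq_or_lt]; constructor <;> rintro (h | h) <;> simp [h]
    rw [h1, h2, Finset.sum_insert (by simp), mul_add]
    congr 1
    rw [← mul_assoc, ← pow_succ, Finset.mul_sum]
    refine Finset.sum_congr rfl fun j hj => ?_
    have hlt : (j₀ : ℕ) < j := by simpa using hj
    rw [← mul_assoc, ← pow_add]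
    congr 3; omega
  have hFsmall : ∀ y : Fin n → ℂ, ‖y‖ ≤ 1 / 4 →
      ‖F y‖ ≤ (8 * L) ^ n * (8 * (h * B₁) / 2 ^ L) := fun y hy => by
    refine norm_le_of_grid hFd hL0 (B := h * B₁) (fun y hy => hsum p hpN _ _ y hy)
      (fun y hy => ?_) ?_ hy
    · have := hqs (fun i => ⟨y i, hy i⟩)
      rw [hvF] at this
      rw [Nat.cast_pow, Nat.cast_ofNat] at this
      exact this
    · rw [one_div, inv_pow, ← div_eq_mul_inv]
      have : (2:ℝ) ^ L ≤ 4 ^ L := by gcongr; norm_num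
      calc h * B₁ / 4 ^ L ≤ h * B₁ / 2 ^ L := by gcongr
        _ ≤ 8 * (h * B₁) / 2 ^ L := by
          have : 0 < h * B₁ := by positivity
          exact div_le_div_of_nonneg_right (by linarith) (by positivity)
  refine ⟨p j₀, hj₀, hpN j₀, fun y hy hfy => ?_⟩
  let w : Fin n → ℂ := (4 : ℂ) • y
  have hw : ∀ ζ : ℂ, ‖ζ‖ ≤ 1 → ‖ζ • w‖ ≤ 1 / 4 := fun ζ hζ => by
    rw [norm_smul, norm_smul]
    norm_num
    nlinarith [norm_nonneg ζ, norm_nonneg y]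
  have hdiv := norm_le_of_pow_mul_norm_le (a := fun ζ : ℂ => f (ζ • w))
    (H := fun ζ : ℂ => evalCoef (p j₀) (c + (ρ : ℂ) • (ζ • w)) + f (ζ • w) * G (ζ • w))
    (by fun_prop) (by
      have h1 := (hevd (p j₀)).comp (f := fun ζ : ℂ => ζ • w) (by fun_prop)
      have h2 : Differentiable ℂ (fun ζ : ℂ => f (ζ • w) * G (ζ • w)) := by fun_prop
      exact h1.add h2) (fun ζ hζ => hf1 _ ((hw ζ hζ).trans (by norm_num)))
    (M := M) (by simpa using hf0) (j := j₀) (fun ζ hζ => by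
      rw [← hFG]; exact hFsmall _ (hw ζ hζ)) (y := 1 / 4) (by norm_num)
  have hw4 : (1 / 4 : ℂ) • w = y := by simp only [w, smul_smul]; norm_num
  simp only [hw4] at hdiv
  have hG : ‖G y‖ ≤ h * B₁ := hsum p hpN _ _ y (hy.trans (by norm_num))
  have h1 : ‖evalCoef (p j₀) (c + (ρ : ℂ) • y)‖ ≤
      ‖evalCoef (p j₀) (c + (ρ : ℂ) • y) + f y * G y‖ + ‖f y * G y‖ := by
    simpa using norm_sub_le (evalCoef (p j₀) (c + (ρ : ℂ) • y) + f y * G y) (f y * G y)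
  have h2 : ‖f y * G y‖ ≤ Real.exp (-K) * (h * B₁) := by
    rw [norm_mul]; gcongr
  have h3 : Real.exp (j₀ * (8 + 3 * M)) ≤ Real.exp (h * (8 + 3 * M)) := by
    gcongr
    exact_mod_cast j₀.2.le
  have h4 : (8 * (L:ℝ)) ^ n * (8 * (h * B₁) / 2 ^ L) * Real.exp (j₀ * (8 + 3 * M)) ≤
      (8 * (L:ℝ)) ^ n * (8 * (h * B₁) / 2 ^ L) * Real.exp (h * (8 + 3 * M)) := by gcongr
  have h5 : (L:ℝ) = ℓ * d := by rw [hL]; push_cast; ring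
  rw [← h5]
  calc _ ≤ (8 * (L:ℝ)) ^ n * (8 * (h * B₁) / 2 ^ L) * Real.exp (h * (8 + 3 * M)) +
        Real.exp (-K) * (h * B₁) := by linarith
    _ = _ := by ring

theorem eventually_mul_pow_le_exp (C : ℝ) (k : ℕ) :
    ∀ᶠ x : ℝ in atTop, C * x ^ k ≤ Real.exp x := by
  have h := (Real.isLittleO_pow_exp_atTop (n := k)).const_mul_left C
  filter_upwards [h.bound one_pos] with x hx
  rw [one_mul, Real.norm_eq_abs, Real.norm_eq_abs, Real.abs_exp] at hx
  exact (le_abs_self _).trans hx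

/-- Integer polynomials of degree `d` of size `exp (-k * d)` on sets where entire functions
are very small. -/
theorem exists_coef_exp_small {n : ℕ} (c : Fin n → ℂ) {ρ C₀ k : ℝ} (hρ : 0 < ρ) (hC₀ : 0 ≤ C₀)
    (hk : 0 ≤ k) : ∃ κ : ℝ, ∀ S : Set (Fin n → ℂ),
      (∀ᶠ m : ℕ in atTop, ∃ f : (Fin n → ℂ) → ℂ, Differentiable ℂ f ∧
        (∀ y, ‖y‖ ≤ 1 → ‖f y‖ ≤ 1) ∧ Real.exp (-(C₀ * m)) ≤ ‖f 0‖ ∧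
        ∀ y ∈ S, ‖f y‖ ≤ Real.exp (-(κ * m))) →
      ∃ d : ℕ, 0 < d ∧ ∃ q : (Fin n → Fin d) → ℤ, q ≠ 0 ∧ (∀ α, |(q α : ℝ)| ≤ 2 ^ d) ∧
        ∀ y ∈ S, ‖y‖ ≤ 1 / 16 → ‖evalCoef q (c + (ρ : ℂ) • y)‖ ≤ Real.exp (-(k * d)) := by
  set Λ : ℝ := ‖c‖ + ρ + 1 with hΛ
  have hΛ1 : 1 ≤ Λ := by have := norm_nonneg c; linarith
  have hlΛ : 0 ≤ Real.log Λ := Real.log_nonneg hΛ1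
  have hl2 : 0 < Real.log 2 := Real.log_pos (by norm_num)
  obtain ⟨ℓ, hℓ⟩ := exists_nat_gt ((Real.log 2 + n * Real.log Λ + 3 + k) / Real.log 2)
  have hℓ' : Real.log 2 + n * Real.log Λ + 3 + k ≤ ℓ * Real.log 2 := by
    rw [div_lt_iff₀ hl2] at hℓ; exact hℓ.le
  have hℓ0 : 0 < ℓ := by
    have : (0:ℝ) < ℓ := lt_of_le_of_lt (by positivity) hℓ
    exact_mod_cast this
  set h : ℕ := 2 * ℓ ^ (n + 1) + 1 with hh
  obtain ⟨a, ha⟩ := exists_nat_gt (h * (3 * C₀))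
  have ha0 : 0 < a := by
    have : (0:ℝ) < a := lt_of_le_of_lt (by positivity) ha
    exact_mod_cast this
  refine ⟨a * (n * Real.log Λ + Real.log 2 + k + 3), fun S hS => ?_⟩
  set Q : ℝ := h * ((8 * ℓ) ^ n * 8) * Real.exp (h * 8) with hQ
  have hev : ∀ᶠ m : ℕ in atTop, Q * ((a * m : ℕ) : ℝ) ^ (2 * n) ≤ Real.exp ((a * m : ℕ) : ℝ) :=
    (tendsto_natCast_atTop_atTop.comp (tendsto_id.const_mul_atTop' ha0)).eventually
      (eventually_mul_pow_le_exp Q (2 * n))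
  obtain ⟨m, ⟨⟨f, hf, hf1, hf0, hfS⟩, hm⟩, hm0⟩ := (hS.and hev |>.and (eventually_gt_atTop 0)).exists
  set d := a * m with hd
  have hd0 : 0 < d := Nat.mul_pos ha0 hm0
  obtain ⟨q, hq0, hq, hqs⟩ := exists_coef_small hf hf1 (M := C₀ * m)
    (K := a * (n * Real.log Λ + Real.log 2 + k + 3) * m) (by positivity) hf0 hρ hΛ1
    (by linarith : ‖c‖ + ρ ≤ Λ) hd0 hℓ0 hh
  refine ⟨d, hd0, q, hq0, hq, fun y hy hy1 => (hqs y hy1 (hfS y hy)).trans ?_⟩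
  have hdR : (d:ℝ) = a * m := by rw [hd]; push_cast; ring
  have hd1 : (1:ℝ) ≤ d := by exact_mod_cast hd0
  have e2 : (2:ℝ) ^ d = Real.exp (d * Real.log 2) := by
    rw [mul_comm, Real.exp_mul, Real.exp_log two_pos, Real.rpow_natCast]
  have e3 : (2:ℝ) ^ (ℓ * d) = Real.exp (ℓ * d * Real.log 2) := by
    rw [mul_comm (_ * _), Real.exp_mul, Real.exp_log two_pos]; norm_cast
  have e4 : Λ ^ (n * d) = Real.exp (n * d * Real.log Λ) := by
    rw [mul_comm (_ * _), Real.exp_mul, Real.exp_log (by linarith)]; norm_cast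
  have hQ1 : (h:ℝ) * d ^ n ≤ Real.exp d := by
    refine le_trans ?_ hm
    have h1 : (1:ℝ) ≤ (8 * ℓ) ^ n * 8 := by
      have : (1:ℝ) ≤ ℓ := by exact_mod_cast hℓ0
      have := one_le_pow₀ (n := n) (by linarith : (1:ℝ) ≤ 8 * ℓ)
      linarith
    have h2 : 1 ≤ Real.exp (h * 8) := Real.one_le_exp (by positivity)
    have h3 : (d:ℝ) ^ n ≤ d ^ (2 * n) := pow_le_pow_right₀ hd1 (by omega)
    calc (h:ℝ) * d ^ n ≤ h * d ^ (2 * n) := by gcongr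
      _ = h * 1 * 1 * d ^ (2 * n) := by ring
      _ ≤ Q * d ^ (2 * n) := by rw [hQ]; gcongr
  have hT1 : h * (d ^ n * 2 ^ d * Λ ^ (n * d)) * ((8 * (ℓ * d)) ^ n * 8 / 2 ^ (ℓ * d) *
      Real.exp (h * (8 + 3 * (C₀ * m)))) ≤ Real.exp (-(k * d) - 1) := by
    calc _ = (Q * d ^ (2 * n)) * (2 ^ d * Λ ^ (n * d) / 2 ^ (ℓ * d) * Real.exp (h * (3 * C₀) * m)) := by
          rw [hQ, show (h * (8 + 3 * (C₀ * m)) : ℝ) = h * 8 + h * (3 * C₀) * m by ring, Real.exp_add]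
          ring
      _ ≤ Real.exp d * (2 ^ d * Λ ^ (n * d) / 2 ^ (ℓ * d) * Real.exp (a * m)) := by gcongr
      _ = Real.exp (d + (d * Real.log 2 + n * d * Real.log Λ - ℓ * d * Real.log 2 + d)) := by
          rw [e2, e3, e4, hdR]; simp only [Real.exp_add, Real.exp_sub]
      _ ≤ _ := by
          apply Real.exp_le_exp.2
          nlinarith
  have hT2 : h * (d ^ n * 2 ^ d * Λ ^ (n * d)) *
      Real.exp (-(a * (n * Real.log Λ + Real.log 2 + k + 3) * m)) ≤ Real.exp (-(k * d) - 1) := by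
    calc _ = (h * d ^ n) * (2 ^ d * Λ ^ (n * d) *
          Real.exp (-(d * (n * Real.log Λ + Real.log 2 + k + 3)))) := by
          rw [hdR]; ring_nf
      _ ≤ Real.exp d * (2 ^ d * Λ ^ (n * d) *
          Real.exp (-(d * (n * Real.log Λ + Real.log 2 + k + 3)))) := by gcongr
      _ = Real.exp (d + (d * Real.log 2 + n * d * Real.log Λ -
          d * (n * Real.log Λ + Real.log 2 + k + 3))) := by
          rw [e2, e4]; simp only [Real.exp_add, Real.exp_sub, Real.exp_neg]; ring
      _ ≤ _ := by
          apply Real.exp_le_exp.2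
          nlinarith
  have h2e : (2:ℝ) ≤ Real.exp 1 := by have := Real.add_one_le_exp (1:ℝ); linarith
  rw [mul_add]
  calc _ ≤ Real.exp (-(k * d) - 1) + Real.exp (-(k * d) - 1) := add_le_add hT1 hT2
    _ = 2 * Real.exp (-(k * d) - 1) := by ring
    _ ≤ Real.exp 1 * Real.exp (-(k * d) - 1) := by gcongr
    _ = _ := by rw [← Real.exp_add]; ring_nf

section
open scoped ContDiff ComplexConjugate

/-- The constant coefficient operator `(∂_{e j} + s ∂_{i e j}) / 2`; for `s = -i` this is `∂/∂z_j`,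
for `s = i` it is `∂/∂z̄_j`. -/
def wd {n : ℕ} (s : ℂ) (j : Fin n) (f : (Fin n → ℂ) → ℂ) (x : Fin n → ℂ) : ℂ :=
  (fderiv ℝ f x (Pi.single j 1) + s * fderiv ℝ f x (Pi.single j I)) / 2

section wd
variable {n : ℕ} {s t : ℂ} {j k : Fin n} {f g : (Fin n → ℂ) → ℂ} {x : Fin n → ℂ}

theorem contDiff_wd (hf : ContDiff ℝ ∞ f) : ContDiff ℝ ∞ (wd s j f) := by
  have h : ContDiff ℝ ∞ (fderiv ℝ f) := hf.fderiv_right (by simp)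
  unfold wd
  exact ((h.clm_apply contDiff_const).add (contDiff_const.mul (h.clm_apply contDiff_const))).div_const _

theorem wd_add (hf : DifferentiableAt ℝ f x) (hg : DifferentiableAt ℝ g x) :
    wd s j (fun y => f y + g y) x = wd s j f x + wd s j g x := by
  simp only [wd, fderiv_fun_add hf hg, add_apply]; ring

theorem wd_sub (hf : DifferentiableAt ℝ f x) (hg : DifferentiableAt ℝ g x) :
    wd s j (fun y => f y - g y) x = wd s j f x - wd s j g x := by
  simp only [wd, fderiv_fun_sub hf hg, sub_apply]; ring

theorem wd_neg : wd s j (fun y => - f y) x = - wd s j f x := by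
  simp only [wd, fderiv_fun_neg, neg_apply]; ring

theorem wd_sum {ι : Type*} {u : Finset ι} {F : ι → (Fin n → ℂ) → ℂ}
    (hF : ∀ i ∈ u, DifferentiableAt ℝ (F i) x) :
    wd s j (fun y => ∑ i ∈ u, F i y) x = ∑ i ∈ u, wd s j (F i) x := by
  simp only [wd, fderiv_fun_sum hF, sum_apply, Finset.mul_sum,
    ← Finset.sum_add_distrib, Finset.sum_div]

theorem wd_mul (hf : DifferentiableAt ℝ f x) (hg : DifferentiableAt ℝ g x) :
    wd s j (fun y => f y * g y) x = wd s j f x * g x + f x * wd s j g x := by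
  simp only [wd, fderiv_fun_mul hf hg, add_apply, smul_apply, smul_eq_mul]; ring

theorem conj_wd (hf : DifferentiableAt ℝ f x) :
    conj (wd s j f x) = wd (conj s) j (fun y => conj (f y)) x := by
  have h : fderiv ℝ (fun y => conj (f y)) x = (conjCLE : ℂ →L[ℝ] ℂ).comp (fderiv ℝ f x) := by
    exact ((conjCLE : ℂ →L[ℝ] ℂ).hasFDerivAt.comp x hf.hasFDerivAt).fderiv
  simp [wd, h, map_ofNat]

theorem wd_comm (hf : ContDiff ℝ ∞ f) : wd s j (wd t k f) x = wd t k (wd s j f) x := by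
  have h : ContDiff ℝ ∞ (fderiv ℝ f) := hf.fderiv_right (by simp)
  have hd : DifferentiableAt ℝ (fderiv ℝ f) x := (h.differentiable (by simp)) x
  have hs : IsSymmSndFDerivAt ℝ f x := hf.contDiffAt.isSymmSndFDerivAt (by simp; exact ENat.LEInfty.out)
  have key : ∀ (t : ℂ) (k : Fin n) (v : Fin n → ℂ), fderiv ℝ (wd t k f) x v =
      (fderiv ℝ (fderiv ℝ f) x v (Pi.single k 1) + t * fderiv ℝ (fderiv ℝ f) x v (Pi.single k I)) / 2 := by
    intro t k v
    have h1 : ∀ v', HasFDerivAt (fun y => fderiv ℝ f y v') ((fderiv ℝ (fderiv ℝ f) x).flip v') x :=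
      fun v' => by
        have := hd.hasFDerivAt.clm_apply (hasFDerivAt_const v' x)
        simpa using this
    have h2 := ((h1 (Pi.single k 1)).add ((h1 (Pi.single k I)).const_mul t)).mul_const (2⁻¹ : ℂ)
    have h3 : wd t k f = fun y => (fderiv ℝ f y (Pi.single k 1) +
      t * fderiv ℝ f y (Pi.single k I)) * 2⁻¹ := by ext y; simp [wd, div_eq_mul_inv]
    rw [h3]
    erw [HasFDerivAt.fderiv h2]
    simp [div_eq_mul_inv]
    ring
  rw [wd, wd, key, key, key, key, hs.eq (Pi.single k 1), hs.eq (Pi.single k I),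
    hs.eq (Pi.single k 1), hs.eq (Pi.single k I)]
  ring

theorem hasCompactSupport_wd (hf : HasCompactSupport f) : HasCompactSupport (wd s j f) := by
  refine hf.mono' (fun x hx => ?_)
  by_contra h
  refine hx ?_
  have : fderiv ℝ f x = 0 := by
    by_contra h'
    exact h (support_fderiv_subset ℝ h')
  simp [wd, this]

theorem integral_wd (hf : ContDiff ℝ ∞ f) (hc : HasCompactSupport f) : ∫ x, wd s j f x = 0 := by
  have h0 : ∀ v, ∫ x, fderiv ℝ f x v = 0 := fun v => by
    have hi : Integrable (fun x => fderiv ℝ f x v) :=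
      ((hf.continuous_fderiv (by simp)).clm_apply continuous_const).integrable_of_hasCompactSupport
        (hc.fderiv_apply (𝕜 := ℝ) v)
    have := integral_mul_fderiv_eq_neg_fderiv_mul_of_integrable (μ := volume) (v := v)
      (f := fun _ : Fin n → ℂ => (1:ℂ)) (g := f) (by simp) (by simpa using hi)
      (by simpa using hf.continuous.integrable_of_hasCompactSupport hc)
      (by fun_prop) (fun x _ => (hf.differentiable (by simp)) x)
    simpa using this
  have hi : ∀ v, Integrable (fun x => fderiv ℝ f x v) := fun v =>
      ((hf.continuous_fderiv (by simp)).clm_apply continuous_const).integrable_of_hasCompactSupport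
        (hc.fderiv_apply (𝕜 := ℝ) v)
  simp only [wd]
  rw [integral_div, integral_add (hi _) ((hi _).const_mul _), integral_const_mul, h0, h0]
  simp

end wd

section kohn
variable {n : ℕ} {s : ℂ} {j : Fin n} {f g h : (Fin n → ℂ) → ℂ} {φ : (Fin n → ℂ) → ℝ}

theorem integrable_of_smooth (hf : ContDiff ℝ ∞ f) (hc : HasCompactSupport f) : Integrable f :=
  hf.continuous.integrable_of_hasCompactSupport hc

theorem ContDiff.diffAt {f : (Fin n → ℂ) → ℂ} (hf : ContDiff ℝ ∞ f) {x : Fin n → ℂ} :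
    DifferentiableAt ℝ f x :=
  (hf.differentiable (by simp)) x

theorem integral_wd_mul (hf : ContDiff ℝ ∞ f) (hg : ContDiff ℝ ∞ g) (hc : HasCompactSupport g) :
    ∫ x, wd s j f x * g x = - ∫ x, f x * wd s j g x := by
  have h := integral_wd (s := s) (j := j) (hf.mul hg) hc.mul_left
  have h1 : ∀ x, wd s j (fun y => f y * g y) x = wd s j f x * g x + f x * wd s j g x :=
    fun x => wd_mul hf.diffAt hg.diffAt
  rw [integral_congr_ae (Eventually.of_forall h1), integral_add] at h
  · linear_combination h
  · exact integrable_of_smooth ((contDiff_wd hf).mul hg) hc.mul_left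
  · exact integrable_of_smooth (hf.mul (contDiff_wd hg)) (hasCompactSupport_wd hc).mul_left

/-- The weight `exp (-φ)`, as a complex valued function. -/
def wt (φ : (Fin n → ℂ) → ℝ) (x : Fin n → ℂ) : ℂ := Complex.exp (-(φ x : ℂ))

theorem wt_eq (x : Fin n → ℂ) : wt φ x = (Real.exp (-φ x) : ℝ) := by simp [wt]

theorem contDiff_ofReal_comp (hφ : ContDiff ℝ ∞ φ) : ContDiff ℝ ∞ (fun x => (φ x : ℂ)) :=
  ofRealCLM.contDiff.comp hφ

theorem contDiff_wt (hφ : ContDiff ℝ ∞ φ) : ContDiff ℝ ∞ (wt φ) :=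
  (contDiff_ofReal_comp hφ).neg.cexp

theorem wd_wt (hφ : ContDiff ℝ ∞ φ) (x : Fin n → ℂ) :
    wd s j (wt φ) x = - wd s j (fun x => (φ x : ℂ)) x * wt φ x := by
  have h := ((contDiff_ofReal_comp hφ).neg.diffAt (x := x)).hasFDerivAt.cexp
  have h' : fderiv ℝ (wt φ) x = _ := h.fderiv
  rw [fderiv_fun_neg, show Complex.exp (-(φ x : ℂ)) = wt φ x from rfl] at h'
  simp only [wd, h', smul_apply, neg_apply, smul_eq_mul]
  ring

theorem integral_wd_wt (hφ : ContDiff ℝ ∞ φ) (hf : ContDiff ℝ ∞ f) (hg : ContDiff ℝ ∞ g)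
    (hc : HasCompactSupport g) :
    ∫ x, (wd s j f x - wd s j (fun x => (φ x : ℂ)) x * f x) * g x * wt φ x =
      - ∫ x, f x * wd s j g x * wt φ x := by
  have h := integral_wd_mul (s := s) (j := j) (hf.mul (contDiff_wt hφ)) hg hc
  convert h using 2
  · ext x
    rw [wd_mul hf.diffAt (contDiff_wt hφ).diffAt, wd_wt hφ]; ring
  · congr 1; ext x; ring

/-- The formal adjoint of `∂̄` applied to `∂̄ h`, for the weight `exp (-φ)`. -/
def kohn (φ : (Fin n → ℂ) → ℝ) (h : (Fin n → ℂ) → ℂ) (x : Fin n → ℂ) : ℂ :=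
  ∑ j, - (wd (-I) j (wd I j h) x - wd (-I) j (fun x => (φ x : ℂ)) x * wd I j h x)

theorem contDiff_kohn (hφ : ContDiff ℝ ∞ φ) (hh : ContDiff ℝ ∞ h) : ContDiff ℝ ∞ (kohn φ h) :=
  ContDiff.sum fun _ _ => ((contDiff_wd (contDiff_wd hh)).sub
    ((contDiff_wd (contDiff_ofReal_comp hφ)).mul (contDiff_wd hh))).neg

theorem hasCompactSupport_finset_sum {ι : Type*} {u : Finset ι} {F : ι → (Fin n → ℂ) → ℂ}
    (hF : ∀ i ∈ u, HasCompactSupport (F i)) : HasCompactSupport (fun x => ∑ i ∈ u, F i x) := by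
  classical
  induction u using Finset.induction_on with
  | empty => exact HasCompactSupport.zero
  | insert a u ha ih =>
    simp only [Finset.sum_insert ha]
    exact (hF a (by simp)).add (ih fun i hi => hF i (by simp [hi]))

theorem hasCompactSupport_kohn (hc : HasCompactSupport h) : HasCompactSupport (kohn φ h) :=
  hasCompactSupport_finset_sum fun j _ => by
    have h1 := hasCompactSupport_wd (s := I) (j := j) hc
    exact ((hasCompactSupport_wd h1).sub h1.mul_left).neg

theorem integral_kohn_mul (hφ : ContDiff ℝ ∞ φ) (hh : ContDiff ℝ ∞ h) (hg : ContDiff ℝ ∞ g)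
    (hc : HasCompactSupport g) :
    ∫ x, kohn φ h x * g x * wt φ x = ∑ j, ∫ x, wd I j h x * wd (-I) j g x * wt φ x := by
  simp only [kohn, Finset.sum_mul]
  rw [integral_finsetSum]
  · refine Finset.sum_congr rfl fun j _ => ?_
    have := integral_wd_wt (s := -I) (j := j) hφ (contDiff_wd (s := I) (j := j) hh) hg hc
    simp only [neg_mul, integral_neg]
    rw [this, neg_neg]
  · intro j _
    exact integrable_of_smooth ((((contDiff_wd (contDiff_wd hh)).sub
      ((contDiff_wd (contDiff_ofReal_comp hφ)).mul (contDiff_wd hh))).neg.mul hg).mul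
        (contDiff_wt hφ)) hc.mul_left.mul_right

theorem conj_kohn (hφ : ContDiff ℝ ∞ φ) (hh : ContDiff ℝ ∞ h) (x : Fin n → ℂ) :
    conj (kohn φ h x) = ∑ j, - (wd I j (wd (-I) j (fun x => conj (h x))) x -
      wd I j (fun x => (φ x : ℂ)) x * wd (-I) j (fun x => conj (h x)) x) := by
  have h1 : ∀ j, (fun x => conj (wd I j h x)) = wd (-I) j (fun x => conj (h x)) := fun j => by
    ext x; rw [conj_wd hh.diffAt]; simp
  simp only [kohn, map_sum, map_neg, map_sub, map_mul]
  refine Finset.sum_congr rfl fun j _ => ?_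
  rw [conj_wd (contDiff_wd hh).diffAt, conj_wd (contDiff_ofReal_comp hφ).diffAt,
    conj_wd hh.diffAt, h1]
  simp

theorem contDiff_conj (hh : ContDiff ℝ ∞ h) : ContDiff ℝ ∞ (fun x => conj (h x)) :=
  conjCLE.contDiff.comp hh

theorem hasCompactSupport_conj (hc : HasCompactSupport h) :
    HasCompactSupport (fun x => conj (h x)) :=
  hc.comp_left (g := fun z : ℂ => conj z) (by simp)

theorem integral_kohn_conj (hφ : ContDiff ℝ ∞ φ) (hh : ContDiff ℝ ∞ h)
    (hc : HasCompactSupport h) :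
    ∫ x, kohn φ h x * conj (kohn φ h x) * wt φ x = ∑ k, ∑ j,
      ((∫ x, wd I k (wd I j h) x * conj (wd I k (wd I j h) x) * wt φ x) +
      ∫ x, wd I k (wd (-I) j (fun x => (φ x : ℂ))) x * wd I j h x * conj (wd I k h x) * wt φ x) := by
  have hK := contDiff_kohn hφ hh
  have hKc := hasCompactSupport_kohn (φ := φ) hc
  have hhb := contDiff_conj hh
  have hcb := hasCompactSupport_conj hc
  have hΦ := contDiff_ofReal_comp hφ
  have hab : ∀ k, (fun x => conj (wd I k h x)) = wd (-I) k (fun x => conj (h x)) := fun k => by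
    ext x; rw [conj_wd hh.diffAt]; simp
  have e1 : ∫ x, kohn φ h x * conj (kohn φ h x) * wt φ x =
      ∑ k, ∫ x, wd (-I) k (fun x => conj (h x)) x * wd I k (kohn φ h) x * wt φ x := by
    have : ∀ x, kohn φ h x * conj (kohn φ h x) * wt φ x =
        ∑ k, - ((wd I k (wd (-I) k (fun x => conj (h x))) x -
      wd I k (fun x => (φ x : ℂ)) x * wd (-I) k (fun x => conj (h x)) x) * kohn φ h x * wt φ x) := by
      intro x
      rw [conj_kohn hφ hh, Finset.mul_sum, Finset.sum_mul]
      exact Finset.sum_congr rfl fun _ _ => by ring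
    simp only [this]
    rw [integral_finsetSum]
    · refine Finset.sum_congr rfl fun k _ => ?_
      rw [integral_neg, integral_wd_wt hφ (contDiff_wd hhb) hK hKc, neg_neg]
    · intro k _
      exact (integrable_of_smooth ((((contDiff_wd (contDiff_wd hhb)).sub
        ((contDiff_wd hΦ).mul (contDiff_wd hhb))).mul hK).mul
        (contDiff_wt hφ)) hKc.mul_left.mul_right).neg
  rw [e1]
  refine Finset.sum_congr rfl fun k _ => ?_
  have e2 : ∀ x, wd I k (kohn φ h) x = ∑ j, - ((wd (-I) j (wd I k (wd I j h)) x -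
      wd (-I) j (fun x => (φ x : ℂ)) x * wd I k (wd I j h) x) -
      wd I k (wd (-I) j (fun x => (φ x : ℂ))) x * wd I j h x) := by
    intro x
    unfold kohn
    rw [wd_sum]
    · refine Finset.sum_congr rfl fun j _ => ?_
      have hm : ContDiff ℝ ∞ fun y => wd (-I) j (fun x => (φ x : ℂ)) y * wd I j h y :=
        (contDiff_wd hΦ).mul (contDiff_wd hh)
      rw [wd_neg, wd_sub (contDiff_wd (contDiff_wd hh)).diffAt hm.diffAt,
        wd_mul (contDiff_wd hΦ).diffAt (contDiff_wd hh).diffAt, wd_comm (contDiff_wd hh)]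
      ring
    · intro j _
      exact (((contDiff_wd (contDiff_wd hh)).sub
        ((contDiff_wd hΦ).mul (contDiff_wd hh))).neg).diffAt
  have e3 : ∀ x, wd (-I) k (fun x => conj (h x)) x * wd I k (kohn φ h) x * wt φ x =
      ∑ j, (- ((wd (-I) j (wd I k (wd I j h)) x -
      wd (-I) j (fun x => (φ x : ℂ)) x * wd I k (wd I j h) x) *
        wd (-I) k (fun x => conj (h x)) x * wt φ x) +
      wd I k (wd (-I) j (fun x => (φ x : ℂ))) x * wd I j h x * conj (wd I k h x) * wt φ x) := by
    intro x
    rw [e2, Finset.mul_sum, Finset.sum_mul]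
    refine Finset.sum_congr rfl fun j _ => ?_
    rw [show conj (wd I k h x) = _ from congrFun (hab k) x]
    ring
  have hbc := hasCompactSupport_wd (s := -I) (j := k) hcb
  have hi1 : ∀ j, Integrable fun x => - ((wd (-I) j (wd I k (wd I j h)) x -
      wd (-I) j (fun x => (φ x : ℂ)) x * wd I k (wd I j h) x) *
        wd (-I) k (fun x => conj (h x)) x * wt φ x) := fun j =>
    (integrable_of_smooth ((((contDiff_wd (contDiff_wd (contDiff_wd hh))).sub
        ((contDiff_wd hΦ).mul (contDiff_wd (contDiff_wd hh)))).mul (contDiff_wd hhb)).mul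
        (contDiff_wt hφ)) hbc.mul_left.mul_right).neg
  have hi2 : ∀ j, Integrable fun x =>
      wd I k (wd (-I) j (fun x => (φ x : ℂ))) x * wd I j h x * conj (wd I k h x) * wt φ x := fun j => by
    have : HasCompactSupport (fun x => conj (wd I k h x)) := hab k ▸ hbc
    exact integrable_of_smooth ((((contDiff_wd (contDiff_wd hΦ)).mul (contDiff_wd hh)).mul
      (contDiff_conj (contDiff_wd hh))).mul (contDiff_wt hφ)) this.mul_left.mul_right
  simp only [e3]
  rw [integral_finsetSum _ fun j _ => (hi1 j).fun_add (hi2 j)]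
  refine Finset.sum_congr rfl fun j _ => ?_
  rw [integral_add (hi1 j) (hi2 j), integral_neg,
    integral_wd_wt hφ (contDiff_wd (contDiff_wd hh)) (contDiff_wd hhb) hbc, neg_neg]
  congr 2
  ext x
  rw [conj_wd (contDiff_wd hh).diffAt, hab, wd_comm hhb]
  simp

/-- Bochner-type estimate: if the Levi form of `φ` dominates the euclidean metric,
`‖∂̄ h‖ ≤ ‖∂̄* ∂̄ h‖` in weighted `L²` norms. -/
theorem integral_wd_sq_le_kohn (hφ : ContDiff ℝ ∞ φ)
    (hL : ∀ (x : Fin n → ℂ) (a : Fin n → ℂ), ∑ j, ‖a j‖ ^ 2 ≤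
      (∑ k, ∑ j, wd I k (wd (-I) j (fun x => (φ x : ℂ))) x * a j * conj (a k)).re)
    (hh : ContDiff ℝ ∞ h) (hc : HasCompactSupport h) :
    ∫ x, (∑ j, ‖wd I j h x‖ ^ 2) * Real.exp (-φ x) ≤ ∫ x, ‖kohn φ h x‖ ^ 2 * Real.exp (-φ x) := by
  have key := congrArg Complex.re (integral_kohn_conj hφ hh hc)
  have hΦ := contDiff_ofReal_comp hφ
  have hsq : ∀ (F : (Fin n → ℂ) → ℂ), (fun x => F x * conj (F x) * wt φ x) =
      fun x => ((‖F x‖ ^ 2 * Real.exp (-φ x) : ℝ) : ℂ) := fun F => by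
    ext x; rw [mul_conj, wt_eq, normSq_eq_norm_sq]; push_cast; ring
  have hi2 : ∀ k j, Integrable fun x =>
      wd I k (wd (-I) j (fun x => (φ x : ℂ))) x * wd I j h x * conj (wd I k h x) * wt φ x := fun k j => by
    exact integrable_of_smooth ((((contDiff_wd (contDiff_wd hΦ)).mul (contDiff_wd hh)).mul
      (contDiff_conj (contDiff_wd hh))).mul (contDiff_wt hφ))
      (hasCompactSupport_wd hc).mul_left.mul_right.mul_right
  simp only [hsq, integral_complex_ofReal, ofReal_re, Finset.sum_add_distrib, add_re, re_sum] at key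
  rw [key]
  have e : ∑ k, ∑ j, (∫ x, wd I k (wd (-I) j (fun x => (φ x : ℂ))) x * wd I j h x *
      conj (wd I k h x) * wt φ x).re = ∫ x, (∑ k, ∑ j, wd I k (wd (-I) j (fun x => (φ x : ℂ))) x *
        wd I j h x * conj (wd I k h x)).re * Real.exp (-φ x) := by
    have : ∀ x, (∑ k, ∑ j, wd I k (wd (-I) j (fun x => (φ x : ℂ))) x *
        wd I j h x * conj (wd I k h x)).re * Real.exp (-φ x) =
          ∑ k, ∑ j, (wd I k (wd (-I) j (fun x => (φ x : ℂ))) x *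
        wd I j h x * conj (wd I k h x) * wt φ x).re := fun x => by
      simp only [wt_eq, re_mul_ofReal, re_sum, Finset.sum_mul]
    simp only [this]
    have hi3 : ∀ k j, Integrable fun x => (wd I k (wd (-I) j (fun x => (φ x : ℂ))) x * wd I j h x *
      conj (wd I k h x) * wt φ x).re := fun k j => (hi2 k j).re
    rw [integral_finsetSum _ fun k _ => integrable_finsetSum _ fun j _ => hi3 k j]
    refine Finset.sum_congr rfl fun k _ => ?_
    rw [integral_finsetSum _ fun j _ => hi3 k j]
    exact Finset.sum_congr rfl fun j _ => (integral_re (hi2 k j)).symm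
  rw [e]
  refine le_add_of_nonneg_of_le (Finset.sum_nonneg fun k _ => Finset.sum_nonneg fun j _ =>
    integral_nonneg fun x => by positivity) (integral_mono ?_ ?_ fun x => ?_)
  · have : Integrable (fun x => ∑ j, wd I j h x * conj (wd I j h x) * wt φ x) :=
      integrable_finsetSum _ fun j _ => integrable_of_smooth (((contDiff_wd hh).mul
        (contDiff_conj (contDiff_wd hh))).mul (contDiff_wt hφ))
        (hasCompactSupport_wd hc).mul_right.mul_right
    have h2 := this.re
    simp only [fun j x => congrFun (hsq (wd I j h)) x] at h2
    convert h2 using 2 with x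
    rw [Finset.sum_mul]
    simp [← ofReal_sum, -ofReal_mul, -ofReal_pow, -ofReal_exp]
  · have : Integrable (fun x => ∑ k, ∑ j, wd I k (wd (-I) j (fun x => (φ x : ℂ))) x * wd I j h x *
      conj (wd I k h x) * wt φ x) :=
      integrable_finsetSum _ fun k _ => integrable_finsetSum _ fun j _ => hi2 k j
    convert this.re using 2 with x
    simp only [wt_eq, ← Finset.sum_mul, RCLike.re_to_complex, re_mul_ofReal]
  · exact mul_le_mul_of_nonneg_right (hL x _) (Real.exp_pos _).le

end kohn

section hilbert
variable {n : ℕ} {s : ℂ} {j : Fin n} {f g h χ : (Fin n → ℂ) → ℂ} {φ : (Fin n → ℂ) → ℝ}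

theorem wd_const_mul (c : ℂ) (hh : ContDiff ℝ ∞ h) :
    wd s j (fun y => c * h y) = fun x => c * wd s j h x := by
  ext x
  rw [wd_mul contDiff_const.diffAt hh.diffAt]
  simp [wd]

theorem kohn_add (hf : ContDiff ℝ ∞ f) (hg : ContDiff ℝ ∞ g) (x : Fin n → ℂ) :
    kohn φ (fun y => f y + g y) x = kohn φ f x + kohn φ g x := by
  have h1 : ∀ j, wd I j (fun y => f y + g y) = fun x => wd I j f x + wd I j g x := fun j => by
    ext x; exact wd_add hf.diffAt hg.diffAt
  simp only [kohn, h1, ← Finset.sum_add_distrib]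
  refine Finset.sum_congr rfl fun j _ => ?_
  rw [wd_add (contDiff_wd hf).diffAt (contDiff_wd hg).diffAt]
  ring

theorem kohn_const_mul (c : ℂ) (hf : ContDiff ℝ ∞ f) (x : Fin n → ℂ) :
    kohn φ (fun y => c * f y) x = c * kohn φ f x := by
  simp only [kohn, wd_const_mul c hf, wd_const_mul c (contDiff_wd hf), Finset.mul_sum]
  exact Finset.sum_congr rfl fun j _ => by ring

/-- The function `h * exp (-φ / 2)`. -/
def halfWt (φ : (Fin n → ℂ) → ℝ) (h : (Fin n → ℂ) → ℂ) (x : Fin n → ℂ) : ℂ :=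
  h x * (Real.exp (-φ x / 2) : ℝ)

theorem halfWt_mul_conj (x : Fin n → ℂ) :
    halfWt φ f x * conj (halfWt φ g x) = f x * conj (g x) * wt φ x := by
  have : Real.exp (-φ x) = Real.exp (-φ x / 2) * Real.exp (-φ x / 2) := by
    rw [← Real.exp_add]; ring_nf
  rw [halfWt, halfWt, wt_eq, this]
  simp only [map_mul, conj_ofReal]
  push_cast; ring

theorem norm_halfWt_sq (x : Fin n → ℂ) :
    ‖halfWt φ f x‖ ^ 2 = ‖f x‖ ^ 2 * Real.exp (-φ x) := by
  rw [halfWt, norm_mul, mul_pow, norm_real, Real.norm_eq_abs, sq_abs, ← Real.exp_nat_mul]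
  ring_nf

theorem memLp_halfWt (hφ : Continuous φ) (hf : Continuous f) (hc : HasCompactSupport f) :
    MemLp (halfWt φ f) 2 volume := by
  have : Continuous (halfWt φ f) := by unfold halfWt; fun_prop
  exact this.memLp_of_hasCompactSupport hc.mul_right

theorem inner_L2_eq (F G : Lp ℂ 2 (volume : Measure (Fin n → ℂ))) :
    inner ℂ F G = ∫ x, G x * conj (F x) := by
  simp [L2.inner_def]

theorem norm_L2_sq (F : Lp ℂ 2 (volume : Measure (Fin n → ℂ))) : ‖F‖ ^ 2 = ∫ x, ‖F x‖ ^ 2 := by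
  have h := inner_L2_eq F F
  rw [inner_self_eq_norm_sq_to_K] at h
  have h2 : ∀ x, F x * conj (F x) = ((‖F x‖ ^ 2 : ℝ) : ℂ) := fun x => by
    rw [mul_conj, normSq_eq_norm_sq]
  simp only [h2, integral_complex_ofReal] at h
  exact ofReal_injective ((ofReal_pow _ _).trans h)

/-- The space of all `∂̄* ∂̄ h`, `h` a test function, in weighted `L²`. -/
def kohnRange (φ : (Fin n → ℂ) → ℝ) : Submodule ℂ (Lp ℂ 2 (volume : Measure (Fin n → ℂ))) where
  carrier := {F | ∃ h : (Fin n → ℂ) → ℂ, ContDiff ℝ ∞ h ∧ HasCompactSupport h ∧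
    F =ᵐ[volume] halfWt φ (kohn φ h)}
  add_mem' := by
    rintro F G ⟨f, hf, hfc, hF⟩ ⟨g, hg, hgc, hG⟩
    refine ⟨fun y => f y + g y, hf.add hg, hfc.add hgc, ?_⟩
    filter_upwards [hF, hG, Lp.coeFn_add F G] with x h1 h2 h3
    rw [h3, Pi.add_apply, h1, h2]
    simp only [halfWt, kohn_add hf hg]; ring
  zero_mem' := by
    refine ⟨fun _ => 0, contDiff_const, HasCompactSupport.zero, ?_⟩
    filter_upwards [Lp.coeFn_zero ℂ 2 (volume : Measure (Fin n → ℂ))] with x hx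
    rw [hx]
    have := kohn_const_mul (φ := φ) 0 (f := fun _ : Fin n → ℂ => 0) contDiff_const x
    simp only [mul_zero, zero_mul] at this
    simp [halfWt, this]
  smul_mem' := by
    rintro c F ⟨f, hf, hfc, hF⟩
    refine ⟨fun y => c * f y, contDiff_const.mul hf, hfc.mul_left, ?_⟩
    filter_upwards [hF, Lp.coeFn_smul c F] with x h1 h3
    rw [h3, Pi.smul_apply, h1]
    simp only [halfWt, kohn_const_mul c hf, smul_eq_mul]; ring

theorem norm_integral_kohn_le (hφ : ContDiff ℝ ∞ φ)
    (hL : ∀ (x : Fin n → ℂ) (a : Fin n → ℂ), ∑ j, ‖a j‖ ^ 2 ≤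
      (∑ k, ∑ j, wd I k (wd (-I) j (fun x => (φ x : ℂ))) x * a j * conj (a k)).re)
    (hh : ContDiff ℝ ∞ h) (hc : HasCompactSupport h) (hχ : ContDiff ℝ ∞ χ)
    (hχc : HasCompactSupport χ) :
    ‖∫ x, kohn φ h x * conj (χ x) * wt φ x‖ ≤
      1 / 2 * (∫ x, ‖kohn φ h x‖ ^ 2 * Real.exp (-φ x)) +
      1 / 2 * ∫ x, (∑ j, ‖wd I j χ x‖ ^ 2) * Real.exp (-φ x) := by
  rw [integral_kohn_mul hφ hh (contDiff_conj hχ) (hasCompactSupport_conj hχc)]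
  have hB := integral_wd_sq_le_kohn hφ hL hh hc
  have hi : ∀ {f : (Fin n → ℂ) → ℂ}, ContDiff ℝ ∞ f → HasCompactSupport f → ∀ j,
      Integrable fun x => ‖wd I j f x‖ ^ 2 * Real.exp (-φ x) := fun hf hc j => by
    refine Continuous.integrable_of_hasCompactSupport ?_ ?_
    · have := (contDiff_wd (s := I) (j := j) hf).continuous
      have := hφ.continuous
      fun_prop
    · refine (hasCompactSupport_wd (s := I) (j := j) hc).mono fun x hx => ?_
      contrapose! hx
      simp only [Function.mem_support, not_not] at hx ⊢
      rw [hx]; simp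
  simp only [Finset.sum_mul] at hB ⊢
  rw [integral_finsetSum _ fun j _ => hi hh hc j] at hB
  rw [integral_finsetSum _ fun j _ => hi hχ hχc j]
  refine (norm_sum_le _ _).trans ?_
  have : ∀ j ∈ (Finset.univ : Finset (Fin n)),
      ‖∫ x, wd I j h x * wd (-I) j (fun x => conj (χ x)) x * wt φ x‖ ≤
      1 / 2 * (∫ x, ‖wd I j h x‖ ^ 2 * Real.exp (-φ x)) +
      1 / 2 * (∫ x, ‖wd I j χ x‖ ^ 2 * Real.exp (-φ x)) := fun j _ => by
    rw [← integral_const_mul, ← integral_const_mul,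
      ← integral_add ((hi hh hc j).const_mul _) ((hi hχ hχc j).const_mul _)]
    refine norm_integral_le_of_norm_le (((hi hh hc j).const_mul _).add
      ((hi hχ hχc j).const_mul _)) (Eventually.of_forall fun x => ?_)
    have h1 : wd (-I) j (fun x => conj (χ x)) x = conj (wd I j χ x) := by
      rw [conj_wd hχ.diffAt]; simp
    rw [h1, wt_eq, norm_mul, norm_mul, norm_real, Real.norm_eq_abs, Real.abs_exp, RCLike.norm_conj]
    have := Real.exp_pos (-φ x)
    nlinarith [mul_nonneg this.le (sq_nonneg (‖wd I j h x‖ - ‖wd I j χ x‖))]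
  refine (Finset.sum_le_sum this).trans ?_
  rw [Finset.sum_add_distrib, ← Finset.mul_sum, ← Finset.mul_sum]
  linarith

theorem exists_weak_solution (hφ : ContDiff ℝ ∞ φ)
    (hL : ∀ (x : Fin n → ℂ) (a : Fin n → ℂ), ∑ j, ‖a j‖ ^ 2 ≤
      (∑ k, ∑ j, wd I k (wd (-I) j (fun x => (φ x : ℂ))) x * a j * conj (a k)).re)
    (hχ : ContDiff ℝ ∞ χ) (hχc : HasCompactSupport χ) :
    ∃ u : Lp ℂ 2 (volume : Measure (Fin n → ℂ)),
      (∀ h : (Fin n → ℂ) → ℂ, ContDiff ℝ ∞ h → HasCompactSupport h →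
        ∫ x, u x * conj (halfWt φ (kohn φ h) x) = 0) ∧
      ‖u‖ ^ 2 ≤ ∫ x, ‖χ x‖ ^ 2 * Real.exp (-φ x) ∧
      ∫ x, ‖halfWt φ χ x - u x‖ ^ 2 ≤ ∫ x, (∑ j, ‖wd I j χ x‖ ^ 2) * Real.exp (-φ x) := by
  set M := kohnRange φ
  have hXm := memLp_halfWt hφ.continuous hχ.continuous hχc
  set X := hXm.toLp
  have hX : X =ᵐ[volume] halfWt φ χ := hXm.coeFn_toLp
  set u : Lp ℂ 2 (volume : Measure (Fin n → ℂ)) := Mᗮ.starProjection X with hu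
  have huM : u ∈ Mᗮ := Submodule.starProjection_apply_mem _ _
  have hXu : X - u ∈ M.topologicalClosure := by
    rw [← Submodule.orthogonal_orthogonal_eq_closure]
    exact Submodule.sub_starProjection_mem_orthogonal X
  have hnX : ‖X‖ ^ 2 = ∫ x, ‖χ x‖ ^ 2 * Real.exp (-φ x) := by
    rw [norm_L2_sq]
    refine integral_congr_ae ?_
    filter_upwards [hX] with x hx
    rw [hx, norm_halfWt_sq]
  refine ⟨u, fun h hh hc => ?_, ?_, ?_⟩
  · have hm := memLp_halfWt hφ.continuous (contDiff_kohn hφ hh).continuous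
      (hasCompactSupport_kohn (φ := φ) hc)
    have h1 : hm.toLp ∈ M := ⟨h, hh, hc, hm.coeFn_toLp⟩
    have h2 := (Submodule.mem_orthogonal M u).1 huM _ h1
    rw [inner_L2_eq] at h2
    rw [← h2]
    refine integral_congr_ae ?_
    filter_upwards [hm.coeFn_toLp] with x hx
    rw [hx]
  · rw [← hnX]
    gcongr
    exact Submodule.norm_starProjection_apply_le _ _
  · set B := ∫ x, (∑ j, ‖wd I j χ x‖ ^ 2) * Real.exp (-φ x)
    have hcl : IsClosed {F : Lp ℂ 2 (volume : Measure (Fin n → ℂ)) |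
        ‖inner ℂ F X‖ ≤ 1 / 2 * ‖F‖ ^ 2 + 1 / 2 * B} :=
      isClosed_le (by fun_prop) (by fun_prop)
    have hsub : (M : Set (Lp ℂ 2 (volume : Measure (Fin n → ℂ)))) ⊆
        {F | ‖inner ℂ F X‖ ≤ 1 / 2 * ‖F‖ ^ 2 + 1 / 2 * B} := by
      rintro F ⟨h, hh, hc, hF⟩
      have h1 := norm_integral_kohn_le hφ hL hh hc hχ hχc
      rw [mem_ofPred_eq, ← inner_conj_symm, RCLike.norm_conj, inner_L2_eq, norm_L2_sq]
      have e1 : ∫ x, F x * conj (X x) = ∫ x, kohn φ h x * conj (χ x) * wt φ x := by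
        refine integral_congr_ae ?_
        filter_upwards [hF, hX] with x h2 h3
        rw [h2, h3, halfWt_mul_conj]
      have e2 : ∫ x, ‖F x‖ ^ 2 = ∫ x, ‖kohn φ h x‖ ^ 2 * Real.exp (-φ x) := by
        refine integral_congr_ae ?_
        filter_upwards [hF] with x h2
        rw [h2, norm_halfWt_sq]
      rwa [e1, e2]
    have h1 : ‖inner ℂ (X - u) X‖ ≤ 1 / 2 * ‖X - u‖ ^ 2 + 1 / 2 * B := by
      have := closure_minimal hsub hcl hXu
      exact this
    have h2 : inner ℂ (X - u) X = ((‖X - u‖ ^ 2 : ℝ) : ℂ) := by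
      have h3 : inner ℂ (X - u) u = 0 := by
        have := Submodule.sub_starProjection_mem_orthogonal (K := Mᗮ) X
        rw [← hu] at this
        exact (Submodule.mem_orthogonal' _ _).1 this u huM
      have h4 : inner ℂ (X - u) (X - u) = inner ℂ (X - u) X - inner ℂ (X - u) u := inner_sub_right _ _ _
      rw [h3, sub_zero, inner_self_eq_norm_sq_to_K] at h4
      rw [← h4]; push_cast; rfl
    rw [h2, norm_real, Real.norm_of_nonneg (by positivity)] at h1
    have h5 : ∫ x, ‖halfWt φ χ x - u x‖ ^ 2 = ‖X - u‖ ^ 2 := by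
      rw [norm_L2_sq]
      refine integral_congr_ae ?_
      filter_upwards [hX, Lp.coeFn_sub X u] with x h6 h7
      rw [h7, Pi.sub_apply, h6]
    rw [h5]; linarith

end hilbert

section conv
variable {n : ℕ} {s : ℂ} {j : Fin n} {f g h w ρ v : (Fin n → ℂ) → ℂ} {φ : (Fin n → ℂ) → ℝ}

/-- The convolution of `w` and `ρ`. -/
def mconv {n : ℕ} (w ρ : (Fin n → ℂ) → ℂ) (x : Fin n → ℂ) : ℂ := ∫ y, w y * ρ (x - y)

theorem mconv_eq : mconv w ρ = convolution w ρ (ContinuousLinearMap.mul ℝ ℂ) volume := by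
  ext x; simp [mconv, convolution_def]

theorem contDiff_mconv (hw : LocallyIntegrable w) (hρ : ContDiff ℝ ∞ ρ) (hc : HasCompactSupport ρ) :
    ContDiff ℝ ∞ (mconv w ρ) := by
  rw [mconv_eq]
  exact hc.contDiff_convolution_right (n := ⊤) _ hw hρ

theorem integrable_mul_sub (hw : LocallyIntegrable w) (hρ : Continuous ρ)
    (hc : HasCompactSupport ρ) (x : Fin n → ℂ) : Integrable fun y => w y * ρ (x - y) :=
  hc.convolutionExists_right (ContinuousLinearMap.mul ℝ ℂ) hw hρ x

theorem fderiv_mconv (hw : LocallyIntegrable w) (hρ : ContDiff ℝ ∞ ρ) (hc : HasCompactSupport ρ)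
    (x v : Fin n → ℂ) : fderiv ℝ (mconv w ρ) x v = mconv w (fun y => fderiv ℝ ρ y v) x := by
  have h := hc.hasFDerivAt_convolution_right (ContinuousLinearMap.mul ℝ ℂ) hw
    (hρ.of_le (by simp)) x
  rw [mconv_eq, h.fderiv, convolution_precompR_apply _ hw (hc.fderiv ℝ)
    (hρ.continuous_fderiv (by simp)), mconv_eq]

theorem wd_mconv (hw : LocallyIntegrable w) (hρ : ContDiff ℝ ∞ ρ) (hc : HasCompactSupport ρ) :
    wd s j (mconv w ρ) = mconv w (wd s j ρ) := by
  ext x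
  have hi : ∀ v, Integrable fun y => w y * fderiv ℝ ρ (x - y) v := fun v =>
    integrable_mul_sub hw ((hρ.continuous_fderiv (by simp)).clm_apply continuous_const)
      (hc.fderiv_apply (𝕜 := ℝ) v) x
  simp only [wd, fderiv_mconv hw hρ hc]
  simp only [mconv]
  rw [← integral_const_mul, ← integral_add (hi _) ((hi _).const_mul _), ← integral_div]
  congr 1; ext y; simp only [wd]; ring

theorem fderiv_comp_sub_apply (hf : ContDiff ℝ ∞ f) (x y v : Fin n → ℂ) :
    fderiv ℝ (fun y => f (x - y)) y v = - fderiv ℝ f (x - y) v := by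
  have h1 : HasFDerivAt (fun y : Fin n → ℂ => x - y)
      (-ContinuousLinearMap.id ℝ (Fin n → ℂ)) y := (hasFDerivAt_id y).const_sub x
  have h := (hf.diffAt (x := x - y)).hasFDerivAt.comp y h1
  have h2 : fderiv ℝ (fun y => f (x - y)) y = _ := h.fderiv
  rw [h2]; simp

theorem wd_comp_sub (hf : ContDiff ℝ ∞ f) (x : Fin n → ℂ) :
    wd s j (fun y => f (x - y)) = fun y => - wd s j f (x - y) := by
  ext y
  simp only [wd, fderiv_comp_sub_apply hf]
  ring

theorem contDiff_comp_sub (hf : ContDiff ℝ ∞ f) (x : Fin n → ℂ) :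
    ContDiff ℝ ∞ (fun y => f (x - y)) := hf.comp (contDiff_const.sub contDiff_id)

theorem hasCompactSupport_comp_sub (hc : HasCompactSupport f) (x : Fin n → ℂ) :
    HasCompactSupport (fun y => f (x - y)) := hc.comp_homeomorph (Homeomorph.subLeft x)

theorem wd_comp_smul (hf : ContDiff ℝ ∞ f) (c : ℝ) :
    wd s j (fun y => f (c • y)) = fun y => c * wd s j f (c • y) := by
  ext y
  have h1 : HasFDerivAt (fun y : Fin n → ℂ => c • y)
      (c • ContinuousLinearMap.id ℝ (Fin n → ℂ)) y := (hasFDerivAt_id y).const_smul c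
  have h := (hf.diffAt (x := c • y)).hasFDerivAt.comp y h1
  have h2 : fderiv ℝ (fun y => f (c • y)) y = _ := h.fderiv
  simp only [wd, h2, ContinuousLinearMap.comp_apply, smul_apply, ContinuousLinearMap.id_apply, map_smul,
    real_smul]
  ring

theorem MeasureTheory.LocallyIntegrable.integrable_mul_smooth (hw : LocallyIntegrable w) (hf : ContDiff ℝ ∞ f)
    (hc : HasCompactSupport f) : Integrable fun x => w x * f x := by
  have := hw.integrable_smul_right_of_hasCompactSupport hf.continuous hc
  simpa only [smul_eq_mul] using this

/-- Convolutions of weakly holomorphic functions with test functions are entire. -/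
theorem differentiable_mconv (hw : LocallyIntegrable w)
    (hw0 : ∀ j, ∀ k : (Fin n → ℂ) → ℂ, ContDiff ℝ ∞ k → HasCompactSupport k →
      ∫ x, w x * wd I j k x = 0) (hρ : ContDiff ℝ ∞ ρ) (hc : HasCompactSupport ρ) :
    Differentiable ℂ (mconv w ρ) := by
  intro x
  have hd : DifferentiableAt ℝ (mconv w ρ) x := (contDiff_mconv hw hρ hc).diffAt
  have h0 : ∀ j, wd I j (mconv w ρ) x = 0 := fun j => by
    rw [wd_mconv hw hρ hc]
    have := hw0 j _ (contDiff_comp_sub hρ x) (hasCompactSupport_comp_sub hc x)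
    rw [wd_comp_sub hρ] at this
    simpa [mconv, integral_neg] using this
  set L := fderiv ℝ (mconv w ρ) x
  have hI : ∀ j, L (Pi.single j I) = I * L (Pi.single j 1) := fun j => by
    have := h0 j
    simp only [wd] at this
    linear_combination (-2 * I) * this + (L (Pi.single j I)) * I_mul_I
  have hsum : ∀ v : Fin n → ℂ, L v = ∑ j, v j * L (Pi.single j 1) := fun v => by
    have h1 : v = ∑ j, ((v j).re • (Pi.single j (1:ℂ) : Fin n → ℂ) +
        (v j).im • (Pi.single j I : Fin n → ℂ)) := by
      ext i
      simp only [Finset.sum_apply, Pi.add_apply, Pi.smul_apply]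
      rw [Finset.sum_eq_single i]
      · simp
      · intro b _ hb; simp [hb.symm]
      · simp
    conv_lhs => rw [h1]
    rw [map_sum]
    refine Finset.sum_congr rfl fun j _ => ?_
    rw [map_add, map_smul, map_smul, hI]
    conv_rhs => rw [← re_add_im (v j)]
    simp only [real_smul]
    ring
  let Lc : (Fin n → ℂ) →L[ℂ] ℂ := LinearMap.toContinuousLinearMap
    { toFun := L
      map_add' := L.map_add
      map_smul' := fun c v => by
        rw [hsum, hsum v]; simp [Finset.mul_sum, mul_assoc] }
  exact (hasFDerivAt_of_restrictScalars ℝ (f' := Lc) hd.hasFDerivAt (by ext; rfl)).differentiableAt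

end conv

section weak
variable {n : ℕ} {s : ℂ} {j : Fin n} {f g h w ρ v : (Fin n → ℂ) → ℂ} {φ : (Fin n → ℂ) → ℝ}

theorem integral_weak_kohn (hφ : ContDiff ℝ ∞ φ)
    (hW : ∀ h : (Fin n → ℂ) → ℂ, ContDiff ℝ ∞ h → HasCompactSupport h →
      ∫ x, w x * conj (kohn φ h x) * wt φ x = 0) (hf : ContDiff ℝ ∞ f) (hc : HasCompactSupport f) :
    ∫ x, w x * ∑ j, (wd I j (wd (-I) j f) x +
      wd I j (fun y => wd (-I) j (fun x => (φ x : ℂ)) y * f y) x) = 0 := by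
  set E : (Fin n → ℂ) → ℂ := fun x => Complex.exp (φ x) with hE
  have hΦ := contDiff_ofReal_comp hφ
  have hEs : ContDiff ℝ ∞ E := hΦ.cexp
  have hEd : ∀ s j x, wd s j E x = wd s j (fun x => (φ x : ℂ)) x * E x := fun s j x => by
    have h := wd_wt (s := s) (j := j) hφ.neg x
    have e1 : wt (fun x => -φ x) = E := by ext x; simp [wt, hE]
    rw [e1] at h
    rw [h]
    have e2 : (fun x => ((-φ x : ℝ) : ℂ)) = fun x => -(φ x : ℂ) := by ext; simp
    rw [e2, wd_neg]; ring
  have hEw : ∀ x, E x * wt φ x = 1 := fun x => by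
    simp only [hE, wt]; rw [← Complex.exp_add]; simp
  have hk : ContDiff ℝ ∞ (fun x => f x * E x) := hf.mul hEs
  have hkc : HasCompactSupport (fun x => f x * E x) := hc.mul_right
  have h0 := hW _ (contDiff_conj hk) (hasCompactSupport_conj hkc)
  rw [← neg_eq_zero, ← integral_neg, ← h0]
  congr 1; ext x
  rw [conj_kohn hφ (contDiff_conj hk)]
  simp only [conj_conj]
  rw [mul_assoc, Finset.sum_mul, ← mul_neg, ← Finset.sum_neg_distrib]
  congr 1
  refine Finset.sum_congr rfl fun j _ => ?_
  have hq : wd (-I) j (fun x => f x * E x) = fun x =>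
      (wd (-I) j f x + wd (-I) j (fun x => (φ x : ℂ)) x * f x) * E x := by
    ext x; rw [wd_mul hf.diffAt hEs.diffAt, hEd]; ring
  have hm : ContDiff ℝ ∞ (fun x => wd (-I) j (fun x => (φ x : ℂ)) x * f x) :=
    (contDiff_wd hΦ).mul hf
  have hq' : ContDiff ℝ ∞ (fun x => wd (-I) j f x + wd (-I) j (fun x => (φ x : ℂ)) x * f x) :=
    (contDiff_wd hf).add hm
  rw [hq, wd_mul hq'.diffAt hEs.diffAt, hEd, wd_add (contDiff_wd hf).diffAt hm.diffAt]
  linear_combination (wd I j (wd (-I) j f) x +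
    wd I j (fun y => wd (-I) j (fun x => (φ x : ℂ)) y * f y) x) * hEw x

/-- The commutator of `∂̄* ∂̄` with convolution, applied to a weak solution. -/
theorem kohn_mconv (hφ : ContDiff ℝ ∞ φ) (hw : LocallyIntegrable w)
    (hW : ∀ h : (Fin n → ℂ) → ℂ, ContDiff ℝ ∞ h → HasCompactSupport h →
      ∫ x, w x * conj (kohn φ h x) * wt φ x = 0)
    (hρ : ContDiff ℝ ∞ ρ) (hc : HasCompactSupport ρ) (x : Fin n → ℂ) :
    kohn φ (mconv w ρ) x = ∫ y, (w y - w x) * ∑ j, wd I j (fun y =>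
      (wd (-I) j (fun x => (φ x : ℂ)) y - wd (-I) j (fun x => (φ x : ℂ)) x) * ρ (x - y)) y := by
  set Φ : Fin n → (Fin n → ℂ) → ℂ := fun j => wd (-I) j (fun x => (φ x : ℂ)) with hΦdef
  have hΦ : ∀ j, ContDiff ℝ ∞ (Φ j) := fun j => contDiff_wd (contDiff_ofReal_comp hφ)
  set k : (Fin n → ℂ) → ℂ := fun y => ρ (x - y) with hkdef
  have hk : ContDiff ℝ ∞ k := contDiff_comp_sub hρ x
  have hkc : HasCompactSupport k := hasCompactSupport_comp_sub hc x
  have hW0 := integral_weak_kohn hφ hW hk hkc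
  have hg : ∀ j, ContDiff ℝ ∞ fun y => (Φ j y - Φ j x) * k y := fun j =>
    ((hΦ j).sub contDiff_const).mul hk
  have hgc : ∀ j, HasCompactSupport fun y => (Φ j y - Φ j x) * k y := fun j => hkc.mul_left
  have hsm : ContDiff ℝ ∞ fun y => ∑ j, wd I j (fun y => (Φ j y - Φ j x) * k y) y :=
    ContDiff.sum fun j _ => contDiff_wd (hg j)
  have hsc : HasCompactSupport fun y => ∑ j, wd I j (fun y => (Φ j y - Φ j x) * k y) y :=
    hasCompactSupport_finset_sum fun j _ => hasCompactSupport_wd (hgc j)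
  have h0 : ∫ y, ∑ j, wd I j (fun y => (Φ j y - Φ j x) * k y) y = 0 := by
    rw [integral_finsetSum _ fun j _ => integrable_of_smooth (contDiff_wd (hg j))
      (hasCompactSupport_wd (hgc j))]
    exact Finset.sum_eq_zero fun j _ => integral_wd (hg j) (hgc j)
  have e1 : ∫ y, (w y - w x) * ∑ j, wd I j (fun y => (Φ j y - Φ j x) * k y) y =
      ∫ y, w y * ∑ j, wd I j (fun y => (Φ j y - Φ j x) * k y) y := by
    simp only [fun y => sub_mul (w y) (w x)]
    rw [integral_sub (hw.integrable_mul_smooth hsm hsc)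
      ((integrable_of_smooth hsm hsc).const_mul _), integral_const_mul, h0, mul_zero, sub_zero]
  change _ = ∫ y, (w y - w x) * ∑ j, wd I j (fun y => (Φ j y - Φ j x) * k y) y
  rw [e1]
  have e2 : kohn φ (mconv w ρ) x = ∫ y, w y * ∑ j, (- wd (-I) j (wd I j ρ) (x - y) +
      Φ j x * wd I j ρ (x - y)) := by
    have hi1 : ∀ j, Integrable fun y => w y * wd (-I) j (wd I j ρ) (x - y) := fun j =>
      integrable_mul_sub hw (contDiff_wd (contDiff_wd hρ)).continuous
        (hasCompactSupport_wd (hasCompactSupport_wd hc)) x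
    have hi2 : ∀ j, Integrable fun y => w y * wd I j ρ (x - y) := fun j =>
      integrable_mul_sub hw (contDiff_wd hρ).continuous (hasCompactSupport_wd hc) x
    have : ∀ y, w y * ∑ j, (- wd (-I) j (wd I j ρ) (x - y) + Φ j x * wd I j ρ (x - y)) =
        ∑ j, (Φ j x * (w y * wd I j ρ (x - y)) - w y * wd (-I) j (wd I j ρ) (x - y)) := fun y => by
      rw [Finset.mul_sum]; exact Finset.sum_congr rfl fun j _ => by ring
    have hi5 : ∀ j, Integrable fun y => Φ j x * (w y * wd I j ρ (x - y)) -
        w y * wd (-I) j (wd I j ρ) (x - y) := fun j => ((hi2 j).const_mul _).sub (hi1 j)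
    simp only [this]
    rw [integral_finsetSum _ fun j _ => hi5 j]
    refine Finset.sum_congr rfl fun j _ => ?_
    rw [integral_sub ((hi2 j).const_mul _) (hi1 j), integral_const_mul, wd_mconv hw hρ hc,
      wd_mconv hw (contDiff_wd hρ) (hasCompactSupport_wd hc)]
    simp only [mconv, hΦdef]; ring
  have hi3 : Integrable fun y => w y * ∑ j, (- wd (-I) j (wd I j ρ) (x - y) +
      Φ j x * wd I j ρ (x - y)) := by
    refine integrable_mul_sub (ρ := fun z => ∑ j, (- wd (-I) j (wd I j ρ) z +
      Φ j x * wd I j ρ z)) hw (ContDiff.continuous (n := ∞) (𝕜 := ℝ) ?_) ?_ x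
    · exact ContDiff.sum fun j _ => (contDiff_wd (contDiff_wd hρ)).neg.add
        (contDiff_const.mul (contDiff_wd hρ))
    · exact hasCompactSupport_finset_sum fun j _ =>
        (hasCompactSupport_wd (hasCompactSupport_wd hc)).neg.add (hasCompactSupport_wd hc).mul_left
  have hi4 : Integrable fun y => w y * ∑ j, (wd I j (wd (-I) j k) y +
      wd I j (fun y => Φ j y * k y) y) := by
    refine hw.integrable_mul_smooth ?_ ?_
    · exact ContDiff.sum fun j _ => (contDiff_wd (contDiff_wd hk)).add
        (contDiff_wd ((hΦ j).mul hk))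
    · exact hasCompactSupport_finset_sum fun j _ =>
        (hasCompactSupport_wd (hasCompactSupport_wd hkc)).add (hasCompactSupport_wd hkc.mul_left)
  rw [e2, ← add_zero (∫ y, w y * ∑ j, (- wd (-I) j (wd I j ρ) (x - y) +
      Φ j x * wd I j ρ (x - y))), ← hW0, ← integral_add hi3 hi4]
  congr 1; ext y
  rw [← mul_add, ← Finset.sum_add_distrib]
  congr 1
  refine Finset.sum_congr rfl fun j _ => ?_
  have h1 : wd I j (wd (-I) j k) y = wd (-I) j (wd I j ρ) (x - y) := by
    rw [hkdef, wd_comp_sub hρ, wd_neg, wd_comp_sub (contDiff_wd hρ), wd_comm hρ]; simp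
  have h2 : wd I j k y = - wd I j ρ (x - y) := by rw [hkdef, wd_comp_sub hρ]
  have h3 : wd I j (fun y => (Φ j y - Φ j x) * k y) y =
      wd I j (fun y => Φ j y * k y) y - Φ j x * wd I j k y := by
    have hm : ContDiff ℝ ∞ (fun y => Φ j y * k y) := (hΦ j).mul hk
    have e : (fun y => (Φ j y - Φ j x) * k y) = fun y => Φ j y * k y - Φ j x * k y := by
      ext y; ring
    rw [e, wd_sub hm.diffAt (contDiff_const.mul hk).diffAt, wd_const_mul _ hk]
  rw [h1, h3, h2]
  ring

/-- The dilation of `ρ` by `ε`, normalised to preserve the integral. -/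
def dil {n : ℕ} (ρ : (Fin n → ℂ) → ℂ) (ε : ℝ) (x : Fin n → ℂ) : ℂ :=
  ((ε⁻¹ ^ (2 * n) : ℝ) : ℂ) * ρ (ε⁻¹ • x)

theorem contDiff_dil (hρ : ContDiff ℝ ∞ ρ) (ε : ℝ) : ContDiff ℝ ∞ (dil ρ ε) :=
  contDiff_const.mul (hρ.comp (contDiff_const_smul _))

theorem dil_eq_zero (hρ : ∀ x, 1 ≤ ‖x‖ → ρ x = 0) {ε : ℝ} (hε : 0 < ε) {x : Fin n → ℂ}
    (hx : ε ≤ ‖x‖) : dil ρ ε x = 0 := by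
  rw [dil, hρ, mul_zero]
  rw [norm_smul, norm_inv, Real.norm_of_nonneg hε.le, inv_mul_eq_div, le_div_iff₀ hε]
  linarith

theorem hasCompactSupport_dil (hρ : ∀ x, 1 ≤ ‖x‖ → ρ x = 0) {ε : ℝ} (hε : 0 < ε) :
    HasCompactSupport (dil ρ ε) :=
  HasCompactSupport.intro (isCompact_closedBall 0 ε) fun x hx => dil_eq_zero hρ hε (by
    simp at hx; exact hx.le)

theorem wd_dil (hρ : ContDiff ℝ ∞ ρ) (ε : ℝ) (x : Fin n → ℂ) :
    wd s j (dil ρ ε) x = ((ε⁻¹ : ℝ) : ℂ) * dil (wd s j ρ) ε x := by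
  have h1 : ContDiff ℝ ∞ (fun x : Fin n → ℂ => ρ (ε⁻¹ • x)) :=
    hρ.comp (contDiff_const_smul _)
  have h2 : dil ρ ε = fun x => ((ε⁻¹ ^ (2 * n) : ℝ) : ℂ) * ρ (ε⁻¹ • x) := rfl
  rw [h2, wd_const_mul _ h1, wd_comp_smul hρ, dil]
  ring

theorem wd_eq_zero_of_one_le (hρ : ∀ x, 1 ≤ ‖x‖ → ρ x = 0) (hs : ContDiff ℝ ∞ ρ)
    (x : Fin n → ℂ) (hx : 1 ≤ ‖x‖) : wd s j ρ x = 0 := by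
  have hcl : closure {x : Fin n → ℂ | 1 < ‖x‖} ⊆ {x | wd s j ρ x = 0} := by
    refine closure_minimal (fun y hy => ?_) (isClosed_eq (contDiff_wd hs).continuous continuous_const)
    have : ρ =ᶠ[𝓝 y] fun _ => 0 := by
      filter_upwards [(isOpen_lt continuous_const continuous_norm).mem_nhds hy] with z hz
      exact hρ z (le_of_lt hz)
    change wd s j ρ y = 0
    simp [wd, this.fderiv_eq]
  apply hcl
  rw [mem_closure_iff_seq_limit]
  refine ⟨fun m : ℕ => (1 + 1 / ((m:ℝ) + 1)) • x, fun m => ?_, ?_⟩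
  · have : (0:ℝ) < 1 / ((m:ℝ) + 1) := by positivity
    change 1 < ‖(1 + 1 / ((m:ℝ) + 1)) • x‖
    rw [norm_smul, Real.norm_of_nonneg (by positivity)]
    nlinarith
  · have h := (tendsto_one_div_add_atTop_nhds_zero_nat (𝕜 := ℝ)).const_add 1
    simpa using h.smul_const x

theorem exists_norm_le_of_contDiff (hf : ContDiff ℝ ∞ f) (R : ℝ) :
    ∃ C, 0 ≤ C ∧ ∀ x, ‖x‖ ≤ R → ‖f x‖ ≤ C := by
  obtain ⟨C, hC⟩ := (isCompact_closedBall (0 : Fin n → ℂ) R).exists_bound_of_continuousOn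
    hf.continuous.continuousOn
  exact ⟨max C 0, le_max_right _ _, fun x hx => (hC x (by simpa using hx)).trans (le_max_left _ _)⟩

theorem exists_lipschitz_of_contDiff (hf : ContDiff ℝ ∞ f) (R : ℝ) :
    ∃ C, 0 ≤ C ∧ ∀ x y, ‖x‖ ≤ R → ‖y‖ ≤ R → ‖f y - f x‖ ≤ C * ‖y - x‖ := by
  obtain ⟨C, hC⟩ := (isCompact_closedBall (0 : Fin n → ℂ) R).exists_bound_of_continuousOn
    (hf.continuous_fderiv (by simp)).continuousOn
  refine ⟨max C 0, le_max_right _ _, fun x y hx hy => ?_⟩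
  exact (convex_closedBall (0 : Fin n → ℂ) R).norm_image_sub_le_of_norm_fderiv_le (𝕜 := ℝ)
    (fun z _ => hf.diffAt) (fun z hz => (hC z hz).trans (le_max_left _ _))
    (by simpa using hx) (by simpa using hy)

theorem norm_commutator_kernel_le (hφ : ContDiff ℝ ∞ φ) (hρ : ContDiff ℝ ∞ ρ)
    (hρ1 : ∀ x, 1 ≤ ‖x‖ → ρ x = 0) (R : ℝ) : ∃ C, 0 ≤ C ∧ ∀ ε, 0 < ε → ε ≤ 1 → ∀ x y, ‖x‖ ≤ R →
      ‖∑ j, wd I j (fun y => (wd (-I) j (fun x => (φ x : ℂ)) y - wd (-I) j (fun x => (φ x : ℂ)) x) *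
        dil ρ ε (x - y)) y‖ ≤ (ball x ε).indicator (fun _ => C * ε⁻¹ ^ (2 * n)) y := by
  have hΦ : ∀ j, ContDiff ℝ ∞ (wd (-I) j (fun x => (φ x : ℂ))) := fun j =>
    contDiff_wd (contDiff_ofReal_comp hφ)
  have hbd : ∀ f : (Fin n → ℂ) → ℂ, ContDiff ℝ ∞ f → (∀ x, 1 ≤ ‖x‖ → f x = 0) →
      ∃ C, 0 ≤ C ∧ ∀ x, ‖f x‖ ≤ C := fun f hf hf1 => by
    obtain ⟨C, hC0, hC⟩ := exists_norm_le_of_contDiff hf 1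
    refine ⟨C, hC0, fun x => ?_⟩
    rcases le_total ‖x‖ 1 with h | h
    · exact hC x h
    · rw [hf1 x h]; simpa using hC0
  obtain ⟨A, hA0, hA⟩ := hbd ρ hρ hρ1
  choose B hB0 hB using fun j => hbd (wd I j ρ) (contDiff_wd hρ) (wd_eq_zero_of_one_le hρ1 hρ)
  choose L hL0 hL using fun j => exists_lipschitz_of_contDiff (hΦ j) (R + 1)
  choose M hM0 hM using fun j => exists_norm_le_of_contDiff (contDiff_wd (s := I) (j := j) (hΦ j)) (R + 1)
  refine ⟨∑ j, (M j * A + L j * B j), Finset.sum_nonneg fun j _ =>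
    add_nonneg (mul_nonneg (hM0 j) hA0) (mul_nonneg (hL0 j) (hB0 j)), fun ε hε hε1 x y hx => ?_⟩
  have hk : ContDiff ℝ ∞ (fun y => dil ρ ε (x - y)) := contDiff_comp_sub (contDiff_dil hρ ε) x
  have e : ∀ j, wd I j (fun y => (wd (-I) j (fun x => (φ x : ℂ)) y -
      wd (-I) j (fun x => (φ x : ℂ)) x) * dil ρ ε (x - y)) y =
      wd I j (wd (-I) j (fun x => (φ x : ℂ))) y * dil ρ ε (x - y) -
      (wd (-I) j (fun x => (φ x : ℂ)) y - wd (-I) j (fun x => (φ x : ℂ)) x) *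
        (((ε⁻¹ : ℝ) : ℂ) * dil (wd I j ρ) ε (x - y)) := fun j => by
    rw [wd_mul ((hΦ j).sub contDiff_const).diffAt hk.diffAt, wd_comp_sub (contDiff_dil hρ ε),
      wd_sub (hΦ j).diffAt contDiff_const.diffAt]
    simp only [wd_dil hρ]
    simp [wd]; ring
  simp only [e]
  by_cases hy : y ∈ ball x ε
  · rw [indicator_of_mem hy, Finset.sum_mul]
    have hyx : ‖y - x‖ < ε := by simpa [dist_eq_norm] using hy
    have hyR : ‖y‖ ≤ R + 1 := by
      calc ‖y‖ = ‖x + (y - x)‖ := by simp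
        _ ≤ _ := (norm_add_le _ _).trans (by linarith)
    refine (norm_sum_le _ _).trans (Finset.sum_le_sum fun j _ => (norm_sub_le _ _).trans ?_)
    have hp : (0:ℝ) ≤ ε⁻¹ ^ (2 * n) := by positivity
    have hdil : ∀ (f : (Fin n → ℂ) → ℂ) (C : ℝ), (∀ x, ‖f x‖ ≤ C) →
        ‖dil f ε (x - y)‖ ≤ ε⁻¹ ^ (2 * n) * C := fun f C hC => by
      rw [dil, norm_mul, norm_real, Real.norm_of_nonneg hp]
      exact mul_le_mul_of_nonneg_left (hC _) hp
    rw [norm_mul, norm_mul, norm_mul, norm_real, Real.norm_of_nonneg (by positivity : (0:ℝ) ≤ ε⁻¹)]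
    calc _ ≤ M j * (ε⁻¹ ^ (2 * n) * A) + (L j * ε) * (ε⁻¹ * (ε⁻¹ ^ (2 * n) * B j)) := by
          refine add_le_add (mul_le_mul (hM j y hyR) (hdil _ _ hA) (norm_nonneg _) (hM0 j)) ?_
          refine mul_le_mul ((hL j x y (by linarith) hyR).trans ?_)
            (mul_le_mul_of_nonneg_left (hdil _ _ (hB j)) (by positivity)) (by positivity)
            (mul_nonneg (hL0 j) hε.le)
          exact mul_le_mul_of_nonneg_left hyx.le (hL0 j)
      _ = _ := by field_simp
  · rw [indicator_of_notMem hy]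
    have : ε ≤ ‖x - y‖ := by simpa [dist_eq_norm, norm_sub_rev] using hy
    simp [dil_eq_zero hρ1 hε this, dil_eq_zero (wd_eq_zero_of_one_le hρ1 hρ) hε this]

end weak

end

section
open scoped ContDiff ComplexConjugate ENNReal

section L2
variable {n : ℕ} {W : (Fin n → ℂ) → ℂ}

theorem tendsto_lintegral_translate (hW : MemLp W 2) :
    Tendsto (fun t : Fin n → ℂ => ∫⁻ x, ‖W (t + x) - W x‖ₑ ^ 2) (𝓝 0) (𝓝 0) := by
  let g : (Fin n → ℂ) → C(Fin n → ℂ, Fin n → ℂ) := fun t => ⟨fun x => t + x, by fun_prop⟩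
  have hg : Continuous g := ContinuousMap.continuous_of_continuous_uncurry g (by
    change Continuous fun p : (Fin n → ℂ) × (Fin n → ℂ) => p.1 + p.2
    fun_prop)
  have hm : ∀ t, MeasurePreserving (g t) volume volume := fun t => measurePreserving_add_left volume t
  have h := (Tendsto.compMeasurePreservingLp (tendsto_const_nhds (x := hW.toLp W) (f := 𝓝 (0 : Fin n → ℂ)))
    hg.continuousAt.tendsto hm (hm 0) (by simp))
  rw [tendsto_iff_edist_tendsto_0] at h
  have h2 := (ENNReal.continuous_pow 2).tendsto _ |>.comp h
  simp only [Function.comp_def, Lp.toLp_compMeasurePreserving, Lp.edist_toLp_toLp] at h2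
  have e : ∀ t : Fin n → ℂ, ∫⁻ x, ‖W (t + x) - W x‖ₑ ^ 2 =
      eLpNorm (W ∘ g t - W ∘ g 0) 2 volume ^ 2 := fun t => by
    have := eLpNorm_nnreal_pow_eq_lintegral (f := W ∘ g t - W ∘ g 0) (p := 2) (μ := volume) (by simp)
    simp only [NNReal.coe_ofNat, ENNReal.rpow_ofNat, ENNReal.coe_ofNat] at this
    rw [this]
    simp [g]
  simp only [e]
  simpa [Function.comp_def] using h2

theorem sq_lintegral_le (f : (Fin n → ℂ) → ℝ≥0∞) (hf : Measurable f) (s : Set (Fin n → ℂ)) :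
    (∫⁻ x in s, f x) ^ 2 ≤ volume s * ∫⁻ x in s, f x ^ 2 := by
  have h := ENNReal.lintegral_mul_le_Lp_mul_Lq (volume.restrict s) Real.HolderConjugate.two_two
    (f := fun _ => 1) (g := f) aemeasurable_const hf.aemeasurable
  simp only [Pi.mul_apply, one_mul, lintegral_const, MeasurableSet.univ,
    Measure.restrict_apply, univ_inter, ENNReal.rpow_ofNat] at h
  calc _ ≤ (volume s ^ (1 / 2 : ℝ) * (∫⁻ x in s, f x ^ 2) ^ (1 / 2 : ℝ)) ^ 2 := by
        gcongr; simpa using h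
    _ = _ := by
      rw [mul_pow, ← ENNReal.rpow_natCast, ← ENNReal.rpow_mul, ← ENNReal.rpow_natCast,
        ← ENNReal.rpow_mul]
      norm_num

theorem setLIntegral_ball_eq (f : (Fin n → ℂ) → ℝ≥0∞) (x : Fin n → ℂ) (ε : ℝ) :
    ∫⁻ y in ball x ε, f y = ∫⁻ t in ball 0 ε, f (t + x) := by
  rw [← lintegral_indicator measurableSet_ball, ← lintegral_indicator measurableSet_ball,
    ← lintegral_add_right_eq_self _ x]
  congr 1; ext t
  simp [indicator]

theorem volume_ball_mul {ε : ℝ} (hε : 0 < ε) :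
    ENNReal.ofReal (ε⁻¹ ^ (2 * n)) * volume (ball (0 : Fin n → ℂ) ε) =
      volume (ball (0 : Fin n → ℂ) 1) := by
  have hd : Module.finrank ℝ (Fin n → ℂ) = 2 * n := by
    rw [Module.finrank_pi_fintype]; simp [mul_comm]
  rw [Measure.addHaar_ball_of_pos volume _ hε, hd, ← mul_assoc, ← ENNReal.ofReal_mul (by positivity),
    ← mul_pow, inv_mul_cancel₀ hε.ne']
  simp

theorem eventually_oscillation_le (hm : Measurable W) (hW : MemLp W 2) {δ : ℝ≥0∞} (hδ : δ ≠ 0) :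
    ∀ᶠ ε in 𝓝[>] (0:ℝ), ∫⁻ x, (ENNReal.ofReal (ε⁻¹ ^ (2 * n)) *
      ∫⁻ y in ball x ε, ‖W y - W x‖ₑ) ^ 2 ≤ δ := by
  set v := volume (ball (0 : Fin n → ℂ) 1) with hv
  have hvt : v ≠ ⊤ := measure_ball_lt_top.ne
  have hδ' : 0 < δ / (v ^ 2) := ENNReal.div_pos hδ (ENNReal.pow_ne_top hvt)
  have h := (tendsto_lintegral_translate hW).eventually (gt_mem_nhds hδ')
  obtain ⟨ε₀, hε₀, hb⟩ := Metric.eventually_nhds_iff_ball.1 h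
  filter_upwards [Ioo_mem_nhdsGT hε₀] with ε hε
  set a := ENNReal.ofReal (ε⁻¹ ^ (2 * n)) with ha
  have hmF : Measurable fun p : (Fin n → ℂ) × (Fin n → ℂ) => ‖W (p.2 + p.1) - W p.1‖ₑ ^ 2 := by
    fun_prop
  calc ∫⁻ x, (a * ∫⁻ y in ball x ε, ‖W y - W x‖ₑ) ^ 2
      ≤ ∫⁻ x, a ^ 2 * volume (ball (0 : Fin n → ℂ) ε) *
          ∫⁻ t in ball 0 ε, ‖W (t + x) - W x‖ₑ ^ 2 := by
        refine lintegral_mono fun x => ?_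
        rw [setLIntegral_ball_eq, mul_pow, mul_assoc]
        gcongr
        exact sq_lintegral_le (fun t => ‖W (t + x) - W x‖ₑ) (by fun_prop) _
    _ = a ^ 2 * volume (ball (0 : Fin n → ℂ) ε) *
          ∫⁻ t in ball 0 ε, ∫⁻ x, ‖W (t + x) - W x‖ₑ ^ 2 := by
        rw [lintegral_const_mul, lintegral_lintegral_swap]
        · exact hmF.aemeasurable
        · exact hmF.lintegral_prod_right'
    _ ≤ a ^ 2 * volume (ball (0 : Fin n → ℂ) ε) *
          ∫⁻ t in ball (0 : Fin n → ℂ) ε, δ / (v ^ 2) := by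
        refine mul_le_mul_right (setLIntegral_mono measurable_const fun t ht => ?_) _
        exact (hb t (ball_subset_ball hε.2.le ht)).le
    _ = δ / v ^ 2 * (a * volume (ball (0 : Fin n → ℂ) ε)) ^ 2 := by
        simp only [lintegral_const, MeasurableSet.univ, Measure.restrict_apply, univ_inter]; ring
    _ ≤ δ := by
        rw [volume_ball_mul hε.1]
        rw [mul_comm]; exact ENNReal.mul_div_le

theorem lintegral_kernel_le {w : (Fin n → ℂ) → ℂ} {K : (Fin n → ℂ) → (Fin n → ℂ) → ℂ} {R ε C : ℝ}
    (hC : 0 ≤ C) (hε1 : ε ≤ 1)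
    (hK : ∀ x y, ‖x‖ ≤ R → ‖K x y‖ ≤ (ball x ε).indicator (fun _ => C * ε⁻¹ ^ (2 * n)) y) :
    ∫⁻ x in closedBall 0 R, ‖∫ y, (w y - w x) * K x y‖ₑ ^ 2 ≤ ENNReal.ofReal C ^ 2 *
      ∫⁻ x, (ENNReal.ofReal (ε⁻¹ ^ (2 * n)) * ∫⁻ y in ball x ε,
        ‖(closedBall 0 (R + 1)).indicator w y - (closedBall 0 (R + 1)).indicator w x‖ₑ) ^ 2 := by
  rw [← lintegral_const_mul' _ _ (by simp)]
  refine (lintegral_mono_ae ?_).trans (setLIntegral_le_lintegral (closedBall 0 R) _)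
  filter_upwards [ae_restrict_mem measurableSet_closedBall] with x hx
  have hxR : ‖x‖ ≤ R := by simpa using hx
  rw [← mul_pow, ← mul_assoc, ← ENNReal.ofReal_mul hC]
  gcongr
  refine (enorm_integral_le_lintegral_enorm _).trans ?_
  rw [← lintegral_indicator measurableSet_ball, ← lintegral_const_mul' _ _ (by simp)]
  refine lintegral_mono fun y => ?_
  by_cases hy : y ∈ ball x ε
  · have h := hK x y hxR
    have hyR : ‖y‖ ≤ R + 1 := by
      have : ‖y - x‖ < ε := by simpa [dist_eq_norm] using hy
      calc ‖y‖ = ‖x + (y - x)‖ := by simp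
        _ ≤ _ := (norm_add_le _ _).trans (by linarith)
    rw [indicator_of_mem hy] at h ⊢
    rw [indicator_of_mem (by simpa using hyR), indicator_of_mem (by simp; linarith), enorm_mul, mul_comm]
    gcongr
    rw [← ofReal_norm]
    exact ENNReal.ofReal_le_ofReal h
  · have h := hK x y hxR
    rw [indicator_of_notMem hy] at h
    simp [norm_le_zero_iff.1 h]

theorem exists_mollifier (n : ℕ) : ∃ ρ : (Fin n → ℂ) → ℝ, ContDiff ℝ ∞ ρ ∧ (∀ x, 0 ≤ ρ x) ∧
    (∀ x, 1 ≤ ‖x‖ → ρ x = 0) ∧ ∫ x, ρ x = 1 := by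
  let f : ContDiffBump (0 : Fin n → ℂ) := ⟨1 / 2, 1, by norm_num, by norm_num⟩
  refine ⟨f.normed volume, f.contDiff_normed, f.nonneg_normed, fun x hx => ?_, f.integral_normed⟩
  have : x ∉ Function.support (f.normed volume) := by
    rw [f.support_normed_eq]; simpa using hx
  simpa using this

theorem integral_dil (ρ : (Fin n → ℂ) → ℂ) {ε : ℝ} (hε : 0 < ε) : ∫ x, dil ρ ε x = ∫ x, ρ x := by
  have hd : Module.finrank ℝ (Fin n → ℂ) = 2 * n := by
    rw [Module.finrank_pi_fintype]; simp [mul_comm]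
  simp only [dil]
  rw [integral_const_mul, Measure.integral_comp_smul, hd, abs_of_nonneg (by positivity)]
  rw [Complex.real_smul, ← mul_assoc, ← ofReal_mul, mul_inv_cancel₀ (by positivity)]
  simp

theorem exists_mollification {φ : (Fin n → ℂ) → ℝ} {w : (Fin n → ℂ) → ℂ} (hφ : ContDiff ℝ ∞ φ)
    (hm : Measurable w) (hw2 : ∀ R, MemLp ((closedBall 0 R).indicator w) 2)
    (hw : LocallyIntegrable w)
    (hW : ∀ h : (Fin n → ℂ) → ℂ, ContDiff ℝ ∞ h → HasCompactSupport h →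
      ∫ x, w x * conj (kohn φ h x) * wt φ x = 0) (R : ℝ) {δ : ℝ≥0∞} (hδ : δ ≠ 0) :
    ∃ v : (Fin n → ℂ) → ℂ, ContDiff ℝ ∞ v ∧ ∫⁻ x in closedBall 0 R, ‖v x - w x‖ₑ ^ 2 ≤ δ ∧
      ∫⁻ x in closedBall 0 R, ‖kohn φ v x‖ₑ ^ 2 ≤ δ := by
  obtain ⟨ρ', hρ', -, hρ1', hρi'⟩ := exists_mollifier n
  set ρ : (Fin n → ℂ) → ℂ := fun x => (ρ' x : ℂ) with hρdef
  have hρ : ContDiff ℝ ∞ ρ := contDiff_ofReal_comp hρ'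
  have hρ1 : ∀ x, 1 ≤ ‖x‖ → ρ x = 0 := fun x hx => by simp [hρdef, hρ1' x hx]
  have hρi : ∫ x, ρ x = 1 := by
    simp only [hρdef]; rw [integral_complex_ofReal, hρi', ofReal_one]
  obtain ⟨A, hA0, hA⟩ := exists_norm_le_of_contDiff hρ 1
  obtain ⟨B, hB0, hB⟩ := norm_commutator_kernel_le hφ hρ hρ1 R
  have hev : ∀ C : ℝ, ∀ᶠ ε in 𝓝[>] (0:ℝ), ENNReal.ofReal C ^ 2 *
      ∫⁻ x, (ENNReal.ofReal (ε⁻¹ ^ (2 * n)) * ∫⁻ y in ball x ε,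
        ‖(closedBall 0 (R + 1)).indicator w y - (closedBall 0 (R + 1)).indicator w x‖ₑ) ^ 2 ≤ δ := by
    intro C
    have hC : ENNReal.ofReal C ^ 2 ≠ ⊤ := by simp
    filter_upwards [eventually_oscillation_le (hm.indicator measurableSet_closedBall) (hw2 (R + 1))
      (ENNReal.div_pos hδ hC).ne'] with ε hε
    exact (mul_le_mul_right hε _).trans ENNReal.mul_div_le
  obtain ⟨ε, ⟨hεA, hεB⟩, hε0, hε1⟩ := ((hev A).and (hev B)).and (Ioc_mem_nhdsGT one_pos) |>.exists
  have hk := contDiff_dil hρ ε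
  have hkc := hasCompactSupport_dil hρ1 hε0
  refine ⟨mconv w (dil ρ ε), contDiff_mconv hw hk hkc, ?_, ?_⟩
  · refine le_trans ?_ ((lintegral_kernel_le (K := fun x y => dil ρ ε (x - y)) hA0 hε1
      fun x y _ => ?_).trans hεA)
    · refine le_of_eq (lintegral_congr fun x => ?_)
      have e : ∫ y, dil ρ ε (x - y) = 1 := by
        rw [integral_sub_left_eq_self (dil ρ ε) volume x, integral_dil ρ hε0, hρi]
      simp only [sub_mul]
      rw [integral_sub (integrable_mul_sub hw hk.continuous hkc x)
        ((integrable_of_smooth (contDiff_comp_sub hk x) (hasCompactSupport_comp_sub hkc x)).const_mul _),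
        integral_const_mul, e, mul_one]
      rfl
    · by_cases hy : y ∈ ball x ε
      · have hyx : ‖x - y‖ < ε := by simpa [dist_eq_norm, norm_sub_rev] using hy
        rw [indicator_of_mem hy, dil, norm_mul, norm_real, Real.norm_of_nonneg (by positivity), mul_comm]
        refine mul_le_mul_of_nonneg_right (hA _ ?_) (by positivity)
        rw [norm_smul, norm_inv, Real.norm_of_nonneg hε0.le, inv_mul_le_iff₀ hε0]; linarith
      · rw [indicator_of_notMem hy, dil_eq_zero hρ1 hε0, norm_zero]
        simpa [dist_eq_norm, norm_sub_rev] using hy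
  · refine le_trans (le_of_eq (lintegral_congr fun x => ?_)) ((lintegral_kernel_le
      (K := fun x y => ∑ j, wd I j (fun y => (wd (-I) j (fun x => (φ x : ℂ)) y -
        wd (-I) j (fun x => (φ x : ℂ)) x) * dil ρ ε (x - y)) y) hB0 hε1
      (hB ε hε0 hε1)).trans hεB)
    rw [kohn_mconv hφ hw hW hk hkc]

end L2

section cacc
variable {n : ℕ} {v : (Fin n → ℂ) → ℂ} {φ η : (Fin n → ℂ) → ℝ}

theorem caccioppoli (hφ : ContDiff ℝ ∞ φ) (hv : ContDiff ℝ ∞ v) (hη : ContDiff ℝ ∞ η)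
    (hηc : HasCompactSupport η) :
    ∫ x, η x ^ 2 * (∑ j, ‖wd I j v x‖ ^ 2) * Real.exp (-φ x) ≤
      2 * (∫ x, η x ^ 2 * (‖kohn φ v x‖ * ‖v x‖) * Real.exp (-φ x)) +
      4 * ∫ x, (∑ j, ‖wd (-I) j (fun x => (η x : ℂ)) x‖ ^ 2) * ‖v x‖ ^ 2 * Real.exp (-φ x) := by
  set H : (Fin n → ℂ) → ℂ := fun x => (η x : ℂ) with hH
  have hHs : ContDiff ℝ ∞ H := contDiff_ofReal_comp hη
  have hHc : HasCompactSupport H := hηc.comp_left (g := fun t : ℝ => (t : ℂ)) (by simp)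
  set g : (Fin n → ℂ) → ℂ := fun x => H x * (H x * conj (v x)) with hg
  have hgs : ContDiff ℝ ∞ g := hHs.mul (hHs.mul (contDiff_conj hv))
  have hgc : HasCompactSupport g := hHc.mul_right
  have hK := contDiff_kohn hφ hv
  have hwt := contDiff_wt hφ
  have key := integral_kohn_mul hφ hv hgs hgc
  have hi1 : Integrable fun x => kohn φ v x * g x * wt φ x :=
    integrable_of_smooth ((hK.mul hgs).mul hwt) hgc.mul_left.mul_right
  have hi2 : ∀ j, Integrable fun x => wd I j v x * wd (-I) j g x * wt φ x := fun j =>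
    integrable_of_smooth (((contDiff_wd hv).mul (contDiff_wd hgs)).mul hwt)
      (hasCompactSupport_wd hgc).mul_left.mul_right
  rw [← integral_finsetSum _ fun j _ => hi2 j] at key
  have h0 : ∫ x, (kohn φ v x * g x * wt φ x - ∑ j, wd I j v x * wd (-I) j g x * wt φ x).re = 0 := by
    have hi3 := hi1.sub (integrable_finsetSum Finset.univ fun j _ => hi2 j)
    have := integral_re hi3
    simp only [RCLike.re_eq_complex_re, Pi.sub_apply] at this
    rw [this, integral_sub hi1 (integrable_finsetSum Finset.univ fun j _ => hi2 j), key, sub_self,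
      zero_re]
  have hdg : ∀ j x, wd (-I) j g x = 2 * H x * wd (-I) j H x * conj (v x) +
      H x ^ 2 * conj (wd I j v x) := fun j x => by
    rw [hg, wd_mul hHs.diffAt (hHs.mul (contDiff_conj hv)).diffAt,
      wd_mul hHs.diffAt (contDiff_conj hv).diffAt, conj_wd hv.diffAt]
    simp only [conj_I]; ring
  have hec : Continuous fun x => Real.exp (-φ x) := by
    have := hφ.continuous; fun_prop
  have hvc := hv.continuous
  have hηcont := hη.continuous
  have hKc := hK.continuous
  have hdvc : ∀ j, Continuous (wd I j v) := fun j => (contDiff_wd hv).continuous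
  have hdHc : ∀ j, Continuous (wd (-I) j H) := fun j => (contDiff_wd hHs).continuous
  have ha : Integrable fun x => η x ^ 2 * (∑ j, ‖wd I j v x‖ ^ 2) * Real.exp (-φ x) := by
    refine Continuous.integrable_of_hasCompactSupport (by fun_prop) ?_
    exact hηc.mono fun x hx h => hx (by simp [h])
  have hb : Integrable fun x => η x ^ 2 * (‖kohn φ v x‖ * ‖v x‖) * Real.exp (-φ x) := by
    refine Continuous.integrable_of_hasCompactSupport (by fun_prop) ?_
    exact hηc.mono fun x hx h => hx (by simp [h])
  have hc : Integrable fun x => (∑ j, ‖wd (-I) j H x‖ ^ 2) * ‖v x‖ ^ 2 * Real.exp (-φ x) := by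
    refine Continuous.integrable_of_hasCompactSupport (by fun_prop) ?_
    refine HasCompactSupport.intro hHc.isCompact fun x hx => ?_
    have hz : fderiv ℝ H x = 0 := by
      by_contra h; exact hx (support_fderiv_subset ℝ h)
    simp [wd, hz]
  have hpt : ∀ x, (kohn φ v x * g x * wt φ x - ∑ j, wd I j v x * wd (-I) j g x * wt φ x).re ≤
      η x ^ 2 * (‖kohn φ v x‖ * ‖v x‖) * Real.exp (-φ x) -
      (1 / 2) * (η x ^ 2 * (∑ j, ‖wd I j v x‖ ^ 2) * Real.exp (-φ x)) +
      2 * ((∑ j, ‖wd (-I) j H x‖ ^ 2) * ‖v x‖ ^ 2 * Real.exp (-φ x)) := by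
    intro x
    have hwx : wt φ x = ((Real.exp (-φ x) : ℝ) : ℂ) := by simp [wt]
    rw [hwx, ← Finset.sum_mul, ← sub_mul, re_mul_ofReal]
    have hb1 : (kohn φ v x * g x).re ≤ η x ^ 2 * (‖kohn φ v x‖ * ‖v x‖) := by
      refine (re_le_norm _).trans (le_of_eq ?_)
      simp only [hg, hH, norm_mul, norm_real, RCLike.norm_conj, Real.norm_eq_abs]
      rw [← sq_abs]; ring
    have hb2 : ∀ j, -(wd I j v x * wd (-I) j g x).re ≤
        -(1 / 2) * (η x ^ 2 * ‖wd I j v x‖ ^ 2) + 2 * (‖wd (-I) j H x‖ ^ 2 * ‖v x‖ ^ 2) := by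
      intro j
      have e : wd I j v x * wd (-I) j g x = wd I j v x * (2 * H x * wd (-I) j H x * conj (v x)) +
          ((η x ^ 2 * ‖wd I j v x‖ ^ 2 : ℝ) : ℂ) := by
        rw [hdg]
        have := mul_conj' (wd I j v x)
        push_cast
        rw [← this]; simp only [hH]; ring
      rw [e, add_re, ofReal_re]
      have h1 := neg_le_of_abs_le ((abs_re_le_norm (wd I j v x * (2 * H x * wd (-I) j H x * conj (v x)))))
      have h2 : ‖wd I j v x * (2 * H x * wd (-I) j H x * conj (v x))‖ =
          2 * (|η x| * ‖wd I j v x‖) * (‖wd (-I) j H x‖ * ‖v x‖) := by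
        simp only [hH, norm_mul, norm_real, RCLike.norm_conj, Real.norm_eq_abs]; simp; ring
      rw [h2] at h1
      have h3 : η x ^ 2 * ‖wd I j v x‖ ^ 2 = (|η x| * ‖wd I j v x‖) ^ 2 := by rw [mul_pow, sq_abs]
      rw [h3]
      nlinarith [sq_nonneg ((|η x| * ‖wd I j v x‖) - 2 * (‖wd (-I) j H x‖ * ‖v x‖))]
    have hb3 := Finset.sum_le_sum fun j (_ : j ∈ Finset.univ) => hb2 j
    rw [Finset.sum_neg_distrib, Finset.sum_add_distrib, ← Finset.mul_sum, ← Finset.mul_sum,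
      ← Finset.mul_sum, ← Finset.sum_mul] at hb3
    rw [sub_re, re_sum]
    have := mul_le_mul_of_nonneg_right (add_le_add hb1 hb3) (Real.exp_pos (-φ x)).le
    linarith
  have hfin := integral_mono_ae (μ := volume)
    (hi1.sub (integrable_finsetSum Finset.univ fun j _ => hi2 j)).re
    ((hb.sub (ha.const_mul (1 / 2))).add (hc.const_mul 2)) (ae_of_all _ hpt)
  have e1 : ∫ x, RCLike.re ((fun x => kohn φ v x * g x * wt φ x) x -
      (fun x => ∑ j, wd I j v x * wd (-I) j g x * wt φ x) x) = 0 := h0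
  have e2 := integral_add (hb.sub (ha.const_mul (1 / 2))) (hc.const_mul 2)
  have e3 := integral_sub hb (ha.const_mul (1 / 2))
  simp only [Pi.sub_apply, Pi.add_apply] at e2 e3 hfin
  rw [e1, e2, e3, integral_const_mul, integral_const_mul] at hfin
  linarith

end cacc

section liouville
variable {n : ℕ} {w : (Fin n → ℂ) → ℂ} {φ : (Fin n → ℂ) → ℝ}

theorem integrableOn_sq_of_lintegral_le {f : (Fin n → ℂ) → ℂ} (hf : Measurable f)
    {s : Set (Fin n → ℂ)} {δ : ℝ} (hδ : 0 ≤ δ) (h : ∫⁻ x in s, ‖f x‖ₑ ^ 2 ≤ ENNReal.ofReal δ) :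
    IntegrableOn (fun x => ‖f x‖ ^ 2) s ∧ ∫ x in s, ‖f x‖ ^ 2 ≤ δ := by
  have e : ∀ x, ENNReal.ofReal (‖f x‖ ^ 2) = ‖f x‖ₑ ^ 2 := fun x => by
    rw [ENNReal.ofReal_pow (norm_nonneg _), ofReal_norm]
  have hm : AEStronglyMeasurable (fun x => ‖f x‖ ^ 2) (volume.restrict s) := by
    exact (hf.norm.pow_const 2).aestronglyMeasurable
  constructor
  · refine ⟨hm, ?_⟩
    rw [hasFiniteIntegral_iff_ofReal (ae_of_all _ fun x => by positivity)]
    simp only [e]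
    exact h.trans_lt ENNReal.ofReal_lt_top
  · rw [integral_eq_lintegral_of_nonneg_ae (ae_of_all _ fun x => by positivity) hm]
    simp only [e]
    exact ENNReal.toReal_le_of_le_ofReal hδ h

theorem integrableOn_sq_closedBall (hφ : Continuous φ) (hm : Measurable w)
    (hi : Integrable fun x => ‖w x‖ ^ 2 * Real.exp (-φ x)) (R : ℝ) :
    IntegrableOn (fun x => ‖w x‖ ^ 2) (closedBall 0 R) := by
  obtain ⟨C, hC⟩ := (isCompact_closedBall (0 : Fin n → ℂ) R).exists_bound_of_continuousOn
    hφ.continuousOn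
  refine Integrable.mono' ((hi.const_mul (Real.exp C)).integrableOn (s := closedBall 0 R))
    (hm.norm.pow_const 2).aestronglyMeasurable ?_
  filter_upwards [ae_restrict_mem measurableSet_closedBall] with x hx
  have h1 := (abs_le.1 (hC x hx)).2
  have h2 : 1 ≤ Real.exp C * Real.exp (-φ x) := by
    rw [← Real.exp_add]; exact Real.one_le_exp (by linarith)
  rw [Real.norm_of_nonneg (by positivity)]
  nlinarith [sq_nonneg ‖w x‖]

theorem memLp_indicator_closedBall (hφ : Continuous φ) (hm : Measurable w)
    (hi : Integrable fun x => ‖w x‖ ^ 2 * Real.exp (-φ x)) (R : ℝ) :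
    MemLp ((closedBall 0 R).indicator w) 2 := by
  rw [memLp_indicator_iff_restrict measurableSet_closedBall,
    memLp_two_iff_integrable_sq_norm hm.aestronglyMeasurable]
  exact integrableOn_sq_closedBall hφ hm hi R

theorem locallyIntegrable_of_weighted (hφ : Continuous φ) (hm : Measurable w)
    (hi : Integrable fun x => ‖w x‖ ^ 2 * Real.exp (-φ x)) : LocallyIntegrable w := by
  rw [locallyIntegrable_iff]
  intro K hK
  obtain ⟨R, hR⟩ := hK.isBounded.subset_closedBall 0
  refine IntegrableOn.mono_set ?_ hR
  have := memLp_indicator_closedBall hφ hm hi R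
  rw [memLp_indicator_iff_restrict measurableSet_closedBall] at this
  have hfin : IsFiniteMeasure (volume.restrict (closedBall (0 : Fin n → ℂ) R)) :=
    ⟨by simpa using measure_closedBall_lt_top⟩
  exact this.integrable (by norm_num)

end liouville

section liouville
variable {n : ℕ} {w v : (Fin n → ℂ) → ℂ} {φ : (Fin n → ℂ) → ℝ}

theorem exists_cutoff (n : ℕ) : ∃ η : (Fin n → ℂ) → ℝ, ContDiff ℝ ∞ η ∧ (∀ x, 0 ≤ η x ∧ η x ≤ 1) ∧
    (∀ x, ‖x‖ ≤ 1 → η x = 1) ∧ (∀ x, 2 ≤ ‖x‖ → η x = 0) ∧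
    ∃ B, 0 ≤ B ∧ ∀ s j x, ‖s‖ = 1 → ‖wd s j (fun x => (η x : ℂ)) x‖ ≤ B := by
  let f : ContDiffBump (0 : Fin n → ℂ) := ⟨1, 2, by norm_num, by norm_num⟩
  have hs : ContDiff ℝ ∞ fun x => ((f x : ℝ) : ℂ) := contDiff_ofReal_comp f.contDiff
  have hc : HasCompactSupport fun x => ((f x : ℝ) : ℂ) :=
    f.hasCompactSupport.comp_left (g := fun t : ℝ => (t : ℂ)) (by simp)
  refine ⟨f, f.contDiff, fun x => ⟨f.nonneg, f.le_one⟩, fun x hx => f.one_of_mem_closedBall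
    (by simpa using hx), fun x hx => f.zero_of_le_dist (by simpa using hx), ?_⟩
  obtain ⟨C, hC⟩ := (hc.fderiv ℝ).exists_bound_of_continuous (hs.continuous_fderiv (by simp))
  have hC0 : 0 ≤ C := (norm_nonneg _).trans (hC 0)
  refine ⟨C, hC0, fun s j x h1 => ?_⟩
  have hb : ∀ c : ℂ, ‖c‖ = 1 → ‖fderiv ℝ (fun x => ((f x : ℝ) : ℂ)) x (Pi.single j c)‖ ≤ C :=
    fun c hc => by
      refine ((fderiv ℝ (fun x => ((f x : ℝ) : ℂ)) x).le_opNorm _).trans ?_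
      rw [Pi.norm_single, hc, mul_one]; exact hC x
  rw [wd, norm_div]
  have := norm_add_le (fderiv ℝ (fun x => ((f x : ℝ) : ℂ)) x (Pi.single j 1))
    (s * fderiv ℝ (fun x => ((f x : ℝ) : ℂ)) x (Pi.single j I))
  rw [norm_mul, h1, one_mul] at this
  have h2 := hb 1 (by simp)
  have h3 := hb I (by simp)
  rw [div_le_iff₀ (by simp)]
  simp only [RCLike.norm_ofNat]; linarith

theorem integral_le_setIntegral {f g : (Fin n → ℂ) → ℝ} {S : Set (Fin n → ℂ)}
    (hS : MeasurableSet S) (hf : Integrable f) (hg : IntegrableOn g S) (h0 : ∀ x, x ∉ S → f x = 0)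
    (hle : ∀ x ∈ S, f x ≤ g x) : ∫ x, f x ≤ ∫ x in S, g x := by
  rw [← setIntegral_eq_integral_of_forall_compl_eq_zero h0]
  exact setIntegral_mono_on hf.integrableOn hg hS hle

/-- Interior estimate for `∂̄ v` when `v` almost solves the equation. -/
theorem exists_interior_estimate (hφ : ContDiff ℝ ∞ φ) (M : ℝ) :
    ∃ C, 0 ≤ C ∧ ∀ R, 1 ≤ R → ∀ E, (∀ x, ‖x‖ ≤ 2 * R → Real.exp (-φ x) ≤ E) →
      ∀ v : (Fin n → ℂ) → ℂ, ContDiff ℝ ∞ v →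
      ∫ x in closedBall 0 (2 * R), ‖v x‖ ^ 2 * Real.exp (-φ x) ≤ M →
      ∫ x in closedBall 0 (2 * R), ‖kohn φ v x‖ ^ 2 ≤ 1 / (E * R ^ 4) →
      ∃ η : (Fin n → ℂ) → ℝ, Continuous η ∧ HasCompactSupport η ∧ (∀ x, ‖x‖ ≤ R → η x = 1) ∧
        ∫ x, η x ^ 2 * (∑ j, ‖wd I j v x‖ ^ 2) * Real.exp (-φ x) ≤ C / R ^ 2 := by
  obtain ⟨η₁, hη₁, hη01, hη1, hη0, B, hB0, hB⟩ := exists_cutoff n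
  refine ⟨1 + |M| + 4 * (n * B ^ 2 * |M|), by positivity, fun R hR E hE v hv hV hK => ?_⟩
  have hR0 : 0 < R := by linarith
  have hE0 : 0 < E := (Real.exp_pos _).trans_le (hE 0 (by simp; linarith))
  set S : Set (Fin n → ℂ) := closedBall 0 (2 * R) with hS
  set η : (Fin n → ℂ) → ℝ := fun x => η₁ (R⁻¹ • x) with hη
  have hns : ∀ x : Fin n → ℂ, ‖R⁻¹ • x‖ = ‖x‖ / R := fun x => by
    rw [norm_smul, norm_inv, Real.norm_of_nonneg hR0.le, inv_mul_eq_div]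
  have hηs : ContDiff ℝ ∞ η := hη₁.comp (contDiff_const_smul _)
  have hη0' : ∀ x, x ∉ S → η x = 0 := fun x hx => hη0 _ (by
    have : 2 * R < ‖x‖ := by simpa [hS] using hx
    rw [hns, le_div_iff₀ hR0]; exact this.le)
  have hηc : HasCompactSupport η := HasCompactSupport.intro (isCompact_closedBall 0 (2 * R)) hη0'
  have hηc' : HasCompactSupport fun x => (η x : ℂ) :=
    hηc.comp_left (g := fun t : ℝ => (t : ℂ)) (by simp)
  have hdη : ∀ j x, ‖wd (-I) j (fun x => (η x : ℂ)) x‖ ≤ B / R := fun j x => by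
    have e := congrFun (wd_comp_smul (s := -I) (j := j) (contDiff_ofReal_comp hη₁) R⁻¹) x
    change ‖wd (-I) j (fun y => ((η₁ (R⁻¹ • y) : ℝ) : ℂ)) x‖ ≤ _
    rw [e, norm_mul, norm_real, norm_inv, Real.norm_of_nonneg hR0.le, inv_mul_eq_div]
    exact div_le_div_of_nonneg_right (hB _ _ _ (by simp)) hR0.le
  have hdη0 : ∀ j x, x ∉ S → wd (-I) j (fun x => (η x : ℂ)) x = 0 := fun j x hx => by
    have : (fun x => (η x : ℂ)) =ᶠ[𝓝 x] fun _ => 0 := by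
      filter_upwards [isClosed_closedBall.isOpen_compl.mem_nhds hx] with y hy
      simp [hη0' y hy]
    simp [wd, this.fderiv_eq]
  have hvc := hv.continuous
  have hKc := (contDiff_kohn hφ hv).continuous
  have hφc := hφ.continuous
  have hηcont := hηs.continuous
  have hdvc : ∀ j, Continuous (wd (-I) j fun x => (η x : ℂ)) := fun j =>
    (contDiff_wd (contDiff_ofReal_comp hηs)).continuous
  have hcpt : IsCompact S := isCompact_closedBall 0 (2 * R)
  have hiV : IntegrableOn (fun x => ‖v x‖ ^ 2 * Real.exp (-φ x)) S :=
    (by fun_prop : Continuous _).continuousOn.integrableOn_compact hcpt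
  have hiK : IntegrableOn (fun x => ‖kohn φ v x‖ ^ 2) S :=
    (by fun_prop : Continuous _).continuousOn.integrableOn_compact hcpt
  have hV' : ∫ x in S, ‖v x‖ ^ 2 * Real.exp (-φ x) ≤ |M| := hV.trans (le_abs_self M)
  refine ⟨η, hηs.continuous, hηc, fun x hx => hη1 _ (by rw [hns, div_le_one hR0]; exact hx), ?_⟩
  have hfirst : ∫ x, η x ^ 2 * (‖kohn φ v x‖ * ‖v x‖) * Real.exp (-φ x) ≤
      (1 + |M|) / (2 * R ^ 2) := by
    calc _ ≤ ∫ x in S, (E * R ^ 2 / 2 * ‖kohn φ v x‖ ^ 2 +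
          1 / (2 * R ^ 2) * (‖v x‖ ^ 2 * Real.exp (-φ x))) := by
          refine integral_le_setIntegral measurableSet_closedBall
            (Continuous.integrable_of_hasCompactSupport (by fun_prop)
              (hηc.mono fun x hx h => hx (by simp [h])))
            ((hiK.const_mul _).add (hiV.const_mul _)) (fun x hx => by simp [hη0' x hx])
            fun x hx => ?_
          have hex := hE x (by simpa [hS] using hx)
          have hep := Real.exp_pos (-φ x)
          obtain ⟨h0, h1⟩ : 0 ≤ η x ∧ η x ≤ 1 := hη01 _
          have h2 : η x ^ 2 ≤ 1 := pow_le_one₀ h0 h1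
          set a := ‖kohn φ v x‖
          set b := ‖v x‖
          have ha : 0 ≤ a := norm_nonneg _
          have hb : 0 ≤ b := norm_nonneg _
          have hab : a * b ≤ R ^ 2 / 2 * a ^ 2 + 1 / (2 * R ^ 2) * b ^ 2 := by
            have : R ^ 2 / 2 * a ^ 2 + 1 / (2 * R ^ 2) * b ^ 2 - a * b =
              (1 / 2) * (R * a - b / R) ^ 2 := by field_simp; ring
            nlinarith [sq_nonneg (R * a - b / R)]
          calc η x ^ 2 * (a * b) * Real.exp (-φ x) ≤ 1 * (a * b) * Real.exp (-φ x) := by gcongr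
            _ ≤ (R ^ 2 / 2 * a ^ 2 + 1 / (2 * R ^ 2) * b ^ 2) * Real.exp (-φ x) := by
              rw [one_mul]; gcongr
            _ = R ^ 2 / 2 * a ^ 2 * Real.exp (-φ x) +
                1 / (2 * R ^ 2) * (b ^ 2 * Real.exp (-φ x)) := by ring
            _ ≤ R ^ 2 / 2 * a ^ 2 * E + 1 / (2 * R ^ 2) * (b ^ 2 * Real.exp (-φ x)) := by gcongr
            _ = _ := by ring
      _ = E * R ^ 2 / 2 * (∫ x in S, ‖kohn φ v x‖ ^ 2) +
          1 / (2 * R ^ 2) * ∫ x in S, ‖v x‖ ^ 2 * Real.exp (-φ x) := by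
          rw [integral_add (hiK.const_mul _) (hiV.const_mul _), integral_const_mul,
            integral_const_mul]
      _ ≤ E * R ^ 2 / 2 * (1 / (E * R ^ 4)) + 1 / (2 * R ^ 2) * |M| := by gcongr
      _ = _ := by field_simp
  have hsecond : ∫ x, (∑ j, ‖wd (-I) j (fun x => (η x : ℂ)) x‖ ^ 2) * ‖v x‖ ^ 2 *
      Real.exp (-φ x) ≤ n * B ^ 2 * |M| / R ^ 2 := by
    calc _ ≤ ∫ x in S, n * (B / R) ^ 2 * (‖v x‖ ^ 2 * Real.exp (-φ x)) := by
          refine integral_le_setIntegral measurableSet_closedBall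
            (Continuous.integrable_of_hasCompactSupport (by fun_prop)
              (HasCompactSupport.intro hcpt fun x hx => by simp [hdη0 _ x hx]))
            (hiV.const_mul _) (fun x hx => by simp [hdη0 _ x hx]) fun x hx => ?_
          rw [mul_assoc]
          gcongr
          calc _ ≤ ∑ j : Fin n, (B / R) ^ 2 := Finset.sum_le_sum fun j _ => by
                gcongr; exact hdη j x
            _ = _ := by simp
      _ = n * (B / R) ^ 2 * ∫ x in S, ‖v x‖ ^ 2 * Real.exp (-φ x) := integral_const_mul _ _
      _ ≤ n * (B / R) ^ 2 * |M| := by gcongr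
      _ = _ := by ring
  calc _ ≤ _ := caccioppoli hφ hv hηs hηc
    _ ≤ 2 * ((1 + |M|) / (2 * R ^ 2)) + 4 * (n * B ^ 2 * |M| / R ^ 2) := by gcongr
    _ = _ := by field_simp

end liouville

section liouville
variable {n : ℕ} {w v : (Fin n → ℂ) → ℂ} {φ : (Fin n → ℂ) → ℝ}

theorem norm_integral_mul_le {f g : (Fin n → ℂ) → ℂ} {F G : (Fin n → ℂ) → ℝ} {a b R : ℝ}
    (hR : 0 < R) (hF : Integrable F) (hG : Integrable G) (hFa : ∫ x, F x ≤ a / R ^ 2)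
    (hGb : ∫ x, G x ≤ b) (h : ∀ x, ‖f x * g x‖ ≤ R / 2 * F x + 1 / (2 * R) * G x) :
    ‖∫ x, f x * g x‖ ≤ (a + b) / (2 * R) := by
  calc _ ≤ ∫ x, (R / 2 * F x + 1 / (2 * R) * G x) :=
        norm_integral_le_of_norm_le ((hF.const_mul _).add (hG.const_mul _)) (ae_of_all _ h)
    _ = R / 2 * (∫ x, F x) + 1 / (2 * R) * ∫ x, G x := by
        rw [integral_add (hF.const_mul _) (hG.const_mul _), integral_const_mul, integral_const_mul]
    _ ≤ R / 2 * (a / R ^ 2) + 1 / (2 * R) * b := by gcongr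
    _ = _ := by field_simp

theorem am_gm_weighted {R a b c : ℝ} (hR : 0 < R) (hc : 0 < c) :
    a * b ≤ R / 2 * (a ^ 2 * c) + 1 / (2 * R) * (b ^ 2 * c⁻¹) := by
  have : R / 2 * (a ^ 2 * c) + 1 / (2 * R) * (b ^ 2 * c⁻¹) - a * b =
      (R * a * c - b) ^ 2 / (2 * R * c) := by field_simp; ring
  have h2 : 0 ≤ (R * a * c - b) ^ 2 / (2 * R * c) := by positivity
  linarith

/-- A square integrable weak solution of `∂̄* ∂̄ w = 0` is weakly holomorphic. -/
theorem integral_mul_wd_eq_zero (hφ : ContDiff ℝ ∞ φ) (hm : Measurable w)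
    (hi : Integrable fun x => ‖w x‖ ^ 2 * Real.exp (-φ x))
    (hW : ∀ h : (Fin n → ℂ) → ℂ, ContDiff ℝ ∞ h → HasCompactSupport h →
      ∫ x, w x * conj (kohn φ h x) * wt φ x = 0) (j : Fin n) {k : (Fin n → ℂ) → ℂ}
    (hk : ContDiff ℝ ∞ k) (hkc : HasCompactSupport k) : ∫ x, w x * wd I j k x = 0 := by
  have hφc := hφ.continuous
  have hw := locallyIntegrable_of_weighted hφc hm hi
  set M := ∫ x, ‖w x‖ ^ 2 * Real.exp (-φ x) with hM
  obtain ⟨C, hC0, hC⟩ := exists_interior_estimate hφ (2 + 2 * M)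
  have hdk := contDiff_wd (s := I) (j := j) hk
  have hdkc := hasCompactSupport_wd (s := I) (j := j) hkc
  have hdkcont := hdk.continuous
  have hkcont := hk.continuous
  obtain ⟨R₀, hR₀⟩ := hkc.isBounded.subset_closedBall 0
  have hk0 : ∀ x, R₀ < ‖x‖ → k x = 0 := fun x hx => by
    by_contra h
    have := hR₀ (subset_tsupport _ h)
    simp at this; linarith
  have hdk0 : ∀ x, R₀ < ‖x‖ → wd I j k x = 0 := fun x hx => by
    have : k =ᶠ[𝓝 x] fun _ => 0 := by
      filter_upwards [(isOpen_lt continuous_const continuous_norm).mem_nhds hx] with z hz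
      exact hk0 z hz
    simp [wd, this.fderiv_eq]
  set K₁ := ∫ x, ‖k x‖ ^ 2 * Real.exp (φ x)
  set K₂ := ∫ x, ‖wd I j k x‖ ^ 2
  have hK₁ : Integrable fun x => ‖k x‖ ^ 2 * Real.exp (φ x) :=
    Continuous.integrable_of_hasCompactSupport (by fun_prop) (hkc.mono fun x hx h => hx (by simp [h]))
  have hK₂ : Integrable fun x => ‖wd I j k x‖ ^ 2 :=
    Continuous.integrable_of_hasCompactSupport (by fun_prop) (hdkc.mono fun x hx h => hx (by simp [h]))
  have key : ∀ R, 1 ≤ R → R₀ ≤ R → ‖∫ x, w x * wd I j k x‖ ≤ (1 + K₂ + (C + K₁)) / (2 * R) := by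
    intro R hR hRR
    have hR0 : 0 < R := by linarith
    set S : Set (Fin n → ℂ) := closedBall 0 (2 * R) with hS
    have hcpt : IsCompact S := isCompact_closedBall 0 (2 * R)
    obtain ⟨E', hE'⟩ := hcpt.exists_bound_of_continuousOn
      (f := fun x => Real.exp (-φ x)) (by fun_prop)
    set E := max E' 1
    have hE1 : 1 ≤ E := le_max_right _ _
    have hE : ∀ x, ‖x‖ ≤ 2 * R → Real.exp (-φ x) ≤ E := fun x hx => by
      have := hE' x (by simpa [hS] using hx)
      rw [Real.norm_of_nonneg (Real.exp_pos _).le] at this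
      exact this.trans (le_max_left _ _)
    set δ := 1 / (E * R ^ 4) with hδ
    have hδ0 : 0 < δ := by positivity
    have hR4 : 1 ≤ R ^ 4 := one_le_pow₀ hR
    have hR2 : 1 ≤ R ^ 2 := one_le_pow₀ hR
    have hEδ : E * δ ≤ 1 := by
      rw [hδ]; rw [mul_one_div, div_le_one (by positivity)]; nlinarith
    have hδR : δ ≤ 1 / R ^ 2 := by
      rw [hδ]; apply one_div_le_one_div_of_le (by positivity)
      calc R ^ 2 = 1 * R ^ 2 * 1 := by ring
        _ ≤ E * R ^ 2 * R ^ 2 := by gcongr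
        _ = _ := by ring
    obtain ⟨v, hv, hvw, hvK⟩ := exists_mollification hφ hm (memLp_indicator_closedBall hφc hm hi) hw hW
      (2 * R) (δ := ENNReal.ofReal δ) (by simpa using hδ0)
    have hvc := hv.continuous
    obtain ⟨hi1, h1⟩ := integrableOn_sq_of_lintegral_le (f := fun x => v x - w x)
      (hvc.measurable.sub hm) hδ0.le hvw
    obtain ⟨hi2, h2⟩ := integrableOn_sq_of_lintegral_le (contDiff_kohn hφ hv).continuous.measurable
      hδ0.le hvK
    have hV : ∫ x in S, ‖v x‖ ^ 2 * Real.exp (-φ x) ≤ 2 + 2 * M := by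
      calc _ ≤ ∫ x in S, (2 * E * ‖v x - w x‖ ^ 2 + 2 * (‖w x‖ ^ 2 * Real.exp (-φ x))) := by
            refine setIntegral_mono_on
              ((by fun_prop : Continuous _).continuousOn.integrableOn_compact hcpt)
              ((hi1.const_mul _).add (hi.integrableOn.const_mul _)) measurableSet_closedBall
              fun x hx => ?_
            have hex := hE x (by simpa [hS] using hx)
            have hv2 : ‖v x‖ ^ 2 ≤ 2 * ‖v x - w x‖ ^ 2 + 2 * ‖w x‖ ^ 2 := by
              have := norm_add_le (v x - w x) (w x)
              rw [sub_add_cancel] at this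
              have h3 := pow_le_pow_left₀ (norm_nonneg _) this 2
              nlinarith [sq_nonneg (‖v x - w x‖ - ‖w x‖)]
            calc ‖v x‖ ^ 2 * Real.exp (-φ x)
                ≤ (2 * ‖v x - w x‖ ^ 2 + 2 * ‖w x‖ ^ 2) * Real.exp (-φ x) := by gcongr
              _ = 2 * ‖v x - w x‖ ^ 2 * Real.exp (-φ x) +
                  2 * (‖w x‖ ^ 2 * Real.exp (-φ x)) := by ring
              _ ≤ 2 * ‖v x - w x‖ ^ 2 * E + 2 * (‖w x‖ ^ 2 * Real.exp (-φ x)) := by gcongr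
              _ = _ := by ring
        _ = 2 * E * (∫ x in S, ‖v x - w x‖ ^ 2) + 2 * ∫ x in S, ‖w x‖ ^ 2 * Real.exp (-φ x) := by
            rw [integral_add (hi1.const_mul _) (hi.integrableOn.const_mul _), integral_const_mul,
              integral_const_mul]
        _ ≤ 2 * E * δ + 2 * M := by
            gcongr
            exact setIntegral_le_integral hi (ae_of_all _ fun x => by positivity)
        _ ≤ _ := by linarith
    obtain ⟨η, hηc, hηs, hη1, hη⟩ := hC R hR E hE v hv hV h2
    have hdvc : ∀ j, Continuous (wd I j v) := fun j => (contDiff_wd hv).continuous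
    have e : ∫ x, w x * wd I j k x = (∫ x, (w x - v x) * wd I j k x) - ∫ x, wd I j v x * k x := by
      rw [integral_wd_mul hv hk hkc, sub_neg_eq_add, ← integral_add]
      · congr 1; ext x; ring
      · simp only [sub_mul]
        exact (hw.integrable_mul_smooth hdk hdkc).sub (integrable_of_smooth (hv.mul hdk) hdkc.mul_left)
      · exact integrable_of_smooth (hv.mul hdk) hdkc.mul_left
    have hA : ‖∫ x, (w x - v x) * wd I j k x‖ ≤ (1 + K₂) / (2 * R) := by
      refine norm_integral_mul_le (F := S.indicator fun x => ‖v x - w x‖ ^ 2) hR0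
        (hi1.integrable_indicator measurableSet_closedBall) hK₂ ?_ le_rfl fun x => ?_
      · rw [integral_indicator measurableSet_closedBall]; exact h1.trans hδR
      · by_cases hx : x ∈ S
        · rw [indicator_of_mem hx, norm_mul, norm_sub_rev]
          simpa using am_gm_weighted (a := ‖v x - w x‖) (b := ‖wd I j k x‖) hR0 one_pos
        · rw [indicator_of_notMem hx, hdk0 x (by
            have : 2 * R < ‖x‖ := by simpa [hS] using hx
            linarith)]
          simp
    have hB : ‖∫ x, wd I j v x * k x‖ ≤ (C + K₁) / (2 * R) := by
      refine norm_integral_mul_le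
        (F := fun x => η x ^ 2 * (∑ j, ‖wd I j v x‖ ^ 2) * Real.exp (-φ x)) hR0
        (Continuous.integrable_of_hasCompactSupport (by fun_prop)
          (hηs.mono fun x hx h => hx (by simp [h]))) hK₁ hη le_rfl fun x => ?_
      rcases le_or_gt ‖x‖ R with hx | hx
      · rw [hη1 x hx, norm_mul, one_pow, one_mul]
        refine (am_gm_weighted (a := ‖wd I j v x‖) (b := ‖k x‖) hR0 (Real.exp_pos (-φ x))).trans ?_
        rw [← Real.exp_neg, neg_neg]
        gcongr
        exact Finset.single_le_sum (f := fun j => ‖wd I j v x‖ ^ 2) (fun i _ => by positivity)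
          (Finset.mem_univ j)
      · rw [hk0 x (by linarith)]
        simp only [mul_zero, norm_zero]
        positivity
    rw [e]
    calc _ ≤ (1 + K₂) / (2 * R) + (C + K₁) / (2 * R) := (norm_sub_le _ _).trans (add_le_add hA hB)
      _ = _ := by ring
  have hlim : Tendsto (fun R : ℝ => (1 + K₂ + (C + K₁)) / (2 * R)) atTop (𝓝 0) :=
    tendsto_const_nhds.div_atTop (tendsto_id.const_mul_atTop (by norm_num))
  refine norm_le_zero_iff.1 (ge_of_tendsto hlim ?_)
  filter_upwards [eventually_ge_atTop 1, eventually_ge_atTop R₀] with R h1 h2 using key R h1 h2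

/-- **Hörmander's theorem** in projection form: a test function `χ` is approximated in the weighted
norm by a weakly holomorphic function, with error controlled by `∂̄χ`. -/
theorem exists_weakly_holomorphic (hφ : ContDiff ℝ ∞ φ)
    (hL : ∀ (x : Fin n → ℂ) (a : Fin n → ℂ), ∑ j, ‖a j‖ ^ 2 ≤
      (∑ k, ∑ j, wd I k (wd (-I) j (fun x => (φ x : ℂ))) x * a j * conj (a k)).re)
    {χ : (Fin n → ℂ) → ℂ} (hχ : ContDiff ℝ ∞ χ) (hχc : HasCompactSupport χ) :
    ∃ w : (Fin n → ℂ) → ℂ, LocallyIntegrable w ∧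
      (∀ j k, ContDiff ℝ ∞ k → HasCompactSupport k → ∫ x, w x * wd I j k x = 0) ∧
      Integrable (fun x => ‖w x‖ ^ 2 * Real.exp (-φ x)) ∧
      ∫ x, ‖w x‖ ^ 2 * Real.exp (-φ x) ≤ ∫ x, ‖χ x‖ ^ 2 * Real.exp (-φ x) ∧
      Integrable (fun x => ‖χ x - w x‖ ^ 2 * Real.exp (-φ x)) ∧
      ∫ x, ‖χ x - w x‖ ^ 2 * Real.exp (-φ x) ≤
        ∫ x, (∑ j, ‖wd I j χ x‖ ^ 2) * Real.exp (-φ x) := by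
  obtain ⟨u, hu, hu1, hu2⟩ := exists_weak_solution hφ hL hχ hχc
  have hφc := hφ.continuous
  set w : (Fin n → ℂ) → ℂ := fun x => u x * (Real.exp (φ x / 2) : ℝ) with hw
  have hexp : ∀ x, Real.exp (φ x / 2) * Real.exp (-φ x / 2) = 1 := fun x => by
    rw [← Real.exp_add]; simp [neg_div]
  have hexp2 : ∀ x, Real.exp (-φ x) = Real.exp (-φ x / 2) ^ 2 := fun x => by
    rw [← Real.exp_nat_mul]; congr 1; push_cast; ring
  have hum : Measurable u := (Lp.stronglyMeasurable u).measurable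
  have hm : Measurable w := hum.mul (by fun_prop)
  have hw2 : ∀ x, ‖w x‖ ^ 2 * Real.exp (-φ x) = ‖u x‖ ^ 2 := fun x => by
    simp only [hw]
    rw [norm_mul, norm_real, Real.norm_of_nonneg (Real.exp_pos _).le, hexp2, ← mul_pow, mul_assoc,
      hexp, mul_one]
  have hu3 : ∀ x, ‖χ x - w x‖ ^ 2 * Real.exp (-φ x) = ‖halfWt φ χ x - u x‖ ^ 2 := fun x => by
    have : halfWt φ χ x - u x = (χ x - w x) * (Real.exp (-φ x / 2) : ℝ) := by
      simp only [hw, halfWt, sub_mul, mul_assoc]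
      rw [← ofReal_mul, hexp]; simp
    rw [this, norm_mul, norm_real, Real.norm_of_nonneg (Real.exp_pos _).le, mul_pow, hexp2]
  have hi : Integrable (fun x => ‖w x‖ ^ 2 * Real.exp (-φ x)) := by
    simp only [hw2]
    exact (memLp_two_iff_integrable_sq_norm hum.aestronglyMeasurable).1 (Lp.memLp u)
  have hi3 : Integrable (fun x => ‖χ x - w x‖ ^ 2 * Real.exp (-φ x)) := by
    simp only [hu3]
    have := (memLp_halfWt hφc hχ.continuous hχc).sub (Lp.memLp u)
    exact (memLp_two_iff_integrable_sq_norm this.aestronglyMeasurable).1 this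
  have hW : ∀ h : (Fin n → ℂ) → ℂ, ContDiff ℝ ∞ h → HasCompactSupport h →
      ∫ x, w x * conj (kohn φ h x) * wt φ x = 0 := fun h hh hc => by
    rw [← hu h hh hc]
    congr 1; ext x
    simp only [hw, halfWt, map_mul, conj_ofReal, wt]
    have e : cexp (-(φ x : ℂ)) = ((Real.exp (-φ x / 2) ^ 2 : ℝ) : ℂ) := by
      rw [← hexp2]; simp
    have e2 : ((Real.exp (φ x / 2) : ℝ) : ℂ) * ((Real.exp (-φ x / 2) : ℝ) : ℂ) = 1 := by
      rw [← ofReal_mul, hexp, ofReal_one]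
    rw [e, ofReal_pow]
    linear_combination (u x * conj (kohn φ h x) * ((Real.exp (-φ x / 2) : ℝ) : ℂ)) * e2
  refine ⟨w, locallyIntegrable_of_weighted hφc hm hi, fun j k hk hkc =>
    integral_mul_wd_eq_zero hφ hm hi hW j hk hkc, hi, ?_, hi3, ?_⟩
  · simp only [hw2]; rw [← norm_L2_sq]; exact hu1
  · simp only [hu3]; exact hu2

end liouville

end

section
open scoped ContDiff ComplexConjugate

section levi
variable {n : ℕ} {φ ψ : (Fin n → ℂ) → ℝ} {F : (Fin n → ℂ) → ℂ} {x a : Fin n → ℂ}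

theorem eq_sum_single (a : Fin n → ℂ) : a = ∑ j, ((a j).re • (Pi.single j (1:ℂ) : Fin n → ℂ) +
    (a j).im • (Pi.single j I : Fin n → ℂ)) := by
  ext i
  rw [Finset.sum_apply, Finset.sum_eq_single i]
  · simp
  · intro j _ hj; simp [hj.symm]
  · simp

theorem smul_I_eq_sum_single (a : Fin n → ℂ) :
    I • a = ∑ j, ((-(a j).im) • (Pi.single j (1:ℂ) : Fin n → ℂ) +
    (a j).re • (Pi.single j I : Fin n → ℂ)) := by
  refine (eq_sum_single (I • a)).trans (Finset.sum_congr rfl fun j _ => ?_)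
  simp

theorem sum_wd_mul (x a : Fin n → ℂ) : ∑ j, wd (-I) j F x * a j =
    (fderiv ℝ F x a - I * fderiv ℝ F x (I • a)) / 2 := by
  have h1 : fderiv ℝ F x a = _ := congrArg _ (eq_sum_single a)
  have h2 : fderiv ℝ F x (I • a) = _ := congrArg _ (smul_I_eq_sum_single a)
  rw [h1, h2]
  simp only [map_sum, map_add, map_smul, Complex.real_smul]
  rw [Finset.mul_sum, ← Finset.sum_sub_distrib, Finset.sum_div]
  refine Finset.sum_congr rfl fun j _ => ?_
  rw [wd]
  nth_rewrite 1 [← re_add_im (a j)]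
  push_cast
  linear_combination (-(fderiv ℝ F x (Pi.single j I)) * (a j).im / 2) * I_sq

theorem sum_wd_mul_conj (x a : Fin n → ℂ) : ∑ j, wd I j F x * conj (a j) =
    (fderiv ℝ F x a + I * fderiv ℝ F x (I • a)) / 2 := by
  have h1 : fderiv ℝ F x a = _ := congrArg _ (eq_sum_single a)
  have h2 : fderiv ℝ F x (I • a) = _ := congrArg _ (smul_I_eq_sum_single a)
  rw [h1, h2]
  simp only [map_sum, map_add, map_smul, Complex.real_smul]
  rw [Finset.mul_sum, ← Finset.sum_add_distrib, Finset.sum_div]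
  refine Finset.sum_congr rfl fun j _ => ?_
  have hc : conj (a j) = (a j).re - (a j).im * I := by apply Complex.ext <;> simp
  rw [wd, hc]
  push_cast
  linear_combination (-(fderiv ℝ F x (Pi.single j I)) * (a j).im / 2) * I_sq

/-- The Levi form of `φ`. -/
def levi (φ : (Fin n → ℂ) → ℝ) (x a : Fin n → ℂ) : ℝ :=
  (∑ k, ∑ j, wd I k (wd (-I) j (fun x => (φ x : ℂ))) x * a j * conj (a k)).re

theorem fderiv_ofReal_comp (hφ : DifferentiableAt ℝ φ x) (v : Fin n → ℂ) :
    fderiv ℝ (fun x => (φ x : ℂ)) x v = (fderiv ℝ φ x v : ℝ) := by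
  have := (ofRealCLM.hasFDerivAt.comp x hφ.hasFDerivAt).fderiv
  have e : (fun x => (φ x : ℂ)) = ofRealCLM ∘ φ := rfl
  rw [e, this]; rfl

theorem contDiff_fderiv_apply (hφ : ContDiff ℝ ∞ φ) (a : Fin n → ℂ) :
    ContDiff ℝ ∞ fun y => fderiv ℝ φ y a :=
  (hφ.fderiv_right (m := ∞) (by simp)).clm_apply contDiff_const

theorem levi_eq (hφ : ContDiff ℝ ∞ φ) (x a : Fin n → ℂ) :
    levi φ x a = (fderiv ℝ (fun y => fderiv ℝ φ y a) x a +
      fderiv ℝ (fun y => fderiv ℝ φ y (I • a)) x (I • a)) / 4 := by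
  have hΦ := contDiff_ofReal_comp hφ
  have hd : ∀ y, DifferentiableAt ℝ φ y := fun y => (hφ.differentiable (by simp)) y
  have e1 : ∀ k, ∑ j, wd I k (wd (-I) j (fun x => (φ x : ℂ))) x * a j =
      wd I k (fun y => ((fderiv ℝ φ y a : ℝ) - I * (fderiv ℝ φ y (I • a) : ℝ)) * (1 / 2)) x := by
    intro k
    have : (fun y => (((fderiv ℝ φ y a : ℝ) : ℂ) - I * (fderiv ℝ φ y (I • a) : ℝ)) * (1 / 2)) =
        fun y => ∑ j, a j * wd (-I) j (fun x => (φ x : ℂ)) y := by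
      ext y
      simp only [mul_comm (a _)]
      rw [sum_wd_mul, fderiv_ofReal_comp (hd y), fderiv_ofReal_comp (hd y)]; ring
    rw [this, wd_sum fun j _ => (contDiff_const.mul (contDiff_wd hΦ)).diffAt]
    refine Finset.sum_congr rfl fun j _ => ?_
    rw [wd_const_mul _ (contDiff_wd hΦ)]; ring
  rw [levi]
  simp only [← Finset.sum_mul, e1]
  rw [sum_wd_mul_conj]
  set h₁ : (Fin n → ℂ) → ℝ := fun y => fderiv ℝ φ y a
  set h₂ : (Fin n → ℂ) → ℝ := fun y => fderiv ℝ φ y (I • a)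
  have H1 : DifferentiableAt ℝ h₁ x := (contDiff_fderiv_apply hφ a).differentiable (by simp) x
  have H2 : DifferentiableAt ℝ h₂ x :=
    (contDiff_fderiv_apply hφ (I • a)).differentiable (by simp) x
  have e2 : ∀ v, fderiv ℝ (fun y => ((h₁ y : ℂ) - I * (h₂ y : ℂ)) * (1 / 2)) x v =
      ((fderiv ℝ h₁ x v : ℝ) - I * (fderiv ℝ h₂ x v : ℝ)) * (1 / 2) := by
    intro v
    have d1 := (ofRealCLM.hasFDerivAt.comp x H1.hasFDerivAt)
    have d2 := (ofRealCLM.hasFDerivAt.comp x H2.hasFDerivAt)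
    have := ((d1.sub (d2.const_mul I)).mul_const (1 / 2)).fderiv
    have e : (fun y => ((h₁ y : ℂ) - I * (h₂ y : ℂ)) * (1 / 2)) = fun y =>
      ((ofRealCLM ∘ h₁) y - I * (ofRealCLM ∘ h₂) y) * (1 / 2) := rfl
    rw [e]
    erw [this]
    simp; ring
  rw [e2, e2]
  simp
  ring

theorem levi_add (hφ : ContDiff ℝ ∞ φ) (hψ : ContDiff ℝ ∞ ψ) (x a : Fin n → ℂ) :
    levi (fun x => φ x + ψ x) x a = levi φ x a + levi ψ x a := by
  have hd : ∀ {φ : (Fin n → ℂ) → ℝ}, ContDiff ℝ ∞ φ → ∀ y, DifferentiableAt ℝ φ y := fun h y =>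
    h.differentiable (by simp) y
  rw [levi_eq hφ, levi_eq hψ, levi_eq (hφ.add hψ)]
  have e : ∀ v, fderiv ℝ (fun y => fderiv ℝ (fun x => φ x + ψ x) y v) x v =
      fderiv ℝ (fun y => fderiv ℝ φ y v) x v + fderiv ℝ (fun y => fderiv ℝ ψ y v) x v := fun v => by
    have : (fun y => fderiv ℝ (fun x => φ x + ψ x) y v) = fun y =>
        fderiv ℝ φ y v + fderiv ℝ ψ y v := by
      ext y; rw [fderiv_fun_add (hd hφ y) (hd hψ y)]; rfl
    rw [this, fderiv_fun_add (hd (contDiff_fderiv_apply hφ v) x)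
      (hd (contDiff_fderiv_apply hψ v) x)]; rfl
  rw [e, e]; ring

theorem levi_const_mul (hφ : ContDiff ℝ ∞ φ) (c : ℝ) (x a : Fin n → ℂ) :
    levi (fun x => c * φ x) x a = c * levi φ x a := by
  have hd : ∀ {φ : (Fin n → ℂ) → ℝ}, ContDiff ℝ ∞ φ → ∀ y, DifferentiableAt ℝ φ y := fun h y =>
    h.differentiable (by simp) y
  rw [levi_eq hφ, levi_eq (contDiff_const.mul hφ)]
  have e : ∀ v, fderiv ℝ (fun y => fderiv ℝ (fun x => c * φ x) y v) x v =
      c * fderiv ℝ (fun y => fderiv ℝ φ y v) x v := fun v => by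
    have : (fun y => fderiv ℝ (fun x => c * φ x) y v) = fun y => c * fderiv ℝ φ y v := by
      ext y; rw [fderiv_const_mul (hd hφ y)]; rfl
    rw [this, fderiv_const_mul (hd (contDiff_fderiv_apply hφ v) x)]; rfl
  rw [e, e]; ring

/-- The squared Euclidean norm. -/
def sqn (x : Fin n → ℂ) : ℝ := ∑ j, ‖x j‖ ^ 2

/-- The Euclidean real inner product. -/
def rip (a : Fin n → ℂ) : (Fin n → ℂ) →L[ℝ] ℝ :=
  ∑ j, ((a j).re • reCLM.comp (ContinuousLinearMap.proj j) +
    (a j).im • imCLM.comp (ContinuousLinearMap.proj j))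

theorem rip_apply (a x : Fin n → ℂ) :
    rip a x = ∑ j, ((a j).re * (x j).re + (a j).im * (x j).im) := by
  simp [rip]

theorem rip_self (a : Fin n → ℂ) : rip a a = sqn a := by
  rw [rip_apply, sqn]
  exact Finset.sum_congr rfl fun j _ => by rw [← normSq_eq_norm_sq, normSq_apply]

theorem sqn_smul_I (a : Fin n → ℂ) : sqn (I • a) = sqn a := by
  simp [sqn]

theorem contDiff_sqn : ContDiff ℝ ∞ (sqn (n := n)) :=
  ContDiff.sum fun j _ => (contDiff_norm_sq ℝ).comp (contDiff_apply ℝ ℂ j)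

theorem hasFDerivAt_sqn (x : Fin n → ℂ) : HasFDerivAt sqn ((2:ℝ) • rip x) x := by
  have e : (sqn (n := n)) = fun x => ∑ j, ((x j).re ^ 2 + (x j).im ^ 2) := by
    ext x; exact Finset.sum_congr rfl fun j _ => by
      rw [← normSq_eq_norm_sq, normSq_apply]; ring
  rw [e]
  have h : ∀ j : Fin n, HasFDerivAt (fun x : Fin n → ℂ => (x j).re ^ 2 + (x j).im ^ 2)
      ((2:ℝ) • ((x j).re • reCLM.comp (ContinuousLinearMap.proj (R := ℝ) (φ := fun _ => ℂ) j) +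
    (x j).im • imCLM.comp (ContinuousLinearMap.proj j))) x := fun j => by
    have h1 := ((reCLM.comp (ContinuousLinearMap.proj (R := ℝ) (φ := fun _ : Fin n => ℂ) j)).hasFDerivAt
      (x := x)).pow 2
    have h2 := ((imCLM.comp (ContinuousLinearMap.proj (R := ℝ) (φ := fun _ : Fin n => ℂ) j)).hasFDerivAt
      (x := x)).pow 2
    refine (h1.add h2).congr_fderiv ?_
    ext v; simp; ring
  have := HasFDerivAt.fun_sum (u := Finset.univ) fun j _ => h j
  refine this.congr_fderiv ?_
  rw [rip, Finset.smul_sum]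

theorem rip_comm (a x : Fin n → ℂ) : rip a x = rip x a := by
  rw [rip_apply, rip_apply]; exact Finset.sum_congr rfl fun j _ => by ring

theorem fderiv_sqn (a : Fin n → ℂ) : (fun y => fderiv ℝ sqn y a) = fun y => 2 * rip a y := by
  ext y; rw [(hasFDerivAt_sqn y).fderiv, rip_comm]; simp

theorem levi_sqn (x a : Fin n → ℂ) : levi sqn x a = ∑ j, ‖a j‖ ^ 2 := by
  have e : ∀ v, fderiv ℝ (fun y => fderiv ℝ sqn y v) x v = 2 * sqn v := fun v => by
    rw [fderiv_sqn, (((rip v).hasFDerivAt (x := x)).const_mul 2).fderiv]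
    simp [rip_self]
  rw [levi_eq contDiff_sqn, e, e, sqn_smul_I, sqn]; ring

theorem sqn_nonneg (x : Fin n → ℂ) : 0 ≤ sqn x := Finset.sum_nonneg fun j _ => by positivity

theorem rip_sq_add (a x : Fin n → ℂ) : rip a x ^ 2 + rip (I • a) x ^ 2 ≤ sqn a * sqn x := by
  have e : ((∑ j, conj (a j) * x j).re) = rip a x := by
    rw [rip_apply, re_sum]; exact Finset.sum_congr rfl fun j _ => by simp
  have e2 : ((∑ j, conj (a j) * x j).im) = - rip (I • a) x * (-1) := by
    rw [rip_apply, im_sum, neg_mul_neg, mul_one]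
    exact Finset.sum_congr rfl fun j _ => by simp; ring
  have h : ‖∑ j, conj (a j) * x j‖ ^ 2 ≤ sqn a * sqn x := by
    refine (pow_le_pow_left₀ (norm_nonneg _) (norm_sum_le _ _) 2).trans ?_
    simp only [norm_mul, RCLike.norm_conj]
    exact Finset.sum_mul_sq_le_sq_mul_sq _ _ _
  rw [← normSq_eq_norm_sq, normSq_apply, e, e2] at h
  linarith

theorem contDiff_log_sqn {τ : ℝ} (hτ : 0 < τ) :
    ContDiff ℝ ∞ fun x : Fin n → ℂ => Real.log (sqn x + τ) :=
  (contDiff_sqn.add contDiff_const).log fun x => by have := sqn_nonneg x; positivity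

theorem levi_log_sqn {τ : ℝ} (hτ : 0 < τ) (x a : Fin n → ℂ) :
    0 ≤ levi (fun x => Real.log (sqn x + τ)) x a := by
  have hpos : ∀ y : Fin n → ℂ, 0 < sqn y + τ := fun y => by have := sqn_nonneg y; positivity
  have hq : ∀ y : Fin n → ℂ, HasFDerivAt (fun x => sqn x + τ) ((2:ℝ) • rip y) y := fun y =>
    (hasFDerivAt_sqn y).add_const τ
  have e1 : ∀ v, (fun y => fderiv ℝ (fun x => Real.log (sqn x + τ)) y v) =
      fun y => (2 * rip v y) * (sqn y + τ)⁻¹ := fun v => by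
    ext y
    rw [((hq y).log (hpos y).ne').fderiv, rip_comm]
    simp; ring
  have e : ∀ v, fderiv ℝ (fun y => fderiv ℝ (fun x => Real.log (sqn x + τ)) y v) x v =
      2 * (sqn v * (sqn x + τ) - 2 * rip v x ^ 2) / (sqn x + τ) ^ 2 := fun v => by
    have H : HasFDerivAt (fun y => (2 * rip v y) * (sqn y + τ)⁻¹) _ x :=
      (((rip v).hasFDerivAt (x := x)).const_mul 2).mul
        ((hasDerivAt_inv (hpos x).ne').comp_hasFDerivAt x (hq x))
    rw [e1, H.fderiv]
    have := (hpos x).ne'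
    simp [rip_self, rip_comm x v]; field_simp; ring
  rw [levi_eq (contDiff_log_sqn hτ), e, e, sqn_smul_I]
  have h := rip_sq_add a x
  rw [← add_div]
  refine div_nonneg (div_nonneg ?_ (by positivity)) (by norm_num)
  nlinarith [mul_nonneg (sqn_nonneg a) hτ.le]

end levi

section submean
variable {n : ℕ} {φ ψ : (Fin n → ℂ) → ℝ} {x a : Fin n → ℂ}

/-- The integral sub-mean value property on all circles. -/
def SubMean (φ : (Fin n → ℂ) → ℝ) : Prop :=
  ∀ z v, φ z ≤ 1 / (2 * π) * ∫ θ in (0:ℝ)..2 * π, φ (z + exp (θ * I) • v)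

theorem exists_taylor_two (hψ : ContDiff ℝ ∞ ψ) (x : Fin n → ℂ) {ε : ℝ} (hε : 0 < ε) :
    ∃ δ > 0, ∀ v, ‖v‖ < δ → ψ (x + v) ≤ ψ x + fderiv ℝ ψ x v +
      fderiv ℝ (fderiv ℝ ψ) x v v / 2 + ε * ‖v‖ ^ 2 := by
  have hF : HasFDerivAt (fderiv ℝ ψ) (fderiv ℝ (fderiv ℝ ψ) x) x :=
    ((hψ.fderiv_right (m := ∞) (by simp)).differentiable (by simp) x).hasFDerivAt
  set F := fderiv ℝ (fderiv ℝ ψ) x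
  have h1 := (hasFDerivAt_iff_isLittleO_nhds_zero.1 hF).def hε
  obtain ⟨δ, hδ, h2⟩ := Metric.eventually_nhds_iff.1 h1
  refine ⟨δ, hδ, fun v hv => ?_⟩
  have hd : ∀ t : ℝ, HasDerivAt (fun t : ℝ => ψ (x + t • v) - t * fderiv ℝ ψ x v - t ^ 2 / 2 * F v v)
      (fderiv ℝ ψ (x + t • v) v - fderiv ℝ ψ x v - t * F v v) t := fun t => by
    have e1 : HasDerivAt (fun t : ℝ => x + t • v) v t := by
      simpa using ((hasDerivAt_id t).smul_const v).const_add x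
    have e2 := ((hψ.differentiable (by simp) (x + t • v)).hasFDerivAt).comp_hasDerivAt t e1
    have e3 := (hasDerivAt_id t).mul_const (fderiv ℝ ψ x v)
    have e4 := (((hasDerivAt_id t).pow 2).div_const 2).mul_const (F v v)
    have := (e2.sub e3).sub e4
    refine this.congr_deriv ?_
    simp
  have hb : ∀ t ∈ Ico (0:ℝ) 1, ‖fderiv ℝ ψ (x + t • v) v - fderiv ℝ ψ x v - t * F v v‖ ≤
      ε * ‖v‖ ^ 2 := fun t ht => by
    have htv : ‖t • v‖ ≤ ‖v‖ := by
      rw [norm_smul, Real.norm_of_nonneg ht.1]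
      exact mul_le_of_le_one_left (norm_nonneg _) ht.2.le
    have h3 := h2 (y := t • v) (by rw [dist_zero_right]; exact htv.trans_lt hv)
    have e : fderiv ℝ ψ (x + t • v) v - fderiv ℝ ψ x v - t * F v v =
        (fderiv ℝ ψ (x + t • v) - fderiv ℝ ψ x - F (t • v)) v := by simp
    rw [e]
    refine (ContinuousLinearMap.le_of_opNorm_le _ h3 v).trans ?_
    rw [sq, ← mul_assoc]; gcongr
  have := norm_image_sub_le_of_norm_deriv_le_segment_01' (fun t _ => (hd t).hasDerivWithinAt) hb
  simp at this
  have := (abs_le.1 this).2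
  linarith

theorem fderiv_fderiv_apply (hψ : ContDiff ℝ ∞ ψ) (x a v : Fin n → ℂ) :
    fderiv ℝ (fun y => fderiv ℝ ψ y a) x v = fderiv ℝ (fderiv ℝ ψ) x v a := by
  have hF : HasFDerivAt (fderiv ℝ ψ) (fderiv ℝ (fderiv ℝ ψ) x) x :=
    ((hψ.fderiv_right (m := ∞) (by simp)).differentiable (by simp) x).hasFDerivAt
  have := (hF.clm_apply (hasFDerivAt_const a x)).fderiv
  rw [this]; simp

theorem levi_nonneg_of_subMean (hψ : ContDiff ℝ ∞ ψ) (hs : SubMean ψ) (x a : Fin n → ℂ) :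
    0 ≤ levi ψ x a := by
  rw [levi_eq hψ, fderiv_fderiv_apply hψ, fderiv_fderiv_apply hψ]
  set F := fderiv ℝ (fderiv ℝ ψ) x
  refine div_nonneg (le_of_forall_pos_le_add fun ε hε => ?_) (by norm_num)
  obtain ⟨δ, hδ, h⟩ := exists_taylor_two hψ x (ε := ε / (4 * (‖a‖ ^ 2 + 1))) (by positivity)
  set ε' := ε / (4 * (‖a‖ ^ 2 + 1))
  obtain ⟨r, hr, hra⟩ : ∃ r > 0, r * ‖a‖ < δ := by
    refine ⟨δ / (‖a‖ + 1), by positivity, ?_⟩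
    rw [div_mul_eq_mul_div, div_lt_iff₀ (by positivity)]
    nlinarith
  have h1 := hs x ((r:ℂ) • a)
  have hn : ∀ θ : ℝ, ‖exp (θ * I) • (r:ℂ) • a‖ = r * ‖a‖ := fun θ => by
    rw [norm_smul, norm_smul, norm_exp_ofReal_mul_I, one_mul, norm_real, Real.norm_of_nonneg hr.le]
  have hv : ∀ θ : ℝ, exp (θ * I) • (r:ℂ) • a = (r * Real.cos θ) • a + (r * Real.sin θ) • (I • a) :=
    fun θ => by
      ext j
      simp [exp_mul_I]; ring
  have h2 : ∀ θ : ℝ, ψ (x + exp (θ * I) • (r:ℂ) • a) ≤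
      (ψ x + ε' * (r * ‖a‖) ^ 2) + (r * fderiv ℝ ψ x a) * Real.cos θ +
      (r * fderiv ℝ ψ x (I • a)) * Real.sin θ +
      (r ^ 2 * F a a / 2) * Real.cos θ ^ 2 + (r ^ 2 * F (I • a) (I • a) / 2) * Real.sin θ ^ 2 +
      (r ^ 2 * (F a (I • a) + F (I • a) a) / 2) * (Real.sin θ * Real.cos θ) := fun θ => by
    refine (h _ (by rw [hn]; exact hra)).trans (le_of_eq ?_)
    rw [hn, hv]
    simp
    ring
  have hc : Continuous fun θ : ℝ => ψ (x + exp (θ * I) • (r:ℂ) • a) :=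
    hψ.continuous.comp (by fun_prop)
  have h3 := intervalIntegral.integral_mono_on (μ := volume) (a := 0) (b := 2 * π) (by positivity)
    (hc.intervalIntegrable _ _) (Continuous.intervalIntegrable (by fun_prop) _ _)
    (fun θ _ => h2 θ)
  rw [intervalIntegral.integral_add (Continuous.intervalIntegrable (by fun_prop) _ _)
      (Continuous.intervalIntegrable (by fun_prop) _ _),
    intervalIntegral.integral_add (Continuous.intervalIntegrable (by fun_prop) _ _)
      (Continuous.intervalIntegrable (by fun_prop) _ _),
    intervalIntegral.integral_add (Continuous.intervalIntegrable (by fun_prop) _ _)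
      (Continuous.intervalIntegrable (by fun_prop) _ _),
    intervalIntegral.integral_add (Continuous.intervalIntegrable (by fun_prop) _ _)
      (Continuous.intervalIntegrable (by fun_prop) _ _),
    intervalIntegral.integral_add (Continuous.intervalIntegrable (by fun_prop) _ _)
      (Continuous.intervalIntegrable (by fun_prop) _ _)] at h3
  simp only [intervalIntegral.integral_const_mul, intervalIntegral.integral_const, integral_cos,
    integral_sin, integral_cos_sq, integral_sin_sq, integral_sin_mul_cos₁] at h3
  simp at h3
  have h4 : 2 * π * ψ x ≤ ∫ θ in (0:ℝ)..2 * π, ψ (x + exp (θ * I) • (r:ℂ) • a) := by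
    rw [one_div, inv_mul_eq_div, le_div_iff₀ (by positivity)] at h1
    linarith
  simp only [Complex.coe_smul] at h4
  have h5 : 0 ≤ r ^ 2 * π / 2 * (4 * ε' * ‖a‖ ^ 2 + (F a a + F (I • a) (I • a))) := by
    linarith
  have h6 := nonneg_of_mul_nonneg_right h5 (by positivity)
  have h7 : 4 * ε' * ‖a‖ ^ 2 ≤ ε := by
    have : ε' * (4 * (‖a‖ ^ 2 + 1)) = ε := div_mul_cancel₀ _ (by positivity)
    have : 0 < ε' := by positivity
    nlinarith
  linarith

theorem exists_smooth_subMean {N : ℝ} (hN : 0 ≤ N) (hφ : ∀ x y, |φ x - φ y| ≤ N * ‖x - y‖) (hs : SubMean φ)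
    {s : ℝ} (hs0 : 0 < s) : ∃ ψ : (Fin n → ℂ) → ℝ, ContDiff ℝ ∞ ψ ∧
      (∀ x y, |ψ x - ψ y| ≤ N * ‖x - y‖) ∧ SubMean ψ ∧ ∀ x, |ψ x - φ x| ≤ N * s := by
  obtain ⟨ρ, hρ, hρ0, hρ1, hρi⟩ := exists_mollifier n
  have hcφ : Continuous φ := by
    refine (LipschitzWith.of_dist_le_mul (K := N.toNNReal) fun x y => ?_).continuous
    rw [Real.coe_toNNReal _ hN, Real.dist_eq, dist_eq_norm]
    exact hφ x y
  set k : (Fin n → ℂ) → ℝ := fun x => s⁻¹ ^ (2 * n) * ρ (s⁻¹ • x)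
  have hkd : dil (fun x => (ρ x : ℂ)) s = fun x => (k x : ℂ) := by
    ext x; simp [dil, k]
  have hk0 : ∀ x, 0 ≤ k x := fun x => mul_nonneg (by positivity) (hρ0 _)
  have hks : ∀ x, s ≤ ‖x‖ → k x = 0 := fun x hx => by
    have := dil_eq_zero (ρ := fun x => (ρ x : ℂ)) (fun x hx => by simp [hρ1 x hx]) hs0 hx
    simpa [hkd] using this
  have hdc := contDiff_dil (n := n) (contDiff_ofReal_comp hρ) s
  have hdk := hasCompactSupport_dil (ρ := fun x => (ρ x : ℂ)) (fun x hx => by simp [hρ1 x hx]) hs0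
  have hkc : Continuous k := by fun_prop (disch := exact hρ.continuous)
  have hkk : HasCompactSupport k := by
    rw [hkd] at hdk
    exact hdk.mono fun x hx h => hx (by simpa using h)
  have hki : ∫ x, k x = 1 := by
    have := integral_dil (fun x => (ρ x : ℂ)) hs0
    simp only [hkd] at this
    rw [integral_complex_ofReal, integral_complex_ofReal, hρi] at this
    exact_mod_cast this
  have hφk : ∀ x, Integrable fun y => φ (x - y) * k y := fun x =>
    ((hcφ.comp (by fun_prop)).mul hkc).integrable_of_hasCompactSupport hkk.mul_left
  set ψ : (Fin n → ℂ) → ℝ := fun x => ∫ y, φ (x - y) * k y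
  have hψe : ∀ x, mconv (fun y => (φ y : ℂ)) (dil (fun x => (ρ x : ℂ)) s) x = (ψ x : ℂ) := fun x => by
    rw [mconv, hkd]
    have : ∀ y, (φ y : ℂ) * (k (x - y) : ℂ) = ((φ y * k (x - y) : ℝ) : ℂ) := fun y => by push_cast; rfl
    simp only [this]
    rw [integral_complex_ofReal, ← integral_sub_left_eq_self _ volume x]
    simp only [sub_sub_cancel, ψ]
  have hdiff : ∀ x c, ψ x - c = ∫ y, (φ (x - y) - c) * k y := fun x c => by
    simp only [sub_mul]
    rw [integral_sub (hφk x) ((hkc.integrable_of_hasCompactSupport hkk).const_mul c),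
      integral_const_mul, hki, mul_one]
  refine ⟨ψ, ?_, fun x y => ?_, fun z v => ?_, fun x => ?_⟩
  · have h := contDiff_mconv (w := fun y => (φ y : ℂ))
      (continuous_ofReal.comp hcφ).locallyIntegrable hdc hdk
    have := reCLM.contDiff.comp h
    have e : ψ = reCLM ∘ mconv (fun y => (φ y : ℂ)) (dil (fun x => (ρ x : ℂ)) s) := by
      ext x; simp [hψe]
    rw [e]; exact this
  · have : ψ x - ψ y = ∫ t, (φ (x - t) - φ (y - t)) * k t := by
      simp only [sub_mul]
      rw [integral_sub (hφk x) (hφk y)]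
    rw [this, ← Real.norm_eq_abs]
    refine (norm_integral_le_of_norm_le (g := fun t => N * ‖x - y‖ * k t)
      ((hkc.integrable_of_hasCompactSupport hkk).const_mul _) (ae_of_all _ fun t => ?_)).trans ?_
    · rw [norm_mul, Real.norm_of_nonneg (hk0 t)]
      gcongr
      · exact hk0 t
      · simpa using hφ (x - t) (y - t)
    · rw [integral_const_mul, hki, mul_one]
  · have hP : Integrable (Function.uncurry fun (θ : ℝ) y => φ (z + exp (θ * I) • v - y) * k y)
        ((volume.restrict (Ioc 0 (2 * π))).prod volume) := by
      have hki' : Integrable (fun p : ℝ × (Fin n → ℂ) => (|φ z| + N * (‖v‖ + s)) * k p.2)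
          ((volume.restrict (Ioc 0 (2 * π))).prod volume) :=
        ((hkc.integrable_of_hasCompactSupport hkk).comp_snd _).const_mul _
      refine hki'.mono' ?_ (ae_of_all _ fun ⟨θ, y⟩ => ?_)
      · refine Continuous.aestronglyMeasurable ?_
        unfold Function.uncurry
        fun_prop
      · simp only [Function.uncurry_apply_pair]
        rw [norm_mul, Real.norm_of_nonneg (hk0 y)]
        by_cases ht : s ≤ ‖y‖
        · simp [hks y ht]
        refine mul_le_mul_of_nonneg_right ?_ (hk0 y)
        push Not at ht
        have h1 := hφ (z + exp (θ * I) • v - y) z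
        have h2 : ‖z + exp (θ * I) • v - y - z‖ ≤ ‖v‖ + s := by
          rw [add_sub_assoc, add_sub_cancel_left]
          refine (norm_sub_le _ _).trans ?_
          rw [norm_smul, norm_exp_ofReal_mul_I, one_mul]
          gcongr
        have h3 := mul_le_mul_of_nonneg_left h2 hN
        have h4 := abs_sub_abs_le_abs_sub (φ (z + exp (θ * I) • v - y)) (φ z)
        rw [Real.norm_eq_abs]
        linarith
    have hpi : (0:ℝ) ≤ 2 * π := by positivity
    have e : ∫ θ in (0:ℝ)..2 * π, ψ (z + exp (θ * I) • v) =
        ∫ y, (∫ θ in (0:ℝ)..2 * π, φ (z - y + exp (θ * I) • v)) * k y := by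
      simp only [ψ]
      rw [intervalIntegral.integral_of_le hpi, integral_integral_swap hP]
      refine integral_congr_ae (ae_of_all _ fun y => ?_)
      simp only
      rw [intervalIntegral.integral_of_le hpi, integral_mul_const]
      simp only [add_sub_right_comm]
    rw [e, ← integral_const_mul]
    refine integral_mono (hφk z) ?_ fun y => ?_
    · refine (hP.integral_prod_right.congr (ae_of_all _ fun y => ?_)).const_mul _
      simp only [Function.uncurry_apply_pair]
      rw [intervalIntegral.integral_of_le hpi, integral_mul_const]
      simp only [add_sub_right_comm]
    · simp only [← mul_assoc]
      exact mul_le_mul_of_nonneg_right (hs (z - y) v) (hk0 y)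
  · rw [hdiff, ← Real.norm_eq_abs]
    refine (norm_integral_le_of_norm_le (g := fun t => N * s * k t)
      ((hkc.integrable_of_hasCompactSupport hkk).const_mul _) (ae_of_all _ fun t => ?_)).trans ?_
    · rw [norm_mul, Real.norm_of_nonneg (hk0 t)]
      by_cases ht : s ≤ ‖t‖
      · simp [hks t ht]
      refine mul_le_mul_of_nonneg_right ((hφ _ _).trans ?_) (hk0 t)
      push Not at ht
      rw [sub_sub_cancel_left, norm_neg]
      exact mul_le_mul_of_nonneg_left ht.le hN
    · rw [integral_const_mul, hki, mul_one]

end submean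

section kernel
variable {n : ℕ}

theorem volume_real_closedBall (x : Fin n → ℂ) {r : ℝ} (hr : 0 ≤ r) :
    volume.real (closedBall x r) = r ^ (2 * n) * volume.real (ball (0 : Fin n → ℂ) 1) := by
  have hd : Module.finrank ℝ (Fin n → ℂ) = 2 * n := by
    rw [Module.finrank_pi_fintype]; simp [mul_comm]
  rw [Measure.real, Measure.addHaar_closedBall _ _ hr, hd, ENNReal.toReal_mul,
    ENNReal.toReal_ofReal (by positivity), Measure.real]

/-- Cauchy–Schwarz with weights, for a kernel supported in a ball. -/
theorem norm_integral_kernel_sq_le {g k : (Fin n → ℂ) → ℂ} {Φ : (Fin n → ℂ) → ℝ}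
    {x : Fin n → ℂ} {τ a Q m : ℝ} (hτ : 0 ≤ τ)
    (hΦ : Continuous Φ) (hk : Continuous k)
    (hg : Integrable fun y => ‖g y‖ ^ 2 * Real.exp (-Φ y))
    (ha : ∫ y, ‖g y‖ ^ 2 * Real.exp (-Φ y) ≤ a)
    (hkm : ∀ y, ‖k y‖ ≤ m) (hk0 : ∀ y, τ < ‖y - x‖ → k y = 0)
    (hQ : ∀ y, ‖y - x‖ ≤ τ → Real.exp (Φ y) ≤ Q) :
    ‖∫ y, g y * k y‖ ^ 2 ≤
      a * (m ^ 2 * Q * (τ ^ (2 * n) * volume.real (ball (0 : Fin n → ℂ) 1))) := by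
  set b := m ^ 2 * Q * (τ ^ (2 * n) * volume.real (ball (0 : Fin n → ℂ) 1)) with hb
  have hm : 0 ≤ m := (norm_nonneg _).trans (hkm 0)
  have hQ0 : 0 ≤ Q := (Real.exp_pos _).le.trans (hQ x (by simpa using hτ))
  have hb0 : 0 ≤ b := by positivity
  have ha0 : 0 ≤ a := (integral_nonneg fun y => by positivity).trans ha
  have hmem : ∀ y, y ∉ closedBall x τ → k y = 0 := fun y hy => hk0 y (by
    simpa [dist_eq_norm] using hy)
  have hkc : HasCompactSupport k := HasCompactSupport.intro (isCompact_closedBall x τ) hmem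
  have hki : Integrable fun y => ‖k y‖ ^ 2 * (Real.exp (-Φ y))⁻¹ := by
    refine Continuous.integrable_of_hasCompactSupport
      ((hk.norm.pow 2).mul (Continuous.inv₀ (by fun_prop) fun y => (Real.exp_pos _).ne'))
      (hkc.mono fun y hy h => hy (by simp [h]))
  have hkb : ∫ y, ‖k y‖ ^ 2 * (Real.exp (-Φ y))⁻¹ ≤ b := by
    refine (integral_le_setIntegral (S := closedBall x τ) (g := fun _ => m ^ 2 * Q)
      measurableSet_closedBall hki (integrableOn_const measure_closedBall_lt_top.ne)
      (fun y hy => by simp [hmem y hy]) fun y hy => ?_).trans (le_of_eq ?_)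
    · rw [← Real.exp_neg, neg_neg]
      exact mul_le_mul (pow_le_pow_left₀ (norm_nonneg _) (hkm y) 2)
        (hQ y (by simpa [dist_eq_norm] using hy)) (Real.exp_pos _).le (by positivity)
    · rw [setIntegral_const, volume_real_closedBall _ hτ, smul_eq_mul, hb]; ring
  set X := ‖∫ y, g y * k y‖
  have key : ∀ t : ℝ, 0 < t → X ≤ (t ^ 2 * a + b) / (2 * t) := fun t ht => by
    refine norm_integral_mul_le ht hg hki (a := t ^ 2 * a) ?_ hkb fun y => ?_
    · rwa [mul_div_cancel_left₀ _ (by positivity)]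
    · rw [norm_mul]; exact am_gm_weighted ht (Real.exp_pos _)
  have hdis : discrim a (-(2 * X)) b ≤ 0 := discrim_le_zero fun t => by
    rcases lt_or_ge 0 t with ht | ht
    · have := key t ht
      rw [le_div_iff₀ (by positivity)] at this
      linarith
    · have : 0 ≤ -t * X := mul_nonneg (by linarith) (norm_nonneg _)
      nlinarith [mul_nonneg ha0 (mul_self_nonneg t)]
  rw [discrim] at hdis
  nlinarith

theorem sq_norm_le_sqn (x : Fin n → ℂ) : ‖x‖ ^ 2 ≤ sqn x := by
  have h : ‖x‖ ≤ √(sqn x) := by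
    refine (pi_norm_le_iff_of_nonneg (Real.sqrt_nonneg _)).2 fun j => Real.le_sqrt_of_sq_le ?_
    exact Finset.single_le_sum (f := fun j => ‖x j‖ ^ 2) (fun j _ => by positivity)
      (Finset.mem_univ j)
  calc ‖x‖ ^ 2 ≤ √(sqn x) ^ 2 := by gcongr
    _ = sqn x := Real.sq_sqrt (sqn_nonneg x)

theorem sqn_le (x : Fin n → ℂ) : sqn x ≤ n * ‖x‖ ^ 2 := by
  refine (Finset.sum_le_card_nsmul _ _ (‖x‖ ^ 2) fun j _ => ?_).trans (by simp)
  gcongr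
  exact norm_le_pi_norm x j

/-- The weight with a logarithmic pole regularised at scale `τ`. -/
def poleWt (ψ : (Fin n → ℂ) → ℝ) (τ : ℝ) (x : Fin n → ℂ) : ℝ :=
  (ψ x + sqn x) + (n + 1) * Real.log (sqn x + τ ^ 2)

variable {ψ : (Fin n → ℂ) → ℝ} {τ : ℝ}

theorem contDiff_poleWt (hψ : ContDiff ℝ ∞ ψ) (hτ : 0 < τ) : ContDiff ℝ ∞ (poleWt ψ τ) :=
  (hψ.add contDiff_sqn).add (contDiff_const.mul (contDiff_log_sqn (by positivity)))

theorem le_levi_poleWt (hψ : ContDiff ℝ ∞ ψ) (hs : SubMean ψ) (hτ : 0 < τ) (x a : Fin n → ℂ) :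
    ∑ j, ‖a j‖ ^ 2 ≤ levi (poleWt ψ τ) x a := by
  have hl := contDiff_log_sqn (n := n) (τ := τ ^ 2) (by positivity)
  have h1 := levi_add (hψ.add contDiff_sqn) (contDiff_const (c := (n + 1 : ℝ)).mul hl) x a
  have h2 := levi_add hψ contDiff_sqn x a
  have h3 := levi_const_mul hl (n + 1) x a
  have h4 := mul_nonneg (by positivity : (0:ℝ) ≤ n + 1) (levi_log_sqn (τ := τ ^ 2) (by positivity) x a)
  have h5 := levi_nonneg_of_subMean hψ hs x a
  have h6 := levi_sqn x a
  unfold poleWt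
  linarith

theorem exp_poleWt (hτ : 0 < τ) (x : Fin n → ℂ) :
    Real.exp (poleWt ψ τ x) = Real.exp (ψ x + sqn x) * (sqn x + τ ^ 2) ^ (n + 1) := by
  have : 0 < sqn x + τ ^ 2 := by have := sqn_nonneg x; positivity
  rw [poleWt, Real.exp_add]
  congr 1
  rw [← Nat.cast_add_one, ← Real.log_pow, Real.exp_log (by positivity)]

theorem exp_neg_poleWt_le (hτ : 0 < τ) {x : Fin n → ℂ} {b t : ℝ} (hb : -b ≤ ψ x)
    (ht : 0 < t) (htx : t ≤ sqn x + τ ^ 2) :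
    Real.exp (-poleWt ψ τ x) ≤ Real.exp b * (t ^ (n + 1))⁻¹ := by
  rw [Real.exp_neg, exp_poleWt hτ, mul_inv, ← Real.exp_neg]
  have := sqn_nonneg x
  gcongr
  linarith

theorem exp_poleWt_le (hτ : 0 < τ) {x : Fin n → ℂ} {b s t : ℝ} (hb : ψ x ≤ b)
    (hs : sqn x ≤ s) (ht : sqn x + τ ^ 2 ≤ t) :
    Real.exp (poleWt ψ τ x) ≤ Real.exp (b + s) * t ^ (n + 1) := by
  rw [exp_poleWt hτ]
  have := sqn_nonneg x
  gcongr

end kernel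

section entire
variable {n : ℕ}

theorem wd_eq_zero_of_eventually {f : (Fin n → ℂ) → ℂ} {s : ℂ} {j : Fin n} {x : Fin n → ℂ} {c : ℂ}
    (h : ∀ᶠ y in 𝓝 x, f y = c) : wd s j f x = 0 := by
  have h' : f =ᶠ[𝓝 x] fun _ => c := h
  have e : fderiv ℝ f x = 0 := by rw [h'.fderiv_eq]; simp
  rw [wd, e]
  simp

/-- Cutoffs at scale `σ`. -/
theorem exists_cutoff_scaled (n : ℕ) : ∃ B : ℝ, 0 ≤ B ∧ ∀ σ : ℝ, 0 < σ →
    ∃ χ : (Fin n → ℂ) → ℂ, ContDiff ℝ ∞ χ ∧ HasCompactSupport χ ∧ (∀ x, ‖χ x‖ ≤ 1) ∧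
      (∀ x, ‖x‖ ≤ σ → χ x = 1) ∧ (∀ x, 2 * σ < ‖x‖ → χ x = 0) ∧
      (∀ j x, ‖x‖ < σ → wd I j χ x = 0) ∧ (∀ j x, 2 * σ < ‖x‖ → wd I j χ x = 0) ∧
      ∀ j x, ‖wd I j χ x‖ ≤ B * σ⁻¹ := by
  obtain ⟨η, hη, hη01, hη1, hη2, B, hB, hηB⟩ := exists_cutoff n
  refine ⟨B, hB, fun σ hσ => ?_⟩
  have hns : ∀ x : Fin n → ℂ, ‖σ⁻¹ • x‖ = ‖x‖ / σ := fun x => by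
    rw [norm_smul, Real.norm_of_nonneg (by positivity), inv_mul_eq_div]
  have h1 : ∀ x : Fin n → ℂ, ‖x‖ ≤ σ → ((η (σ⁻¹ • x) : ℝ) : ℂ) = 1 := fun x hx => by
    rw [hη1 _ (by rw [hns, div_le_one hσ]; exact hx)]; simp
  have h2 : ∀ x : Fin n → ℂ, 2 * σ < ‖x‖ → ((η (σ⁻¹ • x) : ℝ) : ℂ) = 0 := fun x hx => by
    rw [hη2 _ (by rw [hns, le_div_iff₀ hσ]; exact hx.le)]; simp
  have hs : ContDiff ℝ ∞ fun x : Fin n → ℂ => ((η x : ℝ) : ℂ) := contDiff_ofReal_comp hη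
  refine ⟨fun x => (η (σ⁻¹ • x) : ℝ), hs.comp (contDiff_const_smul _),
    HasCompactSupport.intro (isCompact_closedBall 0 (2 * σ)) fun x hx => h2 x (by simpa using hx),
    fun x => ?_, h1, h2, fun j x hx => ?_, fun j x hx => ?_, fun j x => ?_⟩
  · rw [norm_real, Real.norm_of_nonneg (hη01 _).1]; exact (hη01 _).2
  · refine wd_eq_zero_of_eventually (c := 1) ?_
    filter_upwards [(isOpen_lt continuous_norm continuous_const).mem_nhds hx] with y hy
    exact h1 y (le_of_lt hy)
  · refine wd_eq_zero_of_eventually (c := 0) ?_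
    filter_upwards [(isOpen_lt continuous_const continuous_norm).mem_nhds hx] with y hy
    exact h2 y hy
  · rw [wd_comp_smul hs, norm_mul, norm_real,
      Real.norm_of_nonneg (by positivity), mul_comm]
    gcongr
    exact hηB I j _ (by simp)

variable {ψ : (Fin n → ℂ) → ℝ}

theorem exists_kernel (n : ℕ) : ∃ M : ℝ, 0 ≤ M ∧ ∀ τ : ℝ, 0 < τ → ∃ k : (Fin n → ℂ) → ℂ,
    ContDiff ℝ ∞ k ∧ HasCompactSupport k ∧ (∀ x, τ ≤ ‖x‖ → k x = 0) ∧ ∫ x, k x = 1 ∧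
      ∀ x, ‖k x‖ ≤ M * τ⁻¹ ^ (2 * n) := by
  obtain ⟨ρ, hρ, hρ0, hρ1, hρi⟩ := exists_mollifier n
  have hs : ContDiff ℝ ∞ fun x : Fin n → ℂ => ((ρ x : ℝ) : ℂ) := contDiff_ofReal_comp hρ
  have h1 : ∀ x, 1 ≤ ‖x‖ → ((ρ x : ℝ) : ℂ) = 0 := fun x hx => by simp [hρ1 x hx]
  obtain ⟨M, hM, hMb⟩ := exists_norm_le_of_contDiff hs 1
  refine ⟨M, hM, fun τ hτ => ⟨_, contDiff_dil hs τ, hasCompactSupport_dil h1 hτ,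
    fun x hx => dil_eq_zero h1 hτ hx, ?_, fun x => ?_⟩⟩
  · rw [integral_dil _ hτ, integral_complex_ofReal, hρi]; simp
  · rw [dil, norm_mul, norm_real, Real.norm_of_nonneg (by positivity), mul_comm]
    gcongr
    rcases le_total ‖τ⁻¹ • x‖ 1 with h | h
    · exact hMb _ h
    · rw [h1 _ h]; simpa using hM

theorem integral_cutoff_le {σ τ : ℝ} {χ : (Fin n → ℂ) → ℂ} (hψ : ContDiff ℝ ∞ ψ) (hσ : 0 < σ)
    (hτ : 0 < τ) (hb : ∀ x, ‖x‖ ≤ 2 * σ → -2 ≤ ψ x) (hχ : ContDiff ℝ ∞ χ)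
    (hχc : HasCompactSupport χ) (hχ1 : ∀ x, ‖χ x‖ ≤ 1) (hχ0 : ∀ x, 2 * σ < ‖x‖ → χ x = 0) :
    ∫ x, ‖χ x‖ ^ 2 * Real.exp (-poleWt ψ τ x) ≤ Real.exp 2 * ((τ ^ 2) ^ (n + 1))⁻¹ *
      ((2 * σ) ^ (2 * n) * volume.real (ball (0 : Fin n → ℂ) 1)) := by
  have hΦ := (contDiff_poleWt hψ hτ).continuous
  refine (integral_le_setIntegral (S := closedBall 0 (2 * σ))
    (g := fun _ => Real.exp 2 * ((τ ^ 2) ^ (n + 1))⁻¹) measurableSet_closedBall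
    (Continuous.integrable_of_hasCompactSupport ((hχ.continuous.norm.pow 2).mul (by fun_prop))
      (hχc.mono fun y hy h => hy (by simp [h])))
    (integrableOn_const measure_closedBall_lt_top.ne)
    (fun x hx => by simp [hχ0 x (by simpa using hx)]) fun x hx => ?_).trans (le_of_eq ?_)
  · have h := exp_neg_poleWt_le (ψ := ψ) hτ (x := x) (b := 2) (t := τ ^ 2)
      (hb x (by simpa using hx)) (by positivity) (by linarith [sqn_nonneg x])
    refine (mul_le_of_le_one_left (Real.exp_pos _).le ?_).trans h
    exact pow_le_one₀ (norm_nonneg _) (hχ1 x)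
  · rw [setIntegral_const, volume_real_closedBall _ (by positivity), smul_eq_mul]; ring

theorem integral_wd_cutoff_le {σ τ B : ℝ} {χ : (Fin n → ℂ) → ℂ} (hψ : ContDiff ℝ ∞ ψ) (hσ : 0 < σ)
    (hτ : 0 < τ) (hb : ∀ x, ‖x‖ ≤ 2 * σ → -2 ≤ ψ x) (hχ : ContDiff ℝ ∞ χ)
    (hχ1 : ∀ j x, ‖x‖ < σ → wd I j χ x = 0)
    (hχ0 : ∀ j x, 2 * σ < ‖x‖ → wd I j χ x = 0) (hχB : ∀ j x, ‖wd I j χ x‖ ≤ B * σ⁻¹) :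
    ∫ x, (∑ j, ‖wd I j χ x‖ ^ 2) * Real.exp (-poleWt ψ τ x) ≤
      (n * B ^ 2 * Real.exp 2 * 4 ^ n * volume.real (ball (0 : Fin n → ℂ) 1)) * σ⁻¹ ^ 4 := by
  have hΦ := (contDiff_poleWt hψ hτ).continuous
  have hc : ∀ j, Continuous fun x => ‖wd I j χ x‖ ^ 2 := fun j =>
    (contDiff_wd hχ).continuous.norm.pow 2
  refine (integral_le_setIntegral (S := closedBall 0 (2 * σ))
    (g := fun _ => (n * (B * σ⁻¹) ^ 2) * (Real.exp 2 * ((σ ^ 2) ^ (n + 1))⁻¹))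
    measurableSet_closedBall
    (Continuous.integrable_of_hasCompactSupport
      ((continuous_finsetSum _ fun j _ => hc j).mul (by fun_prop))
      (HasCompactSupport.intro (isCompact_closedBall 0 (2 * σ)) fun x hx => ?_))
    (integrableOn_const measure_closedBall_lt_top.ne)
    (fun x hx => ?_) fun x hx => ?_).trans (le_of_eq ?_)
  · simp [fun j => hχ0 j x (by simpa using hx)]
  · simp [fun j => hχ0 j x (by simpa using hx)]
  · rcases lt_or_ge ‖x‖ σ with h | h
    · have h0 : ∑ j, ‖wd I j χ x‖ ^ 2 = 0 := Finset.sum_eq_zero fun j _ => by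
        rw [hχ1 j x h]; simp
      have h1 : (0:ℝ) ≤ n * (B * σ⁻¹) ^ 2 * (Real.exp 2 * ((σ ^ 2) ^ (n + 1))⁻¹) := by positivity
      simpa [h0] using h1
    · refine mul_le_mul ?_ (exp_neg_poleWt_le hτ (b := 2) (t := σ ^ 2) (hb x (by simpa using hx))
        (by positivity) ?_) (Real.exp_pos _).le (by positivity)
      · refine (Finset.sum_le_card_nsmul _ _ ((B * σ⁻¹) ^ 2) fun j _ => ?_).trans (by simp)
        exact pow_le_pow_left₀ (norm_nonneg _) (hχB j x) 2
      · have h1 := sq_norm_le_sqn x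
        have h2 := pow_le_pow_left₀ hσ.le h 2
        nlinarith [sq_nonneg τ]
  · rw [setIntegral_const, volume_real_closedBall _ (by positivity), smul_eq_mul, mul_pow 2 σ,
      pow_mul 2 2 n]
    have := hσ.ne'
    field_simp
    ring

theorem mul_kernel_bound_eq {σ τ c C M E N v : ℝ} (hσ : σ ≠ 0) (hτ0 : τ ≠ 0) (hτ : τ = c * σ ^ 2) :
    C * σ⁻¹ ^ 4 * ((M * τ⁻¹ ^ (2 * n)) ^ 2 * (E * (N * τ ^ 2) ^ (n + 1)) * (τ ^ (2 * n) * v)) =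
      C * (M ^ 2 * (E * N ^ (n + 1)) * v) * c ^ 2 := by
  have k1 : τ⁻¹ ^ (2 * n) * τ ^ (2 * n) = 1 := by rw [← mul_pow, inv_mul_cancel₀ hτ0, one_pow]
  have k2 : σ⁻¹ ^ 4 * τ ^ 2 = c ^ 2 := by rw [hτ]; field_simp
  rw [mul_pow N, ← pow_mul, mul_add_one 2 n, pow_add τ, ← k2]
  generalize τ⁻¹ ^ (2 * n) = a at k1 ⊢
  generalize τ ^ (2 * n) = b at k1 ⊢
  have : a * b * (a * b) = 1 := by rw [k1]; ring
  linear_combination (C * σ⁻¹ ^ 4 * M ^ 2 * E * N ^ (n + 1) * v * τ ^ 2) * this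

theorem mul_kernel_bound_eq' {σ τ E M P Q v : ℝ} (hτ0 : τ ≠ 0) :
    E * ((τ ^ 2) ^ (n + 1))⁻¹ * ((2 * σ) ^ (2 * n) * v) *
      ((M * τ⁻¹ ^ (2 * n)) ^ 2 * (P * Q) * (τ ^ (2 * n) * v)) =
      σ ^ (2 * n) * (E * (4 ^ n * v) * (M ^ 2 * Q * v) * (τ⁻¹ ^ (2 * n + 1)) ^ 2 * P) := by
  have k1 : τ⁻¹ ^ (2 * n) * τ ^ (2 * n) = 1 := by rw [← mul_pow, inv_mul_cancel₀ hτ0, one_pow]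
  rw [mul_pow 2 σ, pow_mul 2 2 n, ← pow_mul, mul_add_one 2 n, ← inv_pow, pow_add τ⁻¹, pow_succ τ⁻¹ (2 * n)]
  generalize τ⁻¹ ^ (2 * n) = a at k1 ⊢
  generalize τ ^ (2 * n) = b at k1 ⊢
  norm_num
  linear_combination (E * τ⁻¹ ^ 2 * 4 ^ n * σ ^ (2 * n) * v ^ 2 * M ^ 2 * a ^ 2 * P * Q) * k1

/-- Entire functions with prescribed growth which are not small at the origin. -/
theorem exists_entire_le_exp (n : ℕ) (R : ℝ) : ∃ C : ℝ, ∃ K : ℕ, 0 < C ∧ ∀ L : ℝ, 1 ≤ L →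
    ∀ ψ : (Fin n → ℂ) → ℝ, ContDiff ℝ ∞ ψ → SubMean ψ → ψ 0 = 0 →
      (∀ x y, |ψ x - ψ y| ≤ L * ‖x - y‖) →
      ∃ f : (Fin n → ℂ) → ℂ, Differentiable ℂ f ∧ 1 / 2 ≤ ‖f 0‖ ∧
        ∀ z, ‖z‖ ≤ R → ‖f z‖ ≤ C * L ^ K * Real.exp (ψ z / 2) := by
  obtain ⟨B, hB, hcut⟩ := exists_cutoff_scaled n
  obtain ⟨M, hM, hker⟩ := exists_kernel n
  set v := volume.real (ball (0 : Fin n → ℂ) 1) with hv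
  have hv0 : 0 ≤ v := measureReal_nonneg
  set C₁ := n * B ^ 2 * Real.exp 2 * 4 ^ n * v with hC₁
  set C₂ := C₁ * (M ^ 2 * (Real.exp (1 + n) * (n + 1) ^ (n + 1)) * v) with hC₂
  set c := 1 / (2 * (1 + C₂)) with hc
  have hC₁0 : 0 ≤ C₁ := by positivity
  have hC₂0 : 0 ≤ C₂ := by positivity
  have hc0 : 0 < c := by positivity
  have hc1 : c ≤ 1 := by rw [hc, div_le_one (by positivity)]; linarith
  have hcC : C₂ * c ^ 2 ≤ 1 / 4 := by
    rw [hc, div_pow, mul_pow, mul_div_assoc', div_le_div_iff₀ (by positivity) (by norm_num)]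
    nlinarith
  set Q := Real.exp (1 + n * (R + 1) ^ 2) * (n * (R + 1) ^ 2 + 1) ^ (n + 1) with hQ
  set C₃ := Real.exp 2 * (4 ^ n * v) * (M ^ 2 * Q * v) with hC₃
  refine ⟨√C₃ * c⁻¹ ^ (2 * n + 1) + 1, 2 * (2 * n + 1), by positivity, fun L hL ψ hψ hsub h0 hlip => ?_⟩
  set σ := L⁻¹ with hσ
  have hL0 : 0 < L := by linarith
  have hσ0 : 0 < σ := by positivity
  have hσ1 : σ ≤ 1 := inv_le_one_of_one_le₀ hL
  have hLσ : L * σ = 1 := mul_inv_cancel₀ hL0.ne'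
  set τ := c * σ ^ 2 with hτ
  have hτ0 : 0 < τ := by positivity
  have hτσ : τ ≤ σ := by
    rw [hτ]; nlinarith [mul_le_mul_of_nonneg_right hc1 (sq_nonneg σ)]
  obtain ⟨χ, hχ, hχc, hχ1, hχσ, hχ0, hwσ, hw0, hwB⟩ := hcut σ hσ0
  obtain ⟨k, hk, hkc, hk0, hki, hkM⟩ := hker τ hτ0
  have hψ0 : ∀ x, |ψ x| ≤ L * ‖x‖ := fun x => by simpa [h0] using hlip x 0
  have hb : ∀ x, ‖x‖ ≤ 2 * σ → -2 ≤ ψ x := fun x hx => by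
    have := (abs_le.1 (hψ0 x)).1
    have h2 : L * ‖x‖ ≤ L * (2 * σ) := mul_le_mul_of_nonneg_left hx hL0.le
    linarith
  have hΦ := contDiff_poleWt hψ hτ0
  obtain ⟨w, hwl, hwh, hwi, hw, hwχi, hwχ⟩ := exists_weakly_holomorphic hΦ
    (le_levi_poleWt hψ hsub hτ0) hχ hχc
  have hksub : ∀ z y, τ < ‖y - z‖ → k (z - y) = 0 := fun z y h => hk0 _ (by
    rw [norm_sub_rev]; exact h.le)
  have hkz : ∀ z : Fin n → ℂ, Continuous fun y => k (z - y) := fun z =>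
    hk.continuous.comp (by fun_prop)
  refine ⟨mconv w k, differentiable_mconv hwl hwh hk hkc, ?_, fun z hz => ?_⟩
  · have e : 1 - mconv w k 0 = ∫ y, (χ y - w y) * k (0 - y) := by
      simp only [sub_mul]
      rw [integral_sub (integrable_mul_sub hχ.continuous.locallyIntegrable hk.continuous hkc 0)
        (integrable_mul_sub hwl hk.continuous hkc 0), mconv]
      congr 1
      rw [← hki, ← integral_sub_left_eq_self _ volume 0]
      refine integral_congr_ae (ae_of_all _ fun y => ?_)
      simp only
      rcases le_or_gt ‖y‖ τ with h | h
      · rw [hχσ y (h.trans hτσ), one_mul]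
      · rw [hksub 0 y (by simpa using h), mul_zero]
    have h1 := norm_integral_kernel_sq_le (x := 0) hτ0.le hΦ.continuous (hkz 0) hwχi
      (hwχ.trans (integral_wd_cutoff_le hψ hσ0 hτ0 hb hχ hwσ hw0 hwB))
      (fun y => hkM _) (hksub 0) (Q := Real.exp (1 + n) * ((n + 1) * τ ^ 2) ^ (n + 1)) fun y hy => by
        rw [sub_zero] at hy
        have h2 := sqn_le y
        have h3 : ‖y‖ ^ 2 ≤ τ ^ 2 := pow_le_pow_left₀ (norm_nonneg _) hy 2
        have h4 : (n:ℝ) * ‖y‖ ^ 2 ≤ n * τ ^ 2 := by gcongr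
        have h5 : τ ^ 2 ≤ 1 := pow_le_one₀ hτ0.le (hτσ.trans hσ1)
        have h6 : (n:ℝ) * τ ^ 2 ≤ n * 1 := by gcongr
        refine exp_poleWt_le hτ0 ?_ (by linarith) (by linarith)
        have := (abs_le.1 (hψ0 y)).2
        exact this.trans ((mul_le_mul_of_nonneg_left (hy.trans hτσ) hL0.le).trans_eq hLσ)
    rw [← e] at h1
    have h2 : ‖1 - mconv w k 0‖ ^ 2 ≤ (1 / 2) ^ 2 := by
      refine h1.trans (le_trans (le_of_eq ?_) (hcC.trans (by norm_num)))
      exact mul_kernel_bound_eq hσ0.ne' hτ0.ne' hτ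
    have h3 := (pow_le_pow_iff_left₀ (norm_nonneg _) (by norm_num) (by norm_num)).1 h2
    have h4 := norm_sub_norm_le (1 : ℂ) (mconv w k 0)
    rw [norm_one] at h4
    linarith
  · have h1 := norm_integral_kernel_sq_le (x := z) hτ0.le hΦ.continuous (hkz z) hwi
      (hw.trans (integral_cutoff_le hψ hσ0 hτ0 hb hχ hχc hχ1 hχ0))
      (fun y => hkM _) (hksub z) (Q := Real.exp (ψ z) * Q) fun y hy => by
        have hyR : ‖y‖ ≤ R + 1 := by
          have := norm_le_norm_add_norm_sub' y z
          linarith [hτσ.trans hσ1]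
        have h2 := sqn_le y
        have h3 : ‖y‖ ^ 2 ≤ (R + 1) ^ 2 := pow_le_pow_left₀ (norm_nonneg _) hyR 2
        have h4 : (n:ℝ) * ‖y‖ ^ 2 ≤ n * (R + 1) ^ 2 := by gcongr
        have h5 : τ ^ 2 ≤ 1 := pow_le_one₀ hτ0.le (hτσ.trans hσ1)
        have h6 : ψ y ≤ ψ z + 1 := by
          have := (abs_le.1 (hlip y z)).2
          have h7 := (mul_le_mul_of_nonneg_left (hy.trans hτσ) hL0.le).trans_eq hLσ
          exact sub_le_iff_le_add'.1 (this.trans h7)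
        refine (exp_poleWt_le hτ0 h6 (h2.trans h4) (add_le_add (h2.trans h4) h5)).trans (le_of_eq ?_)
        rw [hQ, ← mul_assoc, ← Real.exp_add]
        ring_nf
    have hσn : σ ^ (2 * n) ≤ 1 := pow_le_one₀ hσ0.le hσ1
    have h2 : ‖mconv w k z‖ ^ 2 ≤ (√C₃ * c⁻¹ ^ (2 * n + 1) * L ^ (2 * (2 * n + 1)) *
        Real.exp (ψ z / 2)) ^ 2 := by
      have e1 : Real.exp (ψ z / 2) ^ 2 = Real.exp (ψ z) := by
        rw [← Real.exp_nat_mul]; ring_nf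
      have e2 : c⁻¹ ^ (2 * n + 1) * L ^ (2 * (2 * n + 1)) = τ⁻¹ ^ (2 * n + 1) := by
        rw [hτ, hσ, mul_inv, mul_pow, pow_mul]; simp
      rw [mul_assoc √C₃, e2, mul_pow, mul_pow, e1, Real.sq_sqrt (by positivity)]
      refine h1.trans (le_trans (le_of_eq (b := σ ^ (2 * n) *
        (C₃ * (τ⁻¹ ^ (2 * n + 1)) ^ 2 * Real.exp (ψ z))) ?_)
        (mul_le_of_le_one_left (by positivity) hσn))
      exact mul_kernel_bound_eq' hτ0.ne'
    have h3 := (pow_le_pow_iff_left₀ (norm_nonneg _) (by positivity) (by norm_num)).1 h2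
    refine h3.trans ?_
    gcongr
    linarith

end entire

section entire
variable {n : ℕ}

theorem SubMean.const_mul_sub {φ : (Fin n → ℂ) → ℝ} (hc : Continuous φ) (hs : SubMean φ) {t : ℝ}
    (ht : 0 ≤ t) (b : ℝ) : SubMean fun y => t * (φ y - b) := fun z v => by
  have h := hs z v
  have hi : IntervalIntegrable (fun θ : ℝ => φ (z + exp (θ * I) • v)) volume 0 (2 * π) :=
    (hc.comp (by fun_prop)).intervalIntegrable _ _
  rw [intervalIntegral.integral_const_mul, intervalIntegral.integral_sub hi (by simp)]
  have e : (1 / (2 * π)) * (t * ((∫ θ in (0:ℝ)..2 * π, φ (z + exp (θ * I) • v)) -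
      ∫ θ in (0:ℝ)..2 * π, b)) =
      t * (1 / (2 * π) * (∫ θ in (0:ℝ)..2 * π, φ (z + exp (θ * I) • v)) - b) := by
    rw [intervalIntegral.integral_const, smul_eq_mul, sub_zero]
    generalize (∫ θ in (0:ℝ)..2 * π, φ (z + exp (θ * I) • v)) = J
    field_simp
  rw [e]
  exact mul_le_mul_of_nonneg_left (by linarith) ht

theorem exists_entire_of_lipschitz_subMean {φ : (Fin n → ℂ) → ℝ} {N C₀ κ : ℝ}
    {S : Set (Fin n → ℂ)} (hN : 0 ≤ N) (hφ : ∀ x y, |φ x - φ y| ≤ N * ‖x - y‖) (hs : SubMean φ)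
    (h0 : -C₀ ≤ φ 0) (h1 : ∀ y, ‖y‖ ≤ 1 → φ y ≤ 0) (hS : ∀ y ∈ S, ‖y‖ ≤ 1 ∧ φ y ≤ -κ) :
    ∀ᶠ m : ℕ in atTop, ∃ f : (Fin n → ℂ) → ℂ, Differentiable ℂ f ∧ (∀ y, ‖y‖ ≤ 1 → ‖f y‖ ≤ 1) ∧
      Real.exp (-((C₀ + 1) * m)) ≤ ‖f 0‖ ∧ ∀ y ∈ S, ‖f y‖ ≤ Real.exp (-(κ * m)) := by
  obtain ⟨C, K, hC, hf⟩ := exists_entire_le_exp n 1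
  have hev := tendsto_natCast_atTop_atTop.eventually
    (eventually_mul_pow_le_exp (2 * C * Real.exp 1 * (2 * N + 1) ^ K) K)
  filter_upwards [hev, eventually_ge_atTop 1] with m hm hm1
  have hm1' : (1:ℝ) ≤ m := by exact_mod_cast hm1
  set L : ℝ := 2 * m * N + 1 with hL
  have hL0 : 0 < L := by positivity
  have hL1 : 1 ≤ L := by rw [hL]; linarith [mul_nonneg (by positivity : (0:ℝ) ≤ 2 * m) hN]
  obtain ⟨φ', hs', hlip', hsub', hd⟩ := exists_smooth_subMean hN hφ hs (s := L⁻¹) (by positivity)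
  have hNs : 2 * m * N * L⁻¹ ≤ 1 := by
    rw [← div_eq_mul_inv, div_le_one hL0]; linarith
  obtain ⟨f, hfd, hf0, hfb⟩ := hf L hL1 (fun y => 2 * m * (φ' y - φ' 0))
    (contDiff_const.mul (hs'.sub contDiff_const))
    (hsub'.const_mul_sub hs'.continuous (by positivity) _) (by simp) fun x y => by
      rw [← mul_sub, abs_mul, abs_of_nonneg (by positivity), sub_sub_sub_cancel_right]
      calc 2 * m * |φ' x - φ' y| ≤ 2 * m * (N * ‖x - y‖) := by gcongr; exact hlip' x y
        _ = 2 * m * N * ‖x - y‖ := by ring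
        _ ≤ L * ‖x - y‖ := by gcongr; linarith
  set A := C * L ^ K * Real.exp (m * C₀ + 1) with hA
  have hA0 : 0 < A := by positivity
  have hfz : ∀ z, ‖z‖ ≤ 1 → ‖f z / A‖ ≤ Real.exp (m * φ z) := fun z hz => by
    rw [norm_div, norm_real, Real.norm_of_nonneg hA0.le, div_le_iff₀ hA0]
    refine (hfb z hz).trans ?_
    have e : Real.exp (m * φ z) * A = C * L ^ K * Real.exp (m * φ z + (m * C₀ + 1)) := by
      rw [hA, Real.exp_add (m * φ z)]; ring
    rw [e]
    gcongr
    have h2 := (abs_le.1 (hd z)).2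
    have h3 := (abs_le.1 (hd 0)).1
    have h4 : φ' z - φ' 0 ≤ φ z + C₀ + 2 * (N * L⁻¹) := by linarith
    have h5 := mul_le_mul_of_nonneg_left h4 (by positivity : (0:ℝ) ≤ m)
    linarith
  refine ⟨fun z => f z / A, by simpa only [div_eq_mul_inv] using hfd.mul_const ((A : ℂ)⁻¹),
    fun z hz => (hfz z hz).trans ?_, ?_, fun z hz => ?_⟩
  · rw [Real.exp_le_one_iff]
    exact mul_nonpos_of_nonneg_of_nonpos (by positivity) (h1 z hz)
  · rw [norm_div, norm_real, Real.norm_of_nonneg hA0.le, le_div_iff₀ hA0]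
    refine le_trans ?_ hf0
    have h2 : L ^ K ≤ (2 * N + 1) ^ K * m ^ K := by
      rw [← mul_pow]
      gcongr
      rw [hL]; linarith
    have h3 : Real.exp 1 * (2 * C * L ^ K) ≤ Real.exp m := by
      refine le_trans ?_ hm
      calc Real.exp 1 * (2 * C * L ^ K) ≤ Real.exp 1 * (2 * C * ((2 * N + 1) ^ K * m ^ K)) := by
            gcongr
        _ = _ := by ring
    have h4 : Real.exp (-((C₀ + 1) * m)) * A * 2 =
        Real.exp (-m) * (Real.exp 1 * (2 * C * L ^ K)) := by
      have : Real.exp (-((C₀ + 1) * m)) * Real.exp (m * C₀ + 1) = Real.exp (-m) * Real.exp 1 := by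
        rw [← Real.exp_add, ← Real.exp_add]; ring_nf
      rw [hA]
      linear_combination (2 * C * L ^ K) * this
    have h5 : Real.exp (-m) * Real.exp m = 1 := by rw [← Real.exp_add]; simp
    have h6 := mul_le_mul_of_nonneg_left h3 (Real.exp_pos (-m)).le
    linarith
  · refine (hfz z (hS z hz).1).trans ?_
    gcongr
    have := mul_le_mul_of_nonneg_left (hS z hz).2 (by positivity : (0:ℝ) ≤ m)
    linarith

end entire

end

/-- The sub-mean value inequality over the unit circle, tested against continuous majorants. -/
def DiscMean (h : ℂ → EReal) : Prop :=
  ∀ g : ℂ → ℝ, Continuous g → (∀ ζ, ‖ζ‖ = 1 → h ζ ≤ g ζ) → h 0 ≤ (Real.circleAverage g 0 1 : ℝ)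

theorem mean_eq_circleAverage (g : ℂ → ℝ) :
    1 / (2 * π) * ∫ θ in (0:ℝ)..2 * π, g (exp (θ * I)) = Real.circleAverage g 0 1 := by
  simp [Real.circleAverage_def, circleMap]

theorem EReal.le_of_forall_pos_le_add_coe {x : EReal} {a : ℝ}
    (h : ∀ δ : ℝ, 0 < δ → x ≤ ((a + δ : ℝ) : EReal)) : x ≤ (a : EReal) := by
  induction x with
  | bot => exact bot_le
  | top => exact absurd (top_le_iff.1 (h 1 one_pos)) (EReal.coe_ne_top _)
  | coe x =>
    have : x ≤ a := le_of_forall_pos_le_add fun δ hδ => by exact_mod_cast h δ hδ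
    exact_mod_cast this

theorem normSq_add_on_circle (ζ η : ℂ) (r : ℝ) (hη : ‖η‖ = 1) :
    ‖ζ + r * η‖ ^ 2 = ‖ζ‖ ^ 2 + r ^ 2 + 2 * ((starRingEnd ℂ) ζ * r * η).re := by
  have h1 : η.re ^ 2 + η.im ^ 2 = 1 := by
    have := Complex.sq_norm η
    rw [hη, normSq_apply] at this; linarith
  rw [Complex.sq_norm, Complex.sq_norm, normSq_apply, normSq_apply]
  simp
  linear_combination r ^ 2 * h1

/-- Local sub-mean value inequalities on the closed unit disc imply the global one. -/
theorem discMean_of_local {h : ℂ → EReal} (husc : UpperSemicontinuousOn h (closedBall 0 1))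
    (htop : ∀ ζ, h ζ < ⊤)
    (hloc : ∀ ζ : ℂ, ‖ζ‖ < 1 → ∀ᶠ r : ℝ in 𝓝[>] 0, ∀ g : ℂ → ℝ, Continuous g →
      (∀ η : ℂ, ‖η‖ = 1 → h (ζ + r * η) ≤ g η) → h ζ ≤ (Real.circleAverage g 0 1 : ℝ)) :
    DiscMean h := by
  intro g hg hgh
  refine EReal.le_of_forall_pos_le_add_coe fun δ hδ => ?_
  set ε := δ / 3 with hε
  have hε0 : 0 < ε := by positivity
  obtain ⟨p, hp⟩ := exists_polynomial_re_near g hg.continuousOn hε0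
  have hp0 : (p.eval 0).re ≤ Real.circleAverage g 0 1 + ε := by
    rw [← circleAverage_re_polynomial]
    exact circleAverage_near (by fun_prop) hg fun ζ hζ => by
      linarith [(abs_le.1 (hp ζ hζ)).2]
  set F : ℂ → EReal := fun ζ => h ζ + ((ε * ‖ζ‖ ^ 2 - (p.eval ζ).re : ℝ) : EReal) with hF
  have hFu : UpperSemicontinuousOn F (closedBall 0 1) := by
    refine UpperSemicontinuousOn.add' husc (g := fun ζ => ((ε * ‖ζ‖ ^ 2 - (p.eval ζ).re : ℝ) : EReal))
      ?_ fun x _ => ?_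
    · have hc : Continuous fun ζ : ℂ => ε * ‖ζ‖ ^ 2 - (p.eval ζ).re := by fun_prop
      exact (continuous_coe_real_ereal.comp hc).upperSemicontinuous.upperSemicontinuousOn _
    exact EReal.continuousAt_add (Or.inr (EReal.coe_ne_bot _)) (Or.inr (EReal.coe_ne_top _))
  obtain ⟨ζ, hζ, hmax⟩ := hFu.exists_isMaxOn ⟨0, by simp⟩ (isCompact_closedBall (0:ℂ) 1)
  have hζ' : ‖ζ‖ ≤ 1 := by simpa using hζ
  have h0 : F 0 ≤ F ζ := hmax (by simp)
  suffices hb : F ζ ≤ ((2 * ε : ℝ) : EReal) by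
    have h1 : h 0 + ((-(p.eval 0).re : ℝ) : EReal) ≤ ((2 * ε : ℝ) : EReal) := by
      refine le_trans ?_ (h0.trans hb); simp [hF]
    generalize h 0 = x at h1 ⊢
    induction x with
    | bot => exact bot_le
    | top => rw [EReal.top_add_coe] at h1; exact absurd (top_le_iff.1 h1) (EReal.coe_ne_top _)
    | coe x =>
      norm_cast at h1 ⊢
      linarith
  rcases hζ'.lt_or_eq with hlt | heq
  · rcases eq_or_ne (h ζ) ⊥ with hbot | hbot
    · simp only [hF, hbot, EReal.bot_add, bot_le]
    exfalso
    obtain ⟨m, hm⟩ : ∃ m : ℝ, h ζ = m := ⟨_, (EReal.coe_toReal (htop ζ).ne hbot).symm⟩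
    have hsmall : ∀ᶠ r : ℝ in 𝓝[>] 0, r < 1 - ‖ζ‖ :=
      (eventually_lt_nhds (by linarith)).filter_mono nhdsWithin_le_nhds
    obtain ⟨r, ⟨hr, hr1⟩, hr0⟩ := (((hloc ζ hlt).and hsmall).and self_mem_nhdsWithin).exists
    have hr0' : 0 < r := hr0
    set M := m + ε * ‖ζ‖ ^ 2 - (p.eval ζ).re with hM
    have hall : ∀ x : ℂ, ‖x‖ ≤ 1 → h x ≤ ((M + (p.eval x).re - ε * ‖x‖ ^ 2 : ℝ) : EReal) := by
      intro x hx
      have h1 : F x ≤ F ζ := hmax (by simpa using hx)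
      simp only [hF, hm] at h1
      generalize h x = y at h1 ⊢
      induction y with
      | bot => exact bot_le
      | top => rw [EReal.top_add_coe, ← EReal.coe_add] at h1; exact absurd (top_le_iff.1 h1) (EReal.coe_ne_top _)
      | coe x =>
        norm_cast at h1 ⊢
        linarith
    set q : Polynomial ℂ := Polynomial.C ((M - ε * ‖ζ‖ ^ 2 - ε * r ^ 2 : ℝ) : ℂ) +
      p.comp (Polynomial.C ζ + Polynomial.C (r:ℂ) * Polynomial.X) -
      Polynomial.C ((2 * ε : ℝ) * ((starRingEnd ℂ) ζ * r)) * Polynomial.X with hq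
    have h2 := hr (fun η => (q.eval η).re) (by fun_prop) (fun η hη => by
      have hn : ‖ζ + r * η‖ ≤ 1 := by
        refine (norm_add_le _ _).trans ?_
        rw [norm_mul, hη, norm_real, Real.norm_of_nonneg hr0'.le]; linarith
      refine (hall _ hn).trans (le_of_eq ?_)
      congr 1
      rw [normSq_add_on_circle ζ η r hη]
      have e1 : (q.eval η) = ((M - ε * ‖ζ‖ ^ 2 - ε * r ^ 2 : ℝ) : ℂ) + p.eval (ζ + r * η) -
        ((2 * ε : ℝ) : ℂ) * ((starRingEnd ℂ) ζ * r * η) := by simp [hq]; ring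
      rw [e1, sub_re, add_re, re_ofReal_mul, ofReal_re]
      ring)
    rw [circleAverage_re_polynomial, hm] at h2
    have e2 : (q.eval 0).re = m - ε * r ^ 2 := by
      have : q.eval 0 = ((M - ε * ‖ζ‖ ^ 2 - ε * r ^ 2 : ℝ) : ℂ) + p.eval ζ := by simp [hq]
      rw [this, add_re, ofReal_re, hM]; ring
    rw [e2] at h2
    have h3 : m ≤ m - ε * r ^ 2 := by exact_mod_cast h2
    have : 0 < ε * r ^ 2 := by positivity
    linarith
  · have h1 : F ζ ≤ ((g ζ : ℝ) : EReal) + ((ε * ‖ζ‖ ^ 2 - (p.eval ζ).re : ℝ) : EReal) := by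
      exact add_le_add (hgh ζ heq) le_rfl
    refine h1.trans ?_
    norm_cast
    rw [heq]
    linarith [(abs_le.1 (hp ζ heq)).1]

/-- A function bounded on the circle and equal to `-∞` on an arc is `-∞` at the centre. -/
theorem DiscMean.eq_bot {h : ℂ → EReal} (hh : DiscMean h) {M : ℝ}
    (hM : ∀ ζ, ‖ζ‖ = 1 → h ζ ≤ M) {δ : ℝ} (hδ : 0 < δ)
    (hb : ∀ ζ, ‖ζ‖ = 1 → ‖ζ - 1‖ < δ → h ζ = ⊥) : h 0 = ⊥ := by
  set b : ℂ → ℝ := fun ζ => max 0 (δ - ‖ζ - 1‖) with hbd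
  have hbc : Continuous b := by fun_prop
  have hpos : 0 < Real.circleAverage b 0 1 := by
    rw [← mean_eq_circleAverage]
    refine mul_pos (by positivity) ?_
    refine intervalIntegral.integral_pos Real.two_pi_pos (by fun_prop) (fun _ _ => le_max_left _ _)
      ⟨0, ⟨le_rfl, Real.two_pi_pos.le⟩, ?_⟩
    simp [hbd, hδ]
  have key : ∀ N : ℕ, h 0 ≤ ((M - N * Real.circleAverage b 0 1 : ℝ) : EReal) := by
    intro N
    have := hh (fun ζ => M - N * b ζ) (by fun_prop) (fun ζ hζ => by
      by_cases h1 : ‖ζ - 1‖ < δ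
      · rw [hb ζ hζ h1]; exact bot_le
      · refine (hM ζ hζ).trans (le_of_eq ?_)
        have : b ζ = 0 := max_eq_left (by linarith)
        rw [this]; simp)
    refine this.trans (le_of_eq ?_)
    congr 1
    rw [Real.circleAverage_fun_sub (circleIntegrable_of_continuous continuous_const _ _)
      (circleIntegrable_of_continuous (by fun_prop) _ _), Real.circleAverage_const]
    have := Real.circleAverage_fun_smul (a := (N:ℝ)) (f := b) (c := 0) (R := 1)
    simp only [smul_eq_mul] at this
    rw [this]
  by_contra hne
  have htop : h 0 ≠ ⊤ := fun e => by simpa [e] using key 0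
  obtain ⟨m, hm⟩ : ∃ m : ℝ, h 0 = m := ⟨_, (EReal.coe_toReal htop hne).symm⟩
  obtain ⟨N, hN⟩ := exists_nat_gt ((M - m) / Real.circleAverage b 0 1)
  have h1 := key N
  rw [hm] at h1
  have h2 : m ≤ M - N * Real.circleAverage b 0 1 := by exact_mod_cast h1
  rw [div_lt_iff₀ hpos] at hN
  linarith

theorem PSHe.discMean {u : V → EReal} {U : Set V} (hu : PSHe u U) {z w : V}
    (hdisc : ∀ ζ : ℂ, ‖ζ‖ ≤ 1 → z + ζ • w ∈ U) : DiscMean fun ζ => u (z + ζ • w) := by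
  refine discMean_of_local ?_ (fun ζ => hu.2.1 _) fun ζ hζ => ?_
  · have hc : Continuous fun ζ : ℂ => z + ζ • w := by fun_prop
    exact hu.1.comp hc.continuousOn fun ζ hζ => hdisc ζ (by simpa using hζ)
  · filter_upwards [hu.2.2 _ (hdisc ζ hζ.le) w] with r hr g hg hgh
    have := hr (fun θ => g (exp (θ * I))) (by fun_prop) (fun θ => by
      have h1 := hgh (exp (θ * I)) (norm_exp_ofReal_mul_I θ)
      rwa [add_smul, ← add_assoc] at h1)
    rwa [mean_eq_circleAverage] at this

/-- On an open set a plurisubharmonic function which is `-∞` near one point of a connected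
component is `-∞` on that component. -/
theorem PSHe.eq_bot_on_component {u : V → EReal} {U : Set V} (hu : PSHe u U) (hU : IsOpen U)
    {a : V} (ha : a ∈ U) (hb : ∀ᶠ x in 𝓝 a, u x = ⊥) :
    ∀ x ∈ connectedComponentIn U a, u x = ⊥ := by
  have hB : IsOpen {z | ∀ᶠ x in 𝓝 z, u x = ⊥} := isOpen_setOfPred_eventually_nhds
  have hsub : connectedComponentIn U a ⊆ {z | ∀ᶠ x in 𝓝 z, u x = ⊥} := by
    refine isPreconnected_connectedComponentIn.subset_of_closure_inter_subset hB
      ⟨a, mem_connectedComponentIn ha, hb⟩ ?_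
    rintro z ⟨hz, hzC⟩
    have hzU : z ∈ U := connectedComponentIn_subset _ _ hzC
    obtain ⟨M, hM⟩ : ∃ M : ℝ, u z < M := EReal.lt_iff_exists_real_btwn.1 (hu.2.1 z) |>.imp
      fun _ h => h.1
    have hev : ∀ᶠ x in 𝓝 z, x ∈ U ∧ u x < M := by
      filter_upwards [hU.mem_nhds hzU, (hU.nhdsWithin_eq hzU ▸ hu.1 z hzU M hM)] with x h1 h2
        using ⟨h1, h2⟩
    obtain ⟨r, hr, hball⟩ := Metric.eventually_nhds_iff_ball.1 hev
    obtain ⟨b, hbB, hbz⟩ := Metric.mem_closure_iff.1 hz (r / 4) (by positivity)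
    rw [dist_comm, dist_eq_norm] at hbz
    obtain ⟨s, hs, hbs⟩ := Metric.eventually_nhds_iff_ball.1 hbB
    refine Metric.eventually_nhds_iff_ball.2 ⟨r / 4, by positivity, fun x hx => ?_⟩
    have hx' : ‖x - z‖ < r / 4 := by simpa [dist_eq_norm] using hx
    have hbx : ‖b - x‖ < r / 2 := by
      have := norm_sub_le_norm_sub_add_norm_sub b z x
      rw [norm_sub_rev z x] at this; linarith
    have hin : ∀ ζ : ℂ, ‖ζ‖ ≤ 1 → x + ζ • (b - x) ∈ ball z r := by
      intro ζ hζ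
      have h1 : ‖x + ζ • (b - x) - z‖ ≤ ‖x - z‖ + ‖b - x‖ := by
        calc _ = ‖(x - z) + ζ • (b - x)‖ := by congr 1; abel
          _ ≤ ‖x - z‖ + ‖ζ • (b - x)‖ := norm_add_le _ _
          _ ≤ _ := by
            rw [norm_smul]
            have := mul_le_mul_of_nonneg_right hζ (norm_nonneg (b - x))
            linarith
      rw [mem_ball, dist_eq_norm]; linarith
    have hD := hu.discMean (z := x) (w := b - x) fun ζ hζ => (hball _ (hin ζ hζ)).1
    have hδ : 0 < s / (‖b - x‖ + 1) := by positivity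
    have := hD.eq_bot (M := M) (fun ζ hζ => (hball _ (hin ζ hζ.le)).2.le) hδ (fun ζ hζ h1 => by
      refine hbs _ ?_
      rw [mem_ball, dist_eq_norm]
      have e : x + ζ • (b - x) - b = (ζ - 1) • (b - x) := by
        rw [sub_smul, one_smul]; abel
      rw [e, norm_smul]
      rw [lt_div_iff₀ (by positivity)] at h1
      nlinarith [norm_nonneg (ζ - 1)])
    simpa using this
  exact fun x hx => (hsub hx).self_of_nhds

theorem PSHe.exists_ne_bot_near {u : V → EReal} {U : Set V} (hu : PSHe u U) (hU : IsOpen U)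
    (hne : ∀ z ∈ U, ∃ w ∈ connectedComponentIn U z, u w ≠ ⊥) {a : V} (ha : a ∈ U) {ε : ℝ}
    (hε : 0 < ε) : ∃ c, ‖c - a‖ < ε ∧ u c ≠ ⊥ := by
  by_contra hcon
  push Not at hcon
  obtain ⟨w, hw, hwb⟩ := hne a ha
  refine hwb (hu.eq_bot_on_component hU ha (Metric.eventually_nhds_iff_ball.2 ⟨ε, hε, ?_⟩) w hw)
  exact fun x hx => hcon x (by simpa [dist_eq_norm] using hx)

theorem affine_norm_le_circleAverage {E : Type*} [NormedAddCommGroup E] [NormedSpace ℂ E]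
    {A B : ℝ} (hA : 0 ≤ A) (z w : E) {g : ℂ → ℝ} (hg : Continuous g)
    (h : ∀ η : ℂ, ‖η‖ = 1 → A * (‖z + η • w‖ - B) ≤ g η) :
    A * (‖z‖ - B) ≤ Real.circleAverage g 0 1 := by
  obtain ⟨f, hf, hfz⟩ := exists_dual_vector'' ℂ z
  set q : Polynomial ℂ := Polynomial.C ((A:ℂ) * (f z - B)) +
    Polynomial.C ((A:ℂ) * f w) * Polynomial.X with hq
  have h1 : ∀ η : ℂ, (q.eval η).re = A * ((f (z + η • w)).re - B) := by
    intro η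
    have : q.eval η = (A:ℂ) * (f (z + η • w) - B) := by simp [hq]; ring
    rw [this, re_ofReal_mul]; simp
  have h2 := circleAverage_near (g := fun η => (q.eval η).re) (ε := 0) (by fun_prop) hg
    (fun η hη => by
      rw [h1, add_zero]
      refine le_trans (mul_le_mul_of_nonneg_left (sub_le_sub_right ?_ _) hA) (h η hη)
      refine (re_le_norm _).trans ((f.le_opNorm _).trans ?_)
      exact mul_le_of_le_one_left (norm_nonneg _) hf)
  rw [circleAverage_re_polynomial, h1, add_zero] at h2
  simpa [hfz] using h2

/-- The glueing of `v` with `A (‖y‖ - 2)`. -/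
def glueNorm {E : Type*} [NormedAddCommGroup E] (v : E → EReal) (A : ℝ) (y : E) : EReal :=
  if ‖y‖ < 2 then max (v y) ((A * (‖y‖ - 2) : ℝ) : EReal) else ((A * (‖y‖ - 2) : ℝ) : EReal)

section
variable {E : Type*} [NormedAddCommGroup E] {v : E → EReal} {A : ℝ}

theorem le_glueNorm (y : E) : ((A * (‖y‖ - 2) : ℝ) : EReal) ≤ glueNorm v A y := by
  unfold glueNorm; split_ifs
  exacts [le_max_right _ _, le_rfl]

theorem le_glueNorm_of_lt {y : E} (hy : ‖y‖ < 2) : v y ≤ glueNorm v A y := by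
  unfold glueNorm; rw [if_pos hy]; exact le_max_left _ _

theorem glueNorm_le (hle : ∀ y, ‖y‖ < 3 → v y ≤ 0) (y : E) :
    glueNorm v A y ≤ ((max 0 (A * (‖y‖ - 2)) : ℝ) : EReal) := by
  unfold glueNorm; split_ifs with h
  · refine max_le ((hle y (by linarith)).trans ?_) ?_
    · exact_mod_cast le_max_left _ _
    · exact_mod_cast le_max_right _ _
  · exact_mod_cast le_max_right _ _

theorem glueNorm_upperSemicontinuous (hA : 0 ≤ A) (husc : UpperSemicontinuousOn v (ball 0 3))
    (hle : ∀ y, ‖y‖ < 3 → v y ≤ 0) : UpperSemicontinuous (glueNorm v A) := by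
  intro y
  rcases lt_or_ge ‖y‖ 2 with hy | hy
  · have ho : IsOpen (ball (0:E) 3) := isOpen_ball
    have hy3 : y ∈ ball (0:E) 3 := by simp; linarith
    have h1 : UpperSemicontinuousAt v y := fun c hc => ho.nhdsWithin_eq hy3 ▸ husc y hy3 c hc
    have hc : Continuous fun x : E => A * (‖x‖ - 2) := by fun_prop
    have h2 : UpperSemicontinuousAt (fun x : E => ((A * (‖x‖ - 2) : ℝ) : EReal)) y :=
      (continuous_coe_real_ereal.comp hc).upperSemicontinuous y
    have h3 := h1.sup h2
    intro c hc'
    have hc2 : v y ⊔ ((A * (‖y‖ - 2) : ℝ) : EReal) < c := by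
      unfold glueNorm at hc'; rwa [if_pos hy] at hc'
    have hn : ∀ᶠ x : E in 𝓝 y, ‖x‖ < 2 := continuous_norm.continuousAt.eventually_lt_const hy
    filter_upwards [h3 c hc2, hn] with x hx hx2
    unfold glueNorm; rwa [if_pos hx2]
  · intro c hc
    unfold glueNorm at hc
    rw [if_neg (not_lt.2 hy)] at hc
    have hcc : Continuous fun x : E => max 0 (A * (‖x‖ - 2)) := by fun_prop
    have h1 := ((continuous_coe_real_ereal.comp hcc).tendsto y).eventually_lt_const (u := c) (by
      simp only [Function.comp]
      rwa [max_eq_right (mul_nonneg hA (by linarith))])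
    filter_upwards [h1] with x hx using (glueNorm_le hle x).trans_lt hx

theorem glueNorm_discMean [NormedSpace ℂ E] (hA : 0 ≤ A)
    (husc : UpperSemicontinuousOn v (ball 0 3)) (hle : ∀ y, ‖y‖ < 3 → v y ≤ 0)
    (hloc : ∀ y, ‖y‖ < 2 → ∀ w, ∀ᶠ r : ℝ in 𝓝[>] 0, ∀ g : ℂ → ℝ, Continuous g →
      (∀ η : ℂ, ‖η‖ = 1 → v (y + ((r:ℂ) * η) • w) ≤ g η) →
        v y ≤ (Real.circleAverage g 0 1 : ℝ)) (z w : E) :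
    DiscMean fun ζ : ℂ => glueNorm v A (z + ζ • w) := by
  have hc : Continuous fun ζ : ℂ => z + ζ • w := by fun_prop
  refine discMean_of_local
    (((glueNorm_upperSemicontinuous hA husc hle).comp hc).upperSemicontinuousOn _)
    (fun ζ => (glueNorm_le hle _).trans_lt (EReal.coe_lt_top _)) fun ζ _ => ?_
  have hnorm : ∀ r : ℝ, ∀ g : ℂ → ℝ, Continuous g →
      (∀ η : ℂ, ‖η‖ = 1 → glueNorm v A (z + (ζ + r * η) • w) ≤ g η) →
      ((A * (‖z + ζ • w‖ - 2) : ℝ) : EReal) ≤ (Real.circleAverage g 0 1 : ℝ) := by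
    intro r g hg h
    refine EReal.coe_le_coe_iff.2
      (affine_norm_le_circleAverage hA (z + ζ • w) ((r:ℂ) • w) hg fun η hη => ?_)
    have h1 := (le_glueNorm (v := v) (A := A) _).trans (h η hη)
    have e : z + (ζ + r * η) • w = z + ζ • w + η • (r:ℂ) • w := by
      rw [add_smul, smul_smul, mul_comm η, add_assoc]
    rw [e] at h1
    exact_mod_cast h1
  rcases lt_or_ge ‖z + ζ • w‖ 2 with hy | hy
  · have hb : ∀ᶠ r : ℝ in 𝓝[>] 0, ‖z + ζ • w‖ + r * ‖w‖ < 2 := by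
      have hcr : Continuous fun r : ℝ => ‖z + ζ • w‖ + r * ‖w‖ := by fun_prop
      exact ((hcr.tendsto 0).eventually_lt_const (by simpa using hy)).filter_mono
        nhdsWithin_le_nhds
    filter_upwards [hloc _ hy w, hb, self_mem_nhdsWithin] with r hr hb hr0 g hg h
    have hr0' : 0 < r := hr0
    conv_lhs => unfold glueNorm
    rw [if_pos hy]
    refine max_le (hr g hg fun η hη => ?_) (hnorm r g hg h)
    have e : z + (ζ + r * η) • w = z + ζ • w + ((r:ℂ) * η) • w := by rw [add_smul, add_assoc]
    rw [← e]
    refine (le_glueNorm_of_lt ?_).trans (h η hη)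
    rw [e]
    refine (norm_add_le _ _).trans_lt ?_
    rw [norm_smul, norm_mul, hη, norm_real, Real.norm_of_nonneg hr0'.le, mul_one]
    exact hb
  · refine Eventually.of_forall fun r g hg h => ?_
    conv_lhs => unfold glueNorm
    rw [if_neg (not_lt.2 hy)]
    exact hnorm r g hg h
end

section
variable {E : Type*} [NormedAddCommGroup E] {W : E → ℝ} {A N : ℝ}

/-- The Lipschitz regularization `sup_x (W x - N ‖x - y‖)`. -/
def supConv (W : E → ℝ) (N : ℝ) (y : E) : ℝ := ⨆ x, (W x - N * ‖x - y‖)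

theorem supConv_bddAbove (hN : 0 ≤ N) (hW : ∀ x, W x ≤ N * ‖x‖) (y : E) :
    BddAbove (range fun x => W x - N * ‖x - y‖) := by
  refine ⟨N * ‖y‖, ?_⟩
  rintro _ ⟨x, rfl⟩
  have h1 : ‖x‖ ≤ ‖x - y‖ + ‖y‖ := norm_le_norm_sub_add x y
  have := mul_le_mul_of_nonneg_left h1 hN
  have := hW x
  simp only; linarith

theorem le_supConv (hN : 0 ≤ N) (hW : ∀ x, W x ≤ N * ‖x‖) (x y : E) :
    W x - N * ‖x - y‖ ≤ supConv W N y := le_ciSup (supConv_bddAbove hN hW y) x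

theorem supConv_le_add (hN : 0 ≤ N) (hW : ∀ x, W x ≤ N * ‖x‖) (y z : E) :
    supConv W N y ≤ supConv W N z + N * ‖y - z‖ := by
  refine ciSup_le fun x => ?_
  have h1 := le_supConv hN hW x z
  have h2 : ‖x - z‖ ≤ ‖x - y‖ + ‖y - z‖ := norm_sub_le_norm_sub_add_norm_sub x y z
  have := mul_le_mul_of_nonneg_left h2 hN
  linarith

theorem supConv_lipschitz (hN : 0 ≤ N) (hW : ∀ x, W x ≤ N * ‖x‖) (y z : E) :
    |supConv W N y - supConv W N z| ≤ N * ‖y - z‖ := by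
  have h1 := supConv_le_add hN hW y z
  have h2 := supConv_le_add hN hW z y
  rw [norm_sub_rev] at h2
  rw [abs_le]; constructor <;> linarith

theorem continuous_supConv (hN : 0 ≤ N) (hW : ∀ x, W x ≤ N * ‖x‖) : Continuous (supConv W N) := by
  have : LipschitzWith ⟨N, hN⟩ (supConv W N) := LipschitzWith.of_dist_le_mul fun y z => by
    rw [Real.dist_eq, dist_eq_norm]; exact supConv_lipschitz hN hW y z
  exact this.continuous
end

theorem subMean_supConv {n : ℕ} {W : (Fin n → ℂ) → ℝ} {N : ℝ} (hN : 0 ≤ N)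
    (hW : ∀ x, W x ≤ N * ‖x‖)
    (hm : ∀ z w : Fin n → ℂ, DiscMean fun ζ : ℂ => ((W (z + ζ • w) : ℝ) : EReal)) :
    SubMean (supConv W N) := by
  intro z w
  have hc := continuous_supConv hN hW
  refine ciSup_le fun x => ?_
  have h1 := hm x w (fun ζ => supConv W N (z + ζ • w) + N * ‖x - z‖) (by fun_prop) (fun ζ _ => by
    have := le_supConv hN hW (x + ζ • w) (z + ζ • w)
    rw [add_sub_add_right_eq_sub] at this
    exact EReal.coe_le_coe_iff.2 (by linarith))
  rw [Real.circleAverage_fun_add (circleIntegrable_of_continuous (by fun_prop) _ _)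
    (circleIntegrable_of_continuous continuous_const _ _), Real.circleAverage_const,
    ← mean_eq_circleAverage] at h1
  have h2 : W (x + (0:ℂ) • w) ≤ _ := EReal.coe_le_coe_iff.1 h1
  rw [zero_smul, add_zero] at h2
  linarith

/-- A negative plurisubharmonic function on the ball of radius `3` has Lipschitz plurisubharmonic
substitutes on the whole space, which are small wherever it is small in a neighbourhood. -/
theorem exists_lipschitz_subMean {n : ℕ} {v : (Fin n → ℂ) → EReal} {C₀ κ ε : ℝ}
    (husc : UpperSemicontinuousOn v (ball 0 3)) (hle : ∀ y, ‖y‖ < 3 → v y ≤ 0)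
    (hloc : ∀ y, ‖y‖ < 2 → ∀ w, ∀ᶠ r : ℝ in 𝓝[>] 0, ∀ g : ℂ → ℝ, Continuous g →
      (∀ η : ℂ, ‖η‖ = 1 → v (y + ((r:ℂ) * η) • w) ≤ g η) →
        v y ≤ (Real.circleAverage g 0 1 : ℝ))
    (h0 : ((-C₀ : ℝ) : EReal) ≤ v 0) (hκ : 0 < κ) (hε : 0 < ε) :
    ∃ (N : ℝ) (φ : (Fin n → ℂ) → ℝ), 0 ≤ N ∧ (∀ x y, |φ x - φ y| ≤ N * ‖x - y‖) ∧ SubMean φ ∧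
      -C₀ ≤ φ 0 ∧ (∀ y, ‖y‖ ≤ 1 → φ y ≤ 0) ∧
      ∀ y, ‖y‖ ≤ 1 / 16 → (∀ x, ‖x - y‖ < ε → v x ≤ ((-κ : ℝ) : EReal)) → φ y ≤ -κ := by
  set δ := min ε (1 / 2) with hδ
  have hδ0 : 0 < δ := lt_min hε (by norm_num)
  set N := κ + κ / δ with hNd
  have hκδ : 0 < κ / δ := by positivity
  have hN : 0 ≤ N := by positivity
  set W : (Fin n → ℂ) → ℝ := fun y => (glueNorm v κ y).toReal with hWd
  have hWc : ∀ y, ((W y : ℝ) : EReal) = glueNorm v κ y := fun y => EReal.coe_toReal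
    (((glueNorm_le hle y).trans_lt (EReal.coe_lt_top _)).ne)
    (((EReal.bot_lt_coe _).trans_le (le_glueNorm y)).ne')
  have hWle : ∀ x, W x ≤ max 0 (κ * (‖x‖ - 2)) := fun x => by
    have := glueNorm_le (A := κ) hle x
    rw [← hWc] at this
    exact_mod_cast this
  have hW1 : ∀ x y : Fin n → ℂ, ‖y‖ ≤ 1 → W x ≤ κ * ‖x - y‖ := by
    intro x y hy
    refine (hWle x).trans (max_le (by positivity) (mul_le_mul_of_nonneg_left ?_ hκ.le))
    have : ‖x‖ ≤ ‖x - y‖ + ‖y‖ := norm_le_norm_sub_add x y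
    linarith
  have hWN : ∀ x, W x ≤ N * ‖x‖ := fun x => by
    have := hW1 x 0 (by simp)
    rw [sub_zero] at this
    refine this.trans (mul_le_mul_of_nonneg_right ?_ (norm_nonneg _))
    rw [hNd]; linarith
  refine ⟨N, supConv W N, hN, supConv_lipschitz hN hWN, subMean_supConv hN hWN fun z w => ?_,
    ?_, fun y hy => ciSup_le fun x => ?_, fun y hy hS => ciSup_le fun x => ?_⟩
  · simp only [hWc]
    exact glueNorm_discMean hκ.le husc hle hloc z w
  · have h1 := le_supConv hN hWN 0 0
    have h2 := h0.trans (le_glueNorm_of_lt (v := v) (A := κ) (y := 0) (by simp))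
    rw [← hWc] at h2
    have h3 : -C₀ ≤ W 0 := by exact_mod_cast h2
    simp at h1; linarith
  · have h1 := hW1 x y hy
    have h2 : 0 ≤ κ / δ * ‖x - y‖ := by positivity
    rw [hNd, add_mul]; linarith
  · have h1 := hW1 x y (by linarith)
    rw [hNd, add_mul]
    rcases lt_or_ge ‖x - y‖ δ with hx | hx
    · have h3 : ‖x‖ ≤ ‖x - y‖ + ‖y‖ := norm_le_norm_sub_add x y
      have h4 : δ ≤ 1 / 2 := min_le_right _ _
      have h5 : glueNorm v κ x ≤ ((-κ : ℝ) : EReal) := by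
        unfold glueNorm
        rw [if_pos (by linarith)]
        refine max_le (hS x (hx.trans_le (min_le_left _ _))) (EReal.coe_le_coe_iff.2 ?_)
        nlinarith
      rw [← hWc] at h5
      have h6 : W x ≤ -κ := by exact_mod_cast h5
      have h2 : 0 ≤ κ / δ * ‖x - y‖ := by positivity
      have h7 : 0 ≤ κ * ‖x - y‖ := by positivity
      linarith
    · have h2 : κ / δ * δ ≤ κ / δ * ‖x - y‖ := by gcongr
      rw [div_mul_cancel₀ _ hδ0.ne'] at h2
      linarith

theorem EReal.add_neg_coe_le_iff {x : EReal} {M a : ℝ} :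
    x + ((-M : ℝ) : EReal) ≤ (a : EReal) ↔ x ≤ ((a + M : ℝ) : EReal) := by
  induction x with
  | bot => simp
  | top =>
    rw [EReal.top_add_coe]
    simp only [top_le_iff, EReal.coe_ne_top]
  | coe x =>
    rw [← EReal.coe_add, EReal.coe_le_coe_iff, EReal.coe_le_coe_iff]
    constructor <;> intro h <;> linarith

/-- Integer polynomials which are exponentially small near the `-∞` set of a plurisubharmonic
function. -/
theorem PSHe.exists_evalCoef_small {n : ℕ} {u : (Fin n → ℂ) → EReal} {U : Set (Fin n → ℂ)}
    (hu : PSHe u U) (hU : IsOpen U) (hne : ∀ z ∈ U, ∃ w ∈ connectedComponentIn U z, u w ≠ ⊥)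
    {a : Fin n → ℂ} (ha : a ∈ U) :
    ∃ O, IsOpen O ∧ a ∈ O ∧ O ⊆ U ∧ ∀ k : ℝ, 0 ≤ k → ∃ G, IsOpen G ∧
      (∀ x ∈ O, u x = ⊥ → x ∈ G) ∧ ∀ ε : ℝ, 0 < ε → ∃ d, 0 < d ∧ ∃ q : (Fin n → Fin d) → ℤ,
        q ≠ 0 ∧ (∀ α, |(q α : ℝ)| ≤ 2 ^ d) ∧
        ∀ z, ball z ε ⊆ G → ‖evalCoef q z‖ ≤ Real.exp (-(k * d)) := by
  obtain ⟨M, hM⟩ : ∃ M : ℝ, u a < M := EReal.lt_iff_exists_real_btwn.1 (hu.2.1 a) |>.imp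
    fun _ h => h.1
  have hev : ∀ᶠ x in 𝓝 a, x ∈ U ∧ u x < M := by
    filter_upwards [hU.mem_nhds ha, (hU.nhdsWithin_eq ha ▸ hu.1 a ha M hM)] with x h1 h2
      using ⟨h1, h2⟩
  obtain ⟨r, hr, hball⟩ := Metric.eventually_nhds_iff_ball.1 hev
  set ρ := r / 8 with hρd
  have hρ : 0 < ρ := by positivity
  obtain ⟨c, hca, hcb⟩ := hu.exists_ne_bot_near hU hne ha (ε := ρ / 16) (by positivity)
  have hin : ∀ x : Fin n → ℂ, ‖x - c‖ < 3 * ρ → x ∈ U ∧ u x < M := by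
    intro x hx
    refine hball x ?_
    have := norm_sub_le_norm_sub_add_norm_sub x c a
    rw [mem_ball, dist_eq_norm]; linarith
  have hsc : ∀ y : Fin n → ℂ, ‖c + (ρ:ℂ) • y - c‖ = ρ * ‖y‖ := fun y => by
    rw [add_sub_cancel_left, norm_smul, norm_real, Real.norm_of_nonneg hρ.le]
  have hin' : ∀ y : Fin n → ℂ, ‖y‖ < 3 → c + (ρ:ℂ) • y ∈ U ∧ u (c + (ρ:ℂ) • y) < M := by
    intro y hy
    refine hin _ ?_
    rw [hsc]; nlinarith
  obtain ⟨m, hm⟩ : ∃ m : ℝ, u c = m := ⟨_, (EReal.coe_toReal (hu.2.1 c).ne hcb).symm⟩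
  have hmM : m < M := by
    have := (hin c (by simp; positivity)).2
    rw [hm] at this; exact_mod_cast this
  set v : (Fin n → ℂ) → EReal := fun y => u (c + (ρ:ℂ) • y) + ((-M : ℝ) : EReal) with hv
  have hOsub : ball c (ρ / 16) ⊆ U := fun x hx => (hin x (by
    rw [mem_ball, dist_eq_norm] at hx; linarith)).1
  refine ⟨ball c (ρ / 16), isOpen_ball, ?_, hOsub, fun k hk => ?_⟩
  · rw [mem_ball, dist_eq_norm, norm_sub_rev]; exact hca
  obtain ⟨κ₀, hκ₀⟩ := exists_coef_exp_small c (ρ := ρ) (C₀ := M - m + 1) (k := k) hρ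
    (by linarith) hk
  set κ := max κ₀ 1 with hκd
  have hκ : 0 < κ := lt_of_lt_of_le one_pos (le_max_right _ _)
  refine ⟨{z | z ∈ ball c (ρ / 16) ∧ u z < ((M - κ : ℝ) : EReal)}, ?_, ?_, fun ε hε => ?_⟩
  · rw [isOpen_iff_mem_nhds]
    rintro z ⟨hz, hz2⟩
    have hzU := hOsub hz
    filter_upwards [isOpen_ball.mem_nhds hz, (hU.nhdsWithin_eq hzU ▸ hu.1 z hzU _ hz2)]
      with x h1 h2 using ⟨h1, h2⟩
  · intro x hx hxb
    exact ⟨hx, by rw [hxb]; exact EReal.bot_lt_coe _⟩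
  obtain ⟨N, φ, hN, hLip, hsub, hφ0, hφ1, hφS⟩ := exists_lipschitz_subMean (v := v)
    (C₀ := M - m) (κ := κ) (ε := ε / ρ) (by
      have hc : Continuous fun y : Fin n → ℂ => c + (ρ:ℂ) • y := by fun_prop
      refine UpperSemicontinuousOn.add' (f := fun y => u (c + (ρ:ℂ) • y))
        (g := fun _ => ((-M : ℝ) : EReal))
        (hu.1.comp hc.continuousOn fun y hy => (hin' y (by simpa using hy)).1)
        (continuous_const.upperSemicontinuous.upperSemicontinuousOn _) fun x _ => ?_
      exact EReal.continuousAt_add (Or.inr (EReal.coe_ne_bot _)) (Or.inr (EReal.coe_ne_top _)))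
    (fun y hy => by
      have := EReal.add_neg_coe_le_iff (x := u (c + (ρ:ℂ) • y)) (M := M) (a := 0)
      rw [zero_add] at this
      exact this.2 (hin' y hy).2.le)
    (fun y hy w => by
      filter_upwards [hu.2.2 _ (hin' y (by linarith)).1 ((ρ:ℂ) • w)] with t ht g hg hgh
      have h1 := ht (fun θ => g (exp (θ * I)) + M) (by fun_prop) (fun θ => by
        have h2 := EReal.add_neg_coe_le_iff.1 (hgh (exp (θ * I)) (norm_exp_ofReal_mul_I θ))
        have e : c + (ρ:ℂ) • (y + ((t:ℂ) * exp (θ * I)) • w) =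
            c + (ρ:ℂ) • y + (ofReal t * exp (θ * I)) • (ρ:ℂ) • w := by
          rw [smul_add, smul_comm, add_assoc]
        rwa [e] at h2)
      rw [mean_eq_circleAverage (fun ζ => g ζ + M), Real.circleAverage_fun_add
        (circleIntegrable_of_continuous hg _ _)
        (circleIntegrable_of_continuous continuous_const _ _), Real.circleAverage_const] at h1
      exact EReal.add_neg_coe_le_iff.2 h1)
    (by
      simp only [hv, smul_zero, add_zero, hm]
      rw [← EReal.coe_add, EReal.coe_le_coe_iff]; linarith)
    hκ (by positivity)
  obtain ⟨d, hd, q, hq0, hq, hqS⟩ := hκ₀ {y | ‖y‖ ≤ 1 / 16 ∧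
      ∀ x, ‖x - y‖ < ε / ρ → v x ≤ ((-κ : ℝ) : EReal)} (by
    filter_upwards [exists_entire_of_lipschitz_subMean hN hLip hsub hφ0 hφ1
      (S := {y | ‖y‖ ≤ 1 / 16 ∧ ∀ x, ‖x - y‖ < ε / ρ → v x ≤ ((-κ : ℝ) : EReal)})
      (fun y hy => ⟨by linarith [hy.1], hφS y hy.1 hy.2⟩)] with j hj
    obtain ⟨f, hf1, hf2, hf3, hf4⟩ := hj
    refine ⟨f, hf1, hf2, hf3, fun y hy => (hf4 y hy).trans ?_⟩
    gcongr
    exact le_max_left _ _)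
  refine ⟨d, hd, q, hq0, hq, fun z hz => ?_⟩
  have hz0 := (hz (mem_ball_self hε)).1
  have hρc : (ρ:ℂ) ≠ 0 := by exact_mod_cast hρ.ne'
  set y : Fin n → ℂ := (ρ:ℂ)⁻¹ • (z - c) with hy
  have hzy : c + (ρ:ℂ) • y = z := by rw [hy, smul_inv_smul₀ hρc]; abel
  have hyn : ‖y‖ ≤ 1 / 16 := by
    have h1 := hsc y
    rw [hzy, ← dist_eq_norm] at h1
    have h2 : dist z c < ρ / 16 := hz0
    rw [h1] at h2
    nlinarith
  have h1 := hqS y ⟨hyn, fun x hx => ?_⟩ hyn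
  · rwa [hzy] at h1
  · have hx2 : c + (ρ:ℂ) • x ∈ ball z ε := by
      rw [mem_ball, dist_eq_norm, ← hzy, add_sub_add_left_eq_sub, ← smul_sub, norm_smul, norm_real,
        Real.norm_of_nonneg hρ.le]
      rw [lt_div_iff₀ hρ] at hx; linarith
    refine EReal.add_neg_coe_le_iff.2 ((hz hx2).2.le.trans (le_of_eq ?_))
    congr 1; ring

theorem Polynomial.exists_norm_coeff_le_norm_eval (f : Polynomial ℂ) (k : ℕ)
    (hk : ∀ j < k, f.coeff j = 0) : ∃ ζ : ℂ, ‖ζ‖ = 1 ∧ ‖f.coeff k‖ ≤ ‖f.eval ζ‖ := by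
  obtain ⟨g, rfl⟩ := Polynomial.X_pow_dvd_iff.2 hk
  have h0 : (Polynomial.X ^ k * g).coeff k = g.eval 0 := by
    rw [Polynomial.coeff_X_pow_mul', if_pos le_rfl, Nat.sub_self, Polynomial.coeff_zero_eq_eval_zero]
  have hev : ∀ ζ : ℂ, ‖ζ‖ = 1 → ‖(Polynomial.X ^ k * g).eval ζ‖ = ‖g.eval ζ‖ := fun ζ hζ => by
    simp [hζ]
  obtain ⟨ζ, hζ, hmax⟩ := (isCompact_sphere (0:ℂ) 1).exists_isMaxOn ⟨1, by simp⟩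
    (f := fun ζ => ‖g.eval ζ‖) (by fun_prop)
  have hζ1 : ‖ζ‖ = 1 := by simpa using hζ
  refine ⟨ζ, hζ1, ?_⟩
  rw [h0, hev ζ hζ1]
  exact norm_le_of_circle (F := fun ζ => g.eval ζ) g.differentiable
    (fun η hη => hmax (by simpa using hη)) (by simp)

/-- A nonzero polynomial is at least as large as one of its nonzero coefficients at some point of
the torus. -/
theorem MvPolynomial.exists_norm_coeff_le_norm_eval {n : ℕ} (P : MvPolynomial (Fin n) ℂ)
    (hP : P ≠ 0) : ∃ t : Fin n → ℂ, (∀ i, ‖t i‖ = 1) ∧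
      ∃ α, P.coeff α ≠ 0 ∧ ‖P.coeff α‖ ≤ ‖MvPolynomial.eval t P‖ := by
  induction n with
  | zero =>
    refine ⟨0, fun i => i.elim0, 0, ?_⟩
    obtain ⟨c, rfl⟩ := MvPolynomial.C_surjective (Fin 0) P
    simp at hP ⊢
    exact hP
  | succ n ih =>
    set f := finSuccEquiv ℂ n P with hf
    have hf0 : f ≠ 0 := by simpa [hf] using hP
    obtain ⟨t, ht, α, hα0, hα⟩ := ih (f.coeff f.natTrailingDegree)
      (by simpa [Polynomial.trailingCoeff] using (Polynomial.trailingCoeff_eq_zero.not.2 hf0))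
    obtain ⟨ζ, hζ, hle⟩ := Polynomial.exists_norm_coeff_le_norm_eval (f.map (eval t))
      f.natTrailingDegree (fun j hj => by
        rw [Polynomial.coeff_map, Polynomial.coeff_eq_zero_of_lt_natTrailingDegree hj, map_zero])
    refine ⟨Fin.cons ζ t, fun i => ?_, α.cons f.natTrailingDegree, ?_, ?_⟩
    · refine Fin.cases ?_ (fun i => ?_) i
      · simpa using hζ
      · simpa using ht i
    · rwa [← finSuccEquiv_coeff_coeff]
    · rw [← finSuccEquiv_coeff_coeff, eval_eq_eval_mv_eval', ← hf]
      rw [Polynomial.coeff_map] at hle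
      exact hα.trans hle

theorem MvPolynomial.exists_one_le_norm_aeval {n : ℕ} (P : MvPolynomial (Fin n) ℤ) (hP : P ≠ 0) :
    ∃ t : Fin n → ℂ, (∀ i, ‖t i‖ = 1) ∧ 1 ≤ ‖MvPolynomial.aeval t P‖ := by
  have hinj : Function.Injective (algebraMap ℤ ℂ) := Int.cast_injective
  obtain ⟨t, ht, α, hα0, hα⟩ := exists_norm_coeff_le_norm_eval (map (algebraMap ℤ ℂ) P)
    (fun h => hP (map_injective _ hinj (by rw [h, map_zero])))
  refine ⟨t, ht, ?_⟩
  rw [eval_map, ← aeval_def] at hα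
  refine le_trans ?_ hα
  rw [coeff_map] at hα0 ⊢
  have h1 : P.coeff α ≠ 0 := fun h => hα0 (by rw [h, map_zero])
  have h2 : (1:ℝ) ≤ |((P.coeff α : ℤ) : ℝ)| := by exact_mod_cast Int.one_le_abs h1
  simpa using h2

theorem MvPolynomial.differentiable_aeval_int {n : ℕ} (P : MvPolynomial (Fin n) ℤ)
    (z v : Fin n → ℂ) : Differentiable ℂ fun ζ : ℂ => MvPolynomial.aeval (z + ζ • v) P := by
  induction P using MvPolynomial.induction_on with
  | C a => simp
  | add p q hp hq => simp only [map_add]; exact hp.add hq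
  | mul_X p i hp =>
    simp only [map_mul, aeval_X, Pi.add_apply, Pi.smul_apply, smul_eq_mul]
    exact hp.mul (by fun_prop)

/-- The multivariate polynomial with coefficients `q`. -/
def coefPoly {n d : ℕ} (q : (Fin n → Fin d) → ℤ) : MvPolynomial (Fin n) ℤ :=
  ∑ α, MvPolynomial.monomial (Finsupp.equivFunOnFinite.symm fun i => (α i : ℕ)) (q α)

theorem aeval_coefPoly {n d : ℕ} (q : (Fin n → Fin d) → ℤ) (z : Fin n → ℂ) :
    MvPolynomial.aeval z (coefPoly q) = evalCoef q z := by
  simp only [coefPoly, evalCoef, map_sum]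
  refine Finset.sum_congr rfl fun α _ => ?_
  rw [MvPolynomial.aeval_monomial, Finsupp.prod_fintype _ _ (by simp)]
  simp

theorem coefPoly_ne_zero {n d : ℕ} {q : (Fin n → Fin d) → ℤ} (hq : q ≠ 0) : coefPoly q ≠ 0 := by
  obtain ⟨α, hα⟩ := Function.ne_iff.1 hq
  intro h
  have h1 := congrArg (MvPolynomial.coeff (Finsupp.equivFunOnFinite.symm fun i => (α i : ℕ))) h
  rw [coefPoly, MvPolynomial.coeff_sum] at h1
  simp only [MvPolynomial.coeff_monomial, MvPolynomial.coeff_zero] at h1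
  rw [Finset.sum_eq_single α] at h1
  · rw [if_pos rfl] at h1; exact hα h1
  · intro β _ hβ
    rw [if_neg]
    intro e
    refine hβ (funext fun i => Fin.ext ?_)
    exact congrFun (Finsupp.equivFunOnFinite.symm.injective e) i
  · simp

theorem norm_aeval_coefPoly_le {n d : ℕ} {q : (Fin n → Fin d) → ℤ}
    (hq : ∀ α, |(q α : ℝ)| ≤ 2 ^ d) {Λ : ℝ} (hΛ : 1 ≤ Λ) {z : Fin n → ℂ} (hz : ‖z‖ ≤ Λ) :
    ‖MvPolynomial.aeval z (coefPoly q)‖ ≤ Real.exp (d * (Real.log 2 + n + n * Real.log Λ)) := by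
  rw [aeval_coefPoly]
  refine (norm_evalCoef_le (by positivity) hq hΛ hz).trans ?_
  have h1 : (d:ℝ) ^ n ≤ Real.exp (d * n) := by
    rw [mul_comm, Real.exp_nat_mul]
    gcongr
    linarith [Real.add_one_le_exp (d:ℝ)]
  have h2 : (2:ℝ) ^ d = Real.exp (d * Real.log 2) := by
    rw [Real.exp_nat_mul, Real.exp_log two_pos]
  have h3 : Λ ^ (n * d) = Real.exp (d * (n * Real.log Λ)) := by
    rw [Real.exp_nat_mul, Real.exp_nat_mul, Real.exp_log (by linarith), pow_mul]
  rw [h2, h3]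
  calc _ ≤ Real.exp (d * n) * Real.exp (d * Real.log 2) * Real.exp (d * (n * Real.log Λ)) := by
        gcongr
    _ = _ := by rw [← Real.exp_add, ← Real.exp_add]; congr 1; ring

/-- A product of powers of polynomials whose normalized logarithm is a weighted sum. -/
theorem exists_weighted_prod {n : ℕ} (m : ℕ) (P : ℕ → MvPolynomial (Fin n) ℤ) (d : ℕ → ℕ)
    (hd : ∀ k, 0 < d k) (hP : ∀ k, P k ≠ 0) :
    ∃ (D : ℕ) (Q : MvPolynomial (Fin n) ℤ), 0 < D ∧ Q ≠ 0 ∧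
      ∀ (z : Fin n → ℂ) (b : ℕ → ℝ),
        (∀ k < m, ‖MvPolynomial.aeval z (P k)‖ ≤ Real.exp (d k * b k)) →
        ‖MvPolynomial.aeval z Q‖ ≤ Real.exp (D * ∑ k ∈ Finset.range m, (1 / 2) ^ k * b k) := by
  set D := ∏ k ∈ Finset.range m, d k * 2 ^ k with hD
  have hdvd : ∀ k, ∃ N, k < m → D = d k * 2 ^ k * N := fun k => by
    by_cases hk : k < m
    · obtain ⟨N, hN⟩ := Finset.dvd_prod_of_mem (fun k => d k * 2 ^ k) (Finset.mem_range.2 hk)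
      exact ⟨N, fun _ => hN⟩
    · exact ⟨0, fun h => absurd h hk⟩
  choose N hN using hdvd
  refine ⟨D, ∏ k ∈ Finset.range m, P k ^ N k, Finset.prod_pos fun k _ => by
    have := hd k; positivity, Finset.prod_ne_zero_iff.2 fun k _ => pow_ne_zero _ (hP k), ?_⟩
  intro z b hb
  rw [map_prod, norm_prod, Finset.mul_sum, Real.exp_sum]
  refine Finset.prod_le_prod (fun _ _ => norm_nonneg _) fun k hk => ?_
  have hk' := Finset.mem_range.1 hk
  rw [map_pow, norm_pow]
  refine (pow_le_pow_left₀ (norm_nonneg _) (hb k hk') _).trans (le_of_eq ?_)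
  rw [← Real.exp_nat_mul]
  congr 1
  have h1 : (D:ℝ) = d k * 2 ^ k * N k := by exact_mod_cast hN k hk'
  rw [h1, div_pow, one_pow]
  field_simp

theorem sum_half_pow_le (m : ℕ) : ∑ k ∈ Finset.range m, (1 / 2 : ℝ) ^ k ≤ 2 := by
  have h := Summable.sum_le_tsum (Finset.range m) (fun k _ => by positivity)
    summable_geometric_two
  rwa [tsum_geometric_two] at h

/-- Near a set `A` covered by countably many open sets on which arbitrarily small integer polynomials
exist, there is a sequence of integer polynomials with normalized logarithms tending to `-∞`
locally uniformly near `A`. -/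
theorem exists_polynomial_seq {n : ℕ} {A : Set (Fin n → ℂ)} (O : ℕ → Set (Fin n → ℂ))
    (hAO : A ⊆ ⋃ j, O j)
    (hO : ∀ j, ∀ k : ℝ, 0 ≤ k → ∃ G, IsOpen G ∧ A ∩ O j ⊆ G ∧ ∀ ε : ℝ, 0 < ε → ∃ d, 0 < d ∧
      ∃ q : (Fin n → Fin d) → ℤ, q ≠ 0 ∧ (∀ α, |(q α : ℝ)| ≤ 2 ^ d) ∧
        ∀ z, ball z ε ⊆ G → ‖evalCoef q z‖ ≤ Real.exp (-(k * d))) :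
    ∃ (D : ℕ → ℕ) (Q : ℕ → MvPolynomial (Fin n) ℤ), (∀ i, 0 < D i) ∧ (∀ i, Q i ≠ 0) ∧
      (∀ Λ : ℝ, ∃ B : ℝ, ∀ i (z : Fin n → ℂ), ‖z‖ ≤ Λ → ‖MvPolynomial.aeval z (Q i)‖ ≤ Real.exp (D i * B)) ∧
      ∀ a ∈ A, ∀ T : ℝ, ∃ δ > 0, ∀ᶠ i in atTop, ∀ z ∈ ball a δ,
        ‖MvPolynomial.aeval z (Q i)‖ ≤ Real.exp (D i * T) := by
  have hlev : ∀ k : ℕ, ∃ G, IsOpen G ∧ A ∩ O (Nat.unpair k).1 ⊆ G ∧ ∀ ε : ℝ, 0 < ε → ∃ d, 0 < d ∧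
      ∃ q : (Fin n → Fin d) → ℤ, q ≠ 0 ∧ (∀ α, |(q α : ℝ)| ≤ 2 ^ d) ∧
        ∀ z, ball z ε ⊆ G → ‖evalCoef q z‖ ≤ Real.exp (-((4:ℝ) ^ k * d)) :=
    fun k => hO _ _ (by positivity)
  choose G hGo hGA hG using hlev
  choose d hd q hq0 hq hqG using fun (i k : ℕ) => hG k (1 / (i + 1)) (by positivity)
  choose D Q hD hQ0 hQ using fun i => exists_weighted_prod (i + 1) (fun k => coefPoly (q i k)) (d i)
    (hd i) (fun k => coefPoly_ne_zero (hq0 i k))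
  have hbd : ∀ Λ : ℝ, ∃ B : ℝ, 0 ≤ B ∧ ∀ i k (z : Fin n → ℂ), ‖z‖ ≤ Λ →
      ‖MvPolynomial.aeval z (coefPoly (q i k))‖ ≤ Real.exp (d i k * B) := by
    intro Λ
    refine ⟨Real.log 2 + n + n * Real.log (max 1 Λ), ?_, fun i k z hz =>
      norm_aeval_coefPoly_le (hq i k) (le_max_left _ _) (hz.trans (le_max_right _ _))⟩
    have := Real.log_nonneg (le_max_left 1 Λ)
    have := Real.log_nonneg one_le_two
    positivity
  refine ⟨D, Q, hD, hQ0, fun Λ => ?_, fun a ha T => ?_⟩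
  · obtain ⟨B, hB0, hB⟩ := hbd Λ
    refine ⟨2 * B, fun i z hz => (hQ i z (fun _ => B) fun k _ => hB i k z hz).trans ?_⟩
    gcongr
    rw [← Finset.sum_mul]
    exact mul_le_mul_of_nonneg_right (sum_half_pow_le _) hB0
  · obtain ⟨B, hB0, hB⟩ := hbd (‖a‖ + 1)
    obtain ⟨j, hj⟩ := mem_iUnion.1 (hAO ha)
    obtain ⟨l, hl⟩ := pow_unbounded_of_one_lt (2 * B - T) (one_lt_two (α := ℝ))
    set k₀ := Nat.pair j l with hk₀
    have hk₀l : l ≤ k₀ := Nat.right_le_pair j l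
    have haG : a ∈ G k₀ := hGA k₀ ⟨ha, by rw [hk₀, Nat.unpair_pair]; exact hj⟩
    obtain ⟨r, hr, hrG⟩ := Metric.isOpen_iff.1 (hGo k₀) a haG
    refine ⟨min (r / 2) 1, by positivity, ?_⟩
    have hi1 : ∀ᶠ i : ℕ in atTop, (1:ℝ) / (i + 1) < r / 2 :=
      tendsto_one_div_add_atTop_nhds_zero_nat.eventually_lt_const (by positivity)
    filter_upwards [hi1, eventually_ge_atTop k₀] with i hi hik z hz
    have hz1 : ‖z - a‖ < r / 2 := by
      rw [mem_ball, dist_eq_norm] at hz; exact hz.trans_le (min_le_left _ _)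
    have hz2 : ‖z‖ ≤ ‖a‖ + 1 := by
      rw [mem_ball, dist_eq_norm] at hz
      have := hz.trans_le (min_le_right _ _)
      linarith [norm_le_norm_sub_add z a]
    have hball : ball z (1 / ((i:ℝ) + 1)) ⊆ G k₀ := fun x hx => hrG (by
      rw [mem_ball, dist_eq_norm] at hx ⊢
      have := norm_sub_le_norm_sub_add_norm_sub x z a
      linarith)
    refine (hQ i z (fun k => B - if k = k₀ then B + 4 ^ k₀ else 0) fun k _ => ?_).trans ?_
    · rcases eq_or_ne k k₀ with rfl | hk
      · rw [if_pos rfl, aeval_coefPoly]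
        refine (hqG i _ z hball).trans (le_of_eq ?_)
        congr 1; ring
      · rw [if_neg hk, sub_zero]
        exact hB i k z hz2
    · gcongr
      simp only [mul_sub, Finset.sum_sub_distrib, ← Finset.sum_mul]
      have h1 := mul_le_mul_of_nonneg_right (sum_half_pow_le (i + 1)) hB0
      have h2 : ∑ k ∈ Finset.range (i + 1), (1 / 2 : ℝ) ^ k * (if k = k₀ then B + 4 ^ k₀ else 0) =
          (1 / 2) ^ k₀ * (B + 4 ^ k₀) := by
        rw [Finset.sum_eq_single k₀]
        · rw [if_pos rfl]
        · intro k _ hk; rw [if_neg hk, mul_zero]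
        · intro h; exact absurd (Finset.mem_range.2 (by omega)) h
      rw [h2]
      have h3 : (2:ℝ) ^ l ≤ 2 ^ k₀ := pow_le_pow_right₀ one_le_two hk₀l
      have h4 : (1 / 2 : ℝ) ^ k₀ * 4 ^ k₀ = 2 ^ k₀ := by rw [← mul_pow]; norm_num
      have h5 : 0 ≤ (1 / 2 : ℝ) ^ k₀ * B := by positivity
      rw [mul_add, h4]
      linarith

/-- The normalized logarithm `log ‖Q z‖ / D` of a polynomial. -/
def normLog {n : ℕ} (D : ℕ) (Q : MvPolynomial (Fin n) ℤ) (z : Fin n → ℂ) : EReal :=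
  if MvPolynomial.aeval z Q = 0 then ⊥
  else ((Real.log ‖MvPolynomial.aeval z Q‖ / D : ℝ) : EReal)

theorem normLog_le_iff {n D : ℕ} (hD : 0 < D) {Q : MvPolynomial (Fin n) ℤ} {z : Fin n → ℂ} {c : ℝ} :
    normLog D Q z ≤ c ↔ ‖MvPolynomial.aeval z Q‖ ≤ Real.exp (D * c) := by
  unfold normLog
  split_ifs with h
  · simp [h, Real.exp_nonneg]
  · have hD' : (0:ℝ) < D := by exact_mod_cast hD
    rw [EReal.coe_le_coe_iff, div_le_iff₀ hD', mul_comm, Real.log_le_iff_le_exp (norm_pos_iff.2 h)]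

/-- The upper semicontinuous upper limit of a sequence of functions. -/
def upperLim {X : Type*} [TopologicalSpace X] (ω : ℕ → X → EReal) (z : X) : EReal :=
  limsup (fun p : ℕ × X => ω p.1 p.2) (atTop ×ˢ 𝓝 z)

section
variable {X : Type*} [TopologicalSpace X] {ω : ℕ → X → EReal} {z : X} {c : EReal}

theorem upperLim_le (h : ∀ᶠ p : ℕ × X in atTop ×ˢ 𝓝 z, ω p.1 p.2 ≤ c) : upperLim ω z ≤ c :=
  limsup_le_of_le (h := h)

theorem eventually_lt_of_upperLim_lt (h : upperLim ω z < c) :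
    ∀ᶠ p : ℕ × X in atTop ×ˢ 𝓝 z, ω p.1 p.2 < c := eventually_lt_of_limsup_lt h

theorem upperSemicontinuous_upperLim : UpperSemicontinuous (upperLim ω) := by
  intro z c hc
  obtain ⟨b, hb1, hb2⟩ := exists_between hc
  obtain ⟨p, hp, q, hq, hpq⟩ := eventually_prod_iff.1 (eventually_lt_of_upperLim_lt hb1)
  filter_upwards [hq.eventually_nhds] with x hx
  refine (upperLim_le ?_).trans_lt hb2
  exact eventually_prod_iff.2 ⟨p, hp, q, hx, fun hi _ hy => (hpq hi hy).le⟩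
end

theorem upperLim_normLog_mean {n : ℕ} {D : ℕ → ℕ} {Q : ℕ → MvPolynomial (Fin n) ℤ}
    (hD : ∀ i, 0 < D i) (z v : Fin n → ℂ) {g : ℝ → ℝ} (hg : Continuous g)
    (h : ∀ θ : ℝ, upperLim (fun i => normLog (D i) (Q i)) (z + exp (θ * I) • v) ≤ g θ) :
    upperLim (fun i => normLog (D i) (Q i)) z ≤
      ((1 / (2 * π) * ∫ θ in (0:ℝ)..2 * π, g θ : ℝ) : EReal) := by
  refine EReal.le_of_forall_pos_le_add_coe fun δ hδ => upperLim_le ?_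
  have key : ∀ᶠ p : ℕ × (Fin n → ℂ) in atTop ×ˢ 𝓝 z, ∀ θ ∈ Icc (0:ℝ) (2 * π),
      normLog (D p.1) (Q p.1) (p.2 + exp (θ * I) • v) ≤ ((g θ + δ : ℝ) : EReal) := by
    refine isCompact_Icc.induction_on
      (p := fun s : Set ℝ => ∀ᶠ p : ℕ × (Fin n → ℂ) in atTop ×ˢ 𝓝 z, ∀ θ ∈ s,
        normLog (D p.1) (Q p.1) (p.2 + exp (θ * I) • v) ≤ ((g θ + δ : ℝ) : EReal))
      (by simp) (fun s t hst ht => ht.mono fun p hp θ hθ => hp θ (hst hθ))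
      (fun s t hs ht => (hs.and ht).mono fun p hp θ hθ => hθ.elim (hp.1 θ) (hp.2 θ))
      fun θ _ => ?_
    have h1 : upperLim (fun i => normLog (D i) (Q i)) (z + exp (θ * I) • v) <
        ((g θ + δ / 2 : ℝ) : EReal) :=
      (h θ).trans_lt (EReal.coe_lt_coe_iff.2 (by linarith))
    obtain ⟨p, hp, q, hq, hpq⟩ := eventually_prod_iff.1 (eventually_lt_of_upperLim_lt h1)
    have hc : Continuous fun x : (Fin n → ℂ) × ℝ => x.1 + exp (x.2 * I) • v := by fun_prop
    have h2 : ∀ᶠ x : (Fin n → ℂ) × ℝ in 𝓝 z ×ˢ 𝓝 θ, q (x.1 + exp (x.2 * I) • v) := by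
      rw [← nhds_prod_eq]
      exact (hc.tendsto (z, θ)).eventually hq
    obtain ⟨p1, hp1, q1, hq1, hpq1⟩ := eventually_prod_iff.1 h2
    have h3 : ∀ᶠ t in 𝓝 θ, g θ < g t + δ / 2 :=
      (continuous_const.tendsto θ).eventually_lt ((hg.add continuous_const).tendsto θ)
        (by simpa using hδ)
    refine ⟨{t | q1 t ∧ g θ < g t + δ / 2}, mem_nhdsWithin_of_mem_nhds (hq1.and h3), ?_⟩
    refine eventually_prod_iff.2 ⟨p, hp, p1, hp1, fun hi y hy t ht => ?_⟩
    refine (hpq hi (hpq1 hy ht.1)).le.trans (EReal.coe_le_coe_iff.2 ?_)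
    linarith [ht.2]
  filter_upwards [key] with p hp
  set m := 1 / (2 * π) * ∫ θ in (0:ℝ)..2 * π, g θ with hm
  have hDp : (0:ℝ) < D p.1 := by exact_mod_cast hD p.1
  rw [normLog_le_iff (hD p.1)]
  set F : ℂ → ℂ := fun ζ => MvPolynomial.aeval (p.2 + ζ • v) (Q p.1) with hF
  have hF0 : F 0 = MvPolynomial.aeval p.2 (Q p.1) := by simp [hF]
  rw [← hF0]
  by_cases h0 : F 0 = 0
  · rw [h0, norm_zero]; positivity
  have h4 := log_norm_le_mean (MvPolynomial.differentiable_aeval_int (Q p.1) p.2 v) h0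
    (g := fun θ => D p.1 * (g θ + δ)) (by fun_prop)
    (fun θ hθ => (normLog_le_iff (hD p.1)).1 (hp θ hθ))
  rw [← Real.log_le_iff_le_exp (norm_pos_iff.2 h0)]
  refine h4.trans (le_of_eq ?_)
  rw [intervalIntegral.integral_const_mul, intervalIntegral.integral_add
    (hg.intervalIntegrable _ _) (continuous_const.intervalIntegrable _ _),
    intervalIntegral.integral_const, hm, smul_eq_mul]
  have := Real.pi_ne_zero
  field_simp
  ring

/-- A sequence of integer polynomials with normalized logarithms tending to `-∞` near `A` and
locally bounded above yields a globally defined plurisubharmonic function which is `-∞` on `A`. -/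
theorem exists_global_of_polynomial_seq {n : ℕ} {A : Set (Fin n → ℂ)} (D : ℕ → ℕ)
    (Q : ℕ → MvPolynomial (Fin n) ℤ) (hD : ∀ i, 0 < D i) (hQ : ∀ i, Q i ≠ 0)
    (hB : ∀ Λ : ℝ, ∃ B : ℝ, ∀ i (z : Fin n → ℂ), ‖z‖ ≤ Λ →
      ‖MvPolynomial.aeval z (Q i)‖ ≤ Real.exp (D i * B))
    (hA : ∀ a ∈ A, ∀ T : ℝ, ∃ δ > 0, ∀ᶠ i in atTop, ∀ z ∈ ball a δ,
      ‖MvPolynomial.aeval z (Q i)‖ ≤ Real.exp (D i * T)) :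
    ∃ W : (Fin n → ℂ) → EReal, (∀ S, PSHe W S) ∧ (∀ a ∈ A, W a = ⊥) ∧
      ∀ S, IsOpen S → S.Nonempty → ∃ w ∈ S, W w ≠ ⊥ := by
  set W := upperLim fun i => normLog (D i) (Q i) with hW
  have hbd : ∀ Λ : ℝ, ∃ B : ℝ, ∀ z : Fin n → ℂ, ‖z‖ ≤ Λ → W z ≤ B := by
    intro Λ
    obtain ⟨B, hB⟩ := hB (Λ + 1)
    refine ⟨B, fun z hz => upperLim_le ?_⟩
    have h1 : ∀ᶠ x in 𝓝 z, ‖x‖ < Λ + 1 :=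
      (continuous_norm.tendsto z).eventually_lt_const (by linarith)
    filter_upwards [h1.prod_inr atTop] with p hp
    exact (normLog_le_iff (hD _)).2 (hB _ _ hp.le)
  have hmean : ∀ (z v : Fin n → ℂ) {g : ℝ → ℝ}, Continuous g →
      (∀ θ : ℝ, W (z + exp (θ * I) • v) ≤ g θ) →
      W z ≤ ((1 / (2 * π) * ∫ θ in (0:ℝ)..2 * π, g θ : ℝ) : EReal) :=
    fun z v _ hg h => upperLim_normLog_mean hD z v hg h
  obtain ⟨t, ht⟩ : ∃ t : Fin n → ℂ, 0 ≤ W t := by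
    choose t ht1 ht2 using fun i => (Q i).exists_one_le_norm_aeval (hQ i)
    have htb : ∀ i, t i ∈ closedBall (0 : Fin n → ℂ) 1 := fun i => by
      rw [mem_closedBall_zero_iff]
      exact (pi_norm_le_iff_of_nonneg zero_le_one).2 fun j => (ht1 i j).le
    obtain ⟨s, -, φ, hφ, hs⟩ := (isCompact_closedBall (0 : Fin n → ℂ) 1).tendsto_subseq htb
    refine ⟨s, not_lt.1 fun hlt => ?_⟩
    obtain ⟨c, hc1, hc2⟩ := EReal.lt_iff_exists_real_btwn.1 hlt
    have h1 := (hφ.tendsto_atTop.prodMk hs).eventually (eventually_lt_of_upperLim_lt hc1)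
    obtain ⟨j, hj⟩ := h1.exists
    have h2 := (normLog_le_iff (hD _)).1 hj.le
    have h3 : c < 0 := by exact_mod_cast hc2
    have h4 : (0:ℝ) < D (φ j) := by exact_mod_cast hD _
    have h5 : Real.exp (D (φ j) * c) < 1 :=
      (Real.exp_lt_exp.2 (mul_neg_of_pos_of_neg h4 h3)).trans_eq Real.exp_zero
    exact absurd (ht2 (φ j)) (not_le.2 (h2.trans_lt h5))
  refine ⟨W, fun S => ⟨upperSemicontinuous_upperLim.upperSemicontinuousOn _, fun z => ?_,
    fun z _ v => Eventually.of_forall fun r g hg h => hmean z ((r:ℂ) • v) hg fun θ => ?_⟩,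
    fun a ha => ?_, fun S hS hSn => ?_⟩
  · obtain ⟨B, hB⟩ := hbd ‖z‖
    exact (hB z le_rfl).trans_lt (EReal.coe_lt_top _)
  · rw [smul_smul, mul_comm]; exact h θ
  · refine (EReal.eq_bot_iff_forall_lt _).2 fun T => ?_
    obtain ⟨δ, hδ, hev⟩ := hA a ha (T - 1)
    refine lt_of_le_of_lt (upperLim_le (c := ((T - 1 : ℝ) : EReal)) ?_)
      (EReal.coe_lt_coe_iff.2 (by linarith))
    refine eventually_prod_iff.2 ⟨_, hev, _, ball_mem_nhds a hδ, fun hi y hy => ?_⟩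
    exact (normLog_le_iff (hD _)).2 (hi y hy)
  · by_contra hcon
    push Not at hcon
    obtain ⟨p, hp⟩ := hSn
    obtain ⟨s, hs, hsS⟩ := Metric.isOpen_iff.1 hS p hp
    have hdm : DiscMean fun ζ : ℂ => W (t + ζ • (p - t)) := by
      intro g hg h
      have := hmean t (p - t) (g := fun θ => g (exp (θ * I))) (by fun_prop)
        fun θ => h _ (norm_exp_ofReal_mul_I θ)
      rw [mean_eq_circleAverage] at this
      simpa using this
    obtain ⟨M, hM⟩ := hbd (‖t‖ + ‖p - t‖)
    have hδ : 0 < s / (‖p - t‖ + 1) := by positivity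
    have hbot := hdm.eq_bot (M := M) (fun ζ hζ => hM _ (by
      refine (norm_add_le _ _).trans ?_
      rw [norm_smul, hζ, one_mul])) hδ (fun ζ _ h1 => hcon _ (hsS (by
      rw [mem_ball, dist_eq_norm]
      have e : t + ζ • (p - t) - p = (ζ - 1) • (p - t) := by
        rw [sub_smul, one_smul]; abel
      rw [e, norm_smul]
      rw [lt_div_iff₀ (by positivity)] at h1
      nlinarith [norm_nonneg (ζ - 1)])))
    rw [zero_smul, add_zero] at hbot
    rw [hbot] at ht
    simp at ht

theorem LocPluripolarIn.exists_countable_cover {n : ℕ} {A D : Set (Fin n → ℂ)}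
    (h : LocPluripolarIn A D) :
    ∃ O : ℕ → Set (Fin n → ℂ), A ⊆ ⋃ j, O j ∧
      ∀ j, ∀ k : ℝ, 0 ≤ k → ∃ G, IsOpen G ∧ A ∩ O j ⊆ G ∧ ∀ ε : ℝ, 0 < ε → ∃ d, 0 < d ∧
        ∃ q : (Fin n → Fin d) → ℤ, q ≠ 0 ∧ (∀ α, |(q α : ℝ)| ≤ 2 ^ d) ∧
          ∀ z, ball z ε ⊆ G → ‖evalCoef q z‖ ≤ Real.exp (-(k * d)) := by
  have hloc : ∀ a ∈ A, ∃ O, IsOpen O ∧ a ∈ O ∧ ∀ k : ℝ, 0 ≤ k → ∃ G, IsOpen G ∧ A ∩ O ⊆ G ∧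
      ∀ ε : ℝ, 0 < ε → ∃ d, 0 < d ∧
        ∃ q : (Fin n → Fin d) → ℤ, q ≠ 0 ∧ (∀ α, |(q α : ℝ)| ≤ 2 ^ d) ∧
          ∀ z, ball z ε ⊆ G → ‖evalCoef q z‖ ≤ Real.exp (-(k * d)) := by
    intro a ha
    obtain ⟨U, hU, haU, -, u, hu, hne, hbot⟩ := h a ha
    obtain ⟨O, hO, haO, hOU, hk⟩ := hu.exists_evalCoef_small hU hne haU
    refine ⟨O, hO, haO, fun k hk0 => ?_⟩
    obtain ⟨G, hG, hsub, hε⟩ := hk k hk0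
    exact ⟨G, hG, fun x hx => hsub x hx.2 (hbot x ⟨hx.1, hOU hx.2⟩), hε⟩
  rcases A.eq_empty_or_nonempty with rfl | hne
  · refine ⟨fun _ => ∅, by simp, fun j k _ => ⟨∅, isOpen_empty, by simp, fun ε hε =>
      ⟨1, one_pos, fun _ => 1, ?_, by simp, fun z hz => (hz (mem_ball_self hε)).elim⟩⟩⟩
    exact fun h => one_ne_zero (congrFun h fun _ => 0)
  choose! O hO haO hk using hloc
  obtain ⟨t, htA, htc, htU⟩ := TopologicalSpace.countable_cover_nhdsWithin (s := A) (f := O)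
    fun x hx => mem_nhdsWithin_of_mem_nhds ((hO x hx).mem_nhds (haO x hx))
  have htn : t.Nonempty := by
    obtain ⟨a, ha⟩ := hne
    obtain ⟨x, hx, -⟩ := mem_iUnion₂.1 (htU ha)
    exact ⟨x, hx⟩
  obtain ⟨f, rfl⟩ := htc.exists_eq_range htn
  refine ⟨fun j => O (f j), fun x hx => ?_, fun j => hk _ (htA (mem_range_self j))⟩
  obtain ⟨_, ⟨j, rfl⟩, hj⟩ := mem_iUnion₂.1 (htU hx)
  exact mem_iUnion.2 ⟨j, hj⟩

/-- Josefson–Bedford: in a Stein domain, a set is locally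
pluripolar if and only if it is (globally) pluripolar. -/
theorem locPluripolar_iff_pluripolar
    {n : ℕ} (D A : Set (Fin n → ℂ)) (hD : IsSteinDomain D) (hAD : A ⊆ D) :
    LocPluripolarIn A D ↔ PluripolarIn A D := by
  constructor
  · intro h
    obtain ⟨O, hAO, hO⟩ := h.exists_countable_cover
    obtain ⟨d, Q, hd, hQ, hB, hA⟩ := exists_polynomial_seq O hAO hO
    obtain ⟨W, hW, hWA, hWne⟩ := exists_global_of_polynomial_seq d Q hd hQ hB hA
    exact ⟨W, hW D, fun z hz => hWne _ hD.1.connectedComponentIn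
      ⟨z, mem_connectedComponentIn hz⟩, hWA⟩
  · exact fun h a ha => ⟨D, hD.1, hAD ha, subset_rfl, by rwa [inter_eq_left.2 hAD]⟩

end
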